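/- There exist constants ε₀ > 0 and a, k > 0 such that the following holds. Let G be a finite simple graph with maximum degree at most Δ and let q be an integer such that either (Δ ≥ 125 and q ≥ 1.809Δ) or (Δ ≥ 3 and q ≥ (11/6 − ε₀)Δ). Then the uniform distribution μ over proper q-colourings of G satisfies C-coupling independence with C = a·(qΔ)^k. -/

import Mathlib

open scoped Classical BigOperators

noncomputable section

namespace SpinFormal

variable {V : Type} [Fintype V] [DecidableEq V] {q : ℕ}

/-- `μ` is a probability distribution on the finite type `Ω`. -/
def IsDist {Ω : Type} [Fintype Ω] (μ : Ω → ℝ) : Prop :=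
  (∀ x, 0 ≤ μ x) ∧ ∑ x, μ x = 1

/-- `π` is a coupling of `μ` and `ν`. -/
def IsCoupling {Ω₁ Ω₂ : Type} [Fintype Ω₁] [Fintype Ω₂]
    (π : Ω₁ × Ω₂ → ℝ) (μ : Ω₁ → ℝ) (ν : Ω₂ → ℝ) : Prop :=
  (∀ p, 0 ≤ π p) ∧ (∀ x, ∑ y, π (x, y) = μ x) ∧ (∀ y, ∑ x, π (x, y) = ν y)

/-- 1-Wasserstein distance with respect to a cost `d`. -/
def Wass {Ω₁ Ω₂ : Type} [Fintype Ω₁] [Fintype Ω₂] (d : Ω₁ → Ω₂ → ℝ)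
    (μ : Ω₁ → ℝ) (ν : Ω₂ → ℝ) : ℝ :=
  sInf {c : ℝ | ∃ π : Ω₁ × Ω₂ → ℝ, IsCoupling π μ ν ∧ ∑ p : Ω₁ × Ω₂, π p * d p.1 p.2 = c}

/-- Hamming distance between two configurations, as a real number. -/
def hamming {W : Type} [Fintype W] {α : Type} [DecidableEq α] (σ τ : W → α) : ℝ :=
  ((Finset.univ.filter fun w => σ w ≠ τ w).card : ℝ)

/-- Total variation distance between two functions on a finite type. -/
def tvDist {X : Type} [Fintype X] (μ ν : X → ℝ) : ℝ := (∑ x, |μ x - ν x|) / 2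

/-- The symmetrised edge interaction, as a function on unordered pairs.
When `AE` is symmetric this is just `AE (τ u) (τ v)` on the edge `{u,v}`. -/
def edgeFactor (AE : Fin q → Fin q → ℝ) (τ : V → Fin q) : Sym2 V → ℝ :=
  Sym2.lift ⟨fun u v => (AE (τ u) (τ v) + AE (τ v) (τ u)) / 2, fun u v => by simp [add_comm]⟩

/-- The conditional weight `w^σ(τ)` for the pinning `σ` on `Λ`: products range over
vertices outside `Λ` and edges with at least one endpoint outside `Λ`. -/
def condWeight (G : SimpleGraph V) (AE : Fin q → Fin q → ℝ) (AV : Fin q → ℝ)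
    (Λ : Finset V) (σ τ : V → Fin q) : ℝ :=
  (if ∀ v ∈ Λ, τ v = σ v then (1 : ℝ) else 0)
    * (∏ v ∈ Λᶜ, AV (τ v))
    * ∏ e ∈ Finset.univ.filter
        (fun e : Sym2 V => e ∈ G.edgeSet ∧ ¬ ∀ v ∈ e, v ∈ Λ), edgeFactor AE τ e

/-- The conditional partition function `Z^σ`. -/
def condZ (G : SimpleGraph V) (AE : Fin q → Fin q → ℝ) (AV : Fin q → ℝ)
    (Λ : Finset V) (σ : V → Fin q) : ℝ :=
  ∑ τ : V → Fin q, condWeight G AE AV Λ σ τ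

/-- The conditional Gibbs distribution `μ^σ`. -/
def condDist (G : SimpleGraph V) (AE : Fin q → Fin q → ℝ) (AV : Fin q → ℝ)
    (Λ : Finset V) (σ : V → Fin q) : (V → Fin q) → ℝ :=
  fun τ => condWeight G AE AV Λ σ τ / condZ G AE AV Λ σ

/-- A spin system is permissive if every conditional partition function is positive. -/
def Permissive (G : SimpleGraph V) (AE : Fin q → Fin q → ℝ) (AV : Fin q → ℝ) : Prop :=
  ∀ (Λ : Finset V) (σ : V → Fin q), 0 < condZ G AE AV Λ σ

/-- Marginal of a distribution on configurations at a single vertex. -/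
def marginalAt (μ : (V → Fin q) → ℝ) (u : V) (c : Fin q) : ℝ :=
  ∑ τ : V → Fin q, if τ u = c then μ τ else 0

/-- Marginal probability of a partial configuration `σ` on `Λ`. -/
def margOn (μ : (V → Fin q) → ℝ) (Λ : Finset V) (σ : V → Fin q) : ℝ :=
  ∑ τ : V → Fin q, if ∀ v ∈ Λ, τ v = σ v then μ τ else 0

/-- Two partial configurations on `Λ` differ exactly at the vertex `v ∈ Λ`. -/
def DifferOnlyAt (Λ : Finset V) (σ τ : V → Fin q) (v : V) : Prop :=
  v ∈ Λ ∧ σ v ≠ τ v ∧ ∀ u ∈ Λ, u ≠ v → σ u = τ u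

/-- `C`-coupling independence of the Gibbs distribution of a spin system. -/
def CouplingIndependence (G : SimpleGraph V) (AE : Fin q → Fin q → ℝ)
    (AV : Fin q → ℝ) (C : ℝ) : Prop :=
  ∀ (Λ : Finset V) (σ τ : V → Fin q) (v : V), DifferOnlyAt Λ σ τ v →
    Wass hamming (condDist G AE AV Λ σ) (condDist G AE AV Λ τ) ≤ C

/-- The sphere of radius `ℓ` around `v` in `G` (w.r.t. graph distance). -/
def sphere (G : SimpleGraph V) (v : V) (ℓ : ℕ) : Finset V :=
  Finset.univ.filter fun u => G.Reachable v u ∧ G.dist v u = ℓ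

end SpinFormal

open SpinFormal

/-- The edge interaction of proper colourings. -/
def colAE (q : ℕ) : Fin q → Fin q → ℝ := fun i j => if i = j then 0 else 1

/-- The (trivial) vertex weights of proper colourings. -/
def colAV (q : ℕ) : Fin q → ℝ := fun _ => 1

namespace FlipDynamics

/-- Flip parameters, in units of `10⁻⁴`. -/
def flipParam : ℕ → ℤ
  | 1 => 10000
  | 2 => 3239
  | 3 => 1541
  | 4 => 880
  | 5 => 440
  | 6 => 114
  | _ => 0

/-- The rate at which a Kempe component of size `n` is flipped. -/
def flipProb (n : ℕ) : ℝ := (flipParam n : ℝ) / 10000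

@[simp] lemma flipProb_zero : flipProb 0 = 0 := by norm_num [flipProb, flipParam]
@[simp] lemma flipProb_one : flipProb 1 = 1 := by norm_num [flipProb, flipParam]
lemma flipProb_two : flipProb 2 = 0.3239 := by norm_num [flipProb, flipParam]

lemma flipParam_of_ge {n : ℕ} (h : 7 ≤ n) : flipParam n = 0 := by
  obtain ⟨k, rfl⟩ := Nat.exists_eq_add_of_le h
  rw [Nat.add_comm]; rfl

lemma flipProb_of_ge {n : ℕ} (h : 7 ≤ n) : flipProb n = 0 := by
  simp [flipProb, flipParam_of_ge h]

lemma flipParam_nonneg (n : ℕ) : 0 ≤ flipParam n := by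
  rcases Nat.lt_or_ge n 7 with h | h
  · interval_cases n <;> decide
  · rw [flipParam_of_ge h]

lemma flipParam_anti {m n : ℕ} (hm : 1 ≤ m) (h : m ≤ n) : flipParam n ≤ flipParam m := by
  rcases Nat.lt_or_ge n 7 with h' | h'
  · interval_cases n <;> interval_cases m <;> decide
  · rw [flipParam_of_ge h']; exact flipParam_nonneg m

lemma flipProb_nonneg (n : ℕ) : 0 ≤ flipProb n := by
  unfold flipProb; have := flipParam_nonneg n; positivity

lemma flipProb_anti {m n : ℕ} (hm : 1 ≤ m) (h : m ≤ n) : flipProb n ≤ flipProb m := by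
  unfold flipProb
  have : (flipParam n : ℝ) ≤ flipParam m := by exact_mod_cast flipParam_anti hm h
  linarith

lemma flipProb_le_one (n : ℕ) : flipProb n ≤ 1 := by
  rcases Nat.eq_zero_or_pos n with rfl | h
  · simp
  · simpa using flipProb_anti le_rfl h

lemma mul_flipProb_le_one (n : ℕ) : n * flipProb n ≤ 1 := by
  rcases Nat.lt_or_ge n 7 with h | h
  · interval_cases n <;> norm_num [flipProb, flipParam]
  · simp [flipProb_of_ge h]

/-- The contribution of a pair of components of sizes `a` and `b` to the drift of a colour class,
when flips of the two components are performed at rates `s` and `t`. -/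
def pairCost (a b : ℕ) (s t : ℝ) : ℝ := a * s + b * t - min s t

/-- Integer version of `pairCost`. -/
def pairCostInt (a b : ℕ) (s t : ℤ) : ℤ := a * s + b * t - min s t

/-- Extra charge for pairs of components of sizes `(1,1)`, `(1,2)` and `(2,1)`,
in units of `10⁻⁸`. -/
def chargeInt (a b : ℕ) : ℤ :=
  if a = 1 ∧ b = 1 then 13208325
  else if (a = 1 ∧ b = 2) ∨ (a = 2 ∧ b = 1) then -3766750 else 0

/-- Extra charge for pairs of components of sizes `(1,1)`, `(1,2)` and `(2,1)`. -/
def charge (a b : ℕ) : ℝ := (chargeInt a b : ℝ) / 100000000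

/-- `10⁸` times the drift of a class with two neighbours, the first one carrying the largest
component on one side; `t` tells which one carries the largest component on the other side, and `e`
stands for `η u` in units of `10⁻⁴`. -/
def twoCost (a₁ a₂ b₁ b₂ : ℕ) (t : Bool) (e : ℤ) : ℤ :=
  ((a₂ : ℤ) * 10000 + e) * flipParam (1 + (a₁ + a₂)) +
    ((bif t then (b₂ : ℤ) else b₁) * 10000 + e) * flipParam (1 + (b₁ + b₂)) +
    10000 * pairCostInt a₁ b₁ (flipParam a₁ - flipParam (1 + (a₁ + a₂)))
      (flipParam b₁ - bif t then flipParam (1 + (b₁ + b₂)) else 0) +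
    10000 * pairCostInt a₂ b₂ (flipParam a₂)
      (flipParam b₂ - bif t then 0 else flipParam (1 + (b₁ + b₂))) +
    chargeInt a₁ b₁ + chargeInt a₂ b₂

set_option synthInstance.maxSize 5000 in
set_option synthInstance.maxHeartbeats 200000 in
lemma twoCost_le (t : Bool) : ∀ a₁ < 8, ∀ a₂ < 8, ∀ b₁ < 8, ∀ b₂ < 8,
    a₂ ≤ a₁ → 1 ≤ a₁ → (bif t then b₂ else b₁) ≤ (bif t then b₁ else b₂) →
    1 ≤ (bif t then b₁ else b₂) →
    twoCost a₁ a₂ b₁ b₂ t 0 ≤ 261700000 ∧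
    twoCost a₁ a₂ b₁ b₂ t 475 ≤ 261700000 + 475 * (10000 - 2 * 3522) := by
  cases t <;> decide +kernel

/-- `10⁸` times the drift of a class with one neighbour. -/
def oneCost (a b : ℕ) (e : ℤ) : ℤ :=
  e * flipParam (1 + a) + e * flipParam (1 + b) +
    10000 * pairCostInt a b (flipParam a - flipParam (1 + a)) (flipParam b - flipParam (1 + b)) +
    chargeInt a b

lemma oneCost_le : ∀ a < 8, ∀ b < 8, 1 ≤ a → 1 ≤ b →
    oneCost a b 0 ≤ 80850000 ∧ oneCost a b 475 ≤ 80850000 + 475 * (10000 - 3522) := by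
  decide +kernel

lemma flipParam_min (n : ℕ) : flipParam (min n 7) = flipParam n := by
  rcases le_total n 7 with h | h
  · rw [min_eq_left h]
  · rw [min_eq_right h, flipParam_of_ge h, flipParam_of_ge le_rfl]

lemma chargeInt_min (a b : ℕ) : chargeInt (min a 7) (min b 7) = chargeInt a b := by
  unfold chargeInt
  have h1 (n : ℕ) : min n 7 = 1 ↔ n = 1 := by omega
  have h2 (n : ℕ) : min n 7 = 2 ↔ n = 2 := by omega
  simp only [h1, h2]

lemma twoCost_min {a₁ a₂ b₁ b₂ : ℕ} {t : Bool} (e : ℤ) :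
    twoCost (min a₁ 7) (min a₂ 7) (min b₁ 7) (min b₂ 7) t e = twoCost a₁ a₂ b₁ b₂ t e := by
  have hs (x y : ℕ) : flipParam (1 + (min x 7 + min y 7)) = flipParam (1 + (x + y)) := by
    rcases Nat.lt_or_ge (x + y) 7 with h | h
    · rw [min_eq_left (by omega), min_eq_left (by omega)]
    · rw [flipParam_of_ge (by omega), flipParam_of_ge (by omega)]
  have hm (x y : ℕ) : ((min x 7 : ℕ) : ℤ) * flipParam (1 + (x + y)) =
      x * flipParam (1 + (x + y)) := by
    rcases le_total x 7 with h | h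
    · rw [min_eq_left h]
    · rw [flipParam_of_ge (n := 1 + (x + y)) (by omega)]; simp
  have hm' (x y : ℕ) : ((min y 7 : ℕ) : ℤ) * flipParam (1 + (x + y)) =
      y * flipParam (1 + (x + y)) := by
    rw [add_comm x y]; exact hm y x
  have hp (x : ℕ) : ((min x 7 : ℕ) : ℤ) * flipParam x = x * flipParam x := by
    rcases le_total x 7 with h | h
    · rw [min_eq_left h]
    · rw [flipParam_of_ge h]; simp
  unfold twoCost pairCostInt
  simp only [hs, flipParam_min, chargeInt_min]
  cases t <;> simp only [cond_true, cond_false, add_mul, mul_sub, hm, hm', hp, sub_zero,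
    mul_right_comm _ (10000 : ℤ)]

lemma oneCost_min (a b : ℕ) (e : ℤ) : oneCost (min a 7) (min b 7) e = oneCost a b e := by
  have hs (x : ℕ) : flipParam (1 + min x 7) = flipParam (1 + x) := by
    rcases Nat.lt_or_ge x 7 with h | h
    · rw [min_eq_left (by omega)]
    · rw [flipParam_of_ge (by omega), flipParam_of_ge (by omega)]
  have hm (x : ℕ) : ((min x 7 : ℕ) : ℤ) * flipParam (1 + x) = x * flipParam (1 + x) := by
    rcases le_total x 7 with h | h
    · rw [min_eq_left h]
    · rw [flipParam_of_ge (n := 1 + x) (by omega)]; simp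
  have hp (x : ℕ) : ((min x 7 : ℕ) : ℤ) * flipParam x = x * flipParam x := by
    rcases le_total x 7 with h | h
    · rw [min_eq_left h]
    · rw [flipParam_of_ge h]; simp
  unfold oneCost pairCostInt
  simp only [hs, flipParam_min, chargeInt_min, mul_sub, hm, hp]

lemma pairCost_div (a b : ℕ) (s t : ℤ) :
    pairCost a b (s / 10000) (t / 10000) = (pairCostInt a b s t : ℝ) / 10000 := by
  unfold pairCost pairCostInt
  rw [min_div_div_right (by norm_num)]
  push_cast
  ring

lemma affine_nonpos {K L e E : ℝ} (h0 : L ≤ 0) (h1 : E * K + L ≤ 0) (he : 0 ≤ e) (he' : e ≤ E) :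
    e * K + L ≤ 0 := by
  rcases le_total 0 K with h | h
  · nlinarith
  · nlinarith

lemma oneCost_real {a b : ℕ} (ha : 1 ≤ a) (hb : 1 ≤ b) {e : ℝ} (he : 0 ≤ e) (he' : e ≤ 0.0475) :
    e * flipProb (1 + a) + e * flipProb (1 + b) +
      (pairCost a b (flipProb a - flipProb (1 + a)) (flipProb b - flipProb (1 + b)) + charge a b) ≤
    -1 + e + (1.8085 - 0.3522 * e) := by
  obtain ⟨h0, h1⟩ := oneCost_le (min a 7) (by omega) (min b 7) (by omega) (by omega) (by omega)
  rw [oneCost_min] at h0 h1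
  have hc : pairCost a b (flipProb a - flipProb (1 + a)) (flipProb b - flipProb (1 + b)) =
      (pairCostInt a b (flipParam a - flipParam (1 + a)) (flipParam b - flipParam (1 + b)) : ℝ) /
        10000 := by
    rw [← pairCost_div]; unfold flipProb; push_cast; congr 1 <;> ring
  rw [hc]
  unfold oneCost at h0 h1
  have h0' := (Int.cast_le (R := ℝ)).2 h0
  have h1' := (Int.cast_le (R := ℝ)).2 h1
  push_cast at h0' h1'
  unfold charge flipProb
  have := affine_nonpos
    (K := (flipParam (1 + a) : ℝ) / 10000 + (flipParam (1 + b) : ℝ) / 10000 - 0.6478)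
    (L := (pairCostInt a b (flipParam a - flipParam (1 + a))
      (flipParam b - flipParam (1 + b)) : ℝ) /
        10000 + (chargeInt a b : ℝ) / 100000000 - 0.8085) (e := e) (E := 0.0475)
    (by linarith) (by linarith) he he'
  linarith

lemma twoCost_real {a₁ a₂ b₁ b₂ : ℕ} (t : Bool) (ha : a₂ ≤ a₁) (ha' : 1 ≤ a₁)
    (hb : (bif t then b₂ else b₁) ≤ (bif t then b₁ else b₂)) (hb' : 1 ≤ (bif t then b₁ else b₂))
    {e : ℝ} (he : 0 ≤ e) (he' : e ≤ 0.0475) :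
    (a₂ + e) * flipProb (1 + (a₁ + a₂)) +
      ((bif t then (b₂ : ℝ) else b₁) + e) * flipProb (1 + (b₁ + b₂)) +
      ((pairCost a₁ b₁ (flipProb a₁ - flipProb (1 + (a₁ + a₂)))
        (flipProb b₁ - bif t then flipProb (1 + (b₁ + b₂)) else 0) + charge a₁ b₁) +
      (pairCost a₂ b₂ (flipProb a₂)
        (flipProb b₂ - bif t then 0 else flipProb (1 + (b₁ + b₂))) + charge a₂ b₂)) ≤
    -1 + e + 2 * (1.8085 - 0.3522 * e) := by
  obtain ⟨h0, h1⟩ := twoCost_le t (min a₁ 7) (by omega) (min a₂ 7) (by omega) (min b₁ 7) (by omega)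
    (min b₂ 7) (by omega) (by omega) (by omega) (by cases t <;> simp at hb ⊢ <;> omega)
    (by cases t <;> simp at hb' ⊢ <;> omega)
  rw [twoCost_min] at h0 h1
  have hc : pairCost a₁ b₁ (flipProb a₁ - flipProb (1 + (a₁ + a₂)))
        (flipProb b₁ - bif t then flipProb (1 + (b₁ + b₂)) else 0) =
      (pairCostInt a₁ b₁ (flipParam a₁ - flipParam (1 + (a₁ + a₂)))
        (flipParam b₁ - bif t then flipParam (1 + (b₁ + b₂)) else 0) : ℝ) / 10000 := by
    rw [← pairCost_div]; unfold flipProb; cases t <;> simp only [cond_true, cond_false] <;>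
      push_cast <;> congr 1 <;> ring
  have hc' : pairCost a₂ b₂ (flipProb a₂)
        (flipProb b₂ - bif t then 0 else flipProb (1 + (b₁ + b₂))) =
      (pairCostInt a₂ b₂ (flipParam a₂)
        (flipParam b₂ - bif t then 0 else flipParam (1 + (b₁ + b₂))) : ℝ) / 10000 := by
    rw [← pairCost_div]; unfold flipProb; cases t <;> simp only [cond_true, cond_false] <;>
      push_cast <;> congr 1 <;> ring
  rw [hc, hc']
  unfold twoCost at h0 h1
  have h0' := (Int.cast_le (R := ℝ)).2 h0
  have h1' := (Int.cast_le (R := ℝ)).2 h1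
  push_cast at h0' h1'
  unfold charge flipProb
  generalize hX : (pairCostInt a₁ b₁ (flipParam a₁ - flipParam (1 + (a₁ + a₂)))
        (flipParam b₁ - bif t then flipParam (1 + (b₁ + b₂)) else 0) : ℝ) = X at *
  generalize hX : (pairCostInt a₂ b₂ (flipParam a₂)
        (flipParam b₂ - bif t then 0 else flipParam (1 + (b₁ + b₂))) : ℝ) = Y at *
  have hcast : ((bif t then (b₂ : ℤ) else b₁ : ℤ) : ℝ) = (bif t then (b₂ : ℝ) else b₁) := by
    cases t <;> simp
  rw [hcast] at h0' h1'
  generalize (bif t then (b₂ : ℝ) else b₁) = Z at *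
  have := affine_nonpos (K := (flipParam (1 + (a₁ + a₂)) : ℝ) / 10000 +
      (flipParam (1 + (b₁ + b₂)) : ℝ) / 10000 - 0.2956)
    (L := (a₂ : ℝ) * flipParam (1 + (a₁ + a₂)) / 10000 + Z * flipParam (1 + (b₁ + b₂)) / 10000 +
      X / 10000 + Y / 10000 + (chargeInt a₁ b₁ : ℝ) / 100000000 +
      (chargeInt a₂ b₂ : ℝ) / 100000000 - 2.617) (e := e) (E := 0.0475)
    (by linarith) (by linarith) he he'
  linarith

lemma pairCost_add_charge_le (a b : ℕ) :
    pairCost a b (flipProb a) (flipProb b) + charge a b ≤ 1.31 := by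
  rcases Nat.lt_or_ge a 7 with ha | ha <;> rcases Nat.lt_or_ge b 7 with hb | hb
  · interval_cases a <;> interval_cases b <;>
      norm_num [pairCost, flipProb, flipParam, charge, chargeInt, min_def]
  all_goals
    have hc : charge a b = 0 := by
      unfold charge chargeInt
      rw [if_neg (by omega), if_neg (by omega)]; simp
    have h1 := mul_flipProb_le_one a
    have h2 := mul_flipProb_le_one b
    have h3 := flipProb_nonneg a
    have h4 := flipProb_nonneg b
    unfold pairCost
    rw [hc]
  · rw [flipProb_of_ge hb, min_eq_right h3]; linarith
  · rw [flipProb_of_ge ha, min_eq_left h4]; linarith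
  · rw [flipProb_of_ge ha, flipProb_of_ge hb]; norm_num

lemma sub_two_mul_flipProb_le {n : ℕ} : ((n : ℝ) - 2) * flipProb n ≤ 0.177 := by
  rcases Nat.lt_or_ge n 7 with h | h
  · interval_cases n <;> norm_num [flipProb, flipParam]
  · rw [flipProb_of_ge h]; norm_num

lemma pairCost_sub_le {a b : ℕ} {s t x y : ℝ} (hx : 0 ≤ x) (hy : 0 ≤ y) :
    pairCost a b (s - x) (t - y) ≤ pairCost a b s t - (a - 1) * x - (b - 1) * y := by
  unfold pairCost
  have : min s t ≤ min (s - x) (t - y) + (x + y) := by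
    rw [← min_add_add_right]
    exact min_le_min (by linarith) (by linarith)
  nlinarith

/-- The drift of a colour class is at most linear in the number of neighbours in the class. -/
lemma class_cost_le {ι : Type*} [DecidableEq ι] {N : Finset ι} {a b : ι → ℕ} {w₀ w₁ : ι}
    (h₀ : w₀ ∈ N) (h₁ : w₁ ∈ N) (ha : ∀ w ∈ N, a w ≤ a w₀) (hb : ∀ w ∈ N, b w ≤ b w₁)
    (ha' : 1 ≤ a w₀) (hb' : 1 ≤ b w₁) {A B : ℕ} (hA : A = 1 + ∑ w ∈ N, a w)
    (hB : B = 1 + ∑ w ∈ N, b w) {e : ℝ} (he : 0 ≤ e) (he' : e ≤ 0.0475) :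
    ((A : ℝ) - a w₀ - 1 + e) * flipProb A + ((B : ℝ) - b w₁ - 1 + e) * flipProb B +
      ∑ w ∈ N, (pairCost (a w) (b w) (flipProb (a w) - if w = w₀ then flipProb A else 0)
        (flipProb (b w) - if w = w₁ then flipProb B else 0) + charge (a w) (b w)) ≤
    -1 + e + N.card * (1.8085 - 0.3522 * e) := by
  rcases Nat.lt_or_ge N.card 3 with hN | hN
  · have hpos : 0 < N.card := Finset.card_pos.2 ⟨_, h₀⟩
    rcases (by omega : N.card = 1 ∨ N.card = 2) with h | h
    · obtain ⟨w, rfl⟩ := Finset.card_eq_one.1 h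
      obtain rfl := Finset.mem_singleton.1 h₀
      obtain rfl := Finset.mem_singleton.1 h₁
      have := oneCost_real ha' hb' he he'
      simp only [Finset.sum_singleton] at hA hB ⊢
      subst hA hB
      simp only [if_true, Finset.card_singleton]
      push_cast
      linarith
    · obtain ⟨z, hz, hzN⟩ : ∃ z, z ≠ w₀ ∧ N = {w₀, z} := by
        obtain ⟨x, y, hxy, rfl⟩ := Finset.card_eq_two.1 h
        rcases (by simpa using h₀ : w₀ = x ∨ w₀ = y) with rfl | rfl
        · exact ⟨y, hxy.symm, rfl⟩
        · exact ⟨x, hxy, Finset.pair_comm _ _⟩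
      subst hzN
      rw [Finset.sum_pair hz.symm] at hA hB ⊢
      have haz := ha z (by simp)
      rw [h]
      rcases (by simpa using h₁ : w₁ = w₀ ∨ w₁ = z) with rfl | rfl
      · have hbz := hb z (by simp)
        have := twoCost_real true haz ha' hbz hb' he he'
        subst hA hB
        simp only [cond_true, if_true, if_neg hz] at this ⊢
        push_cast
        simp only [sub_zero] at this ⊢
        linarith
      · have hbz := hb w₀ (by simp)
        have := twoCost_real false haz ha' hbz hb' he he'
        subst hA hB
        simp only [cond_false, if_true, if_neg hz, if_neg hz.symm] at this ⊢
        push_cast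
        simp only [sub_zero] at this ⊢
        linarith
  · have key : ∑ w ∈ N, (pairCost (a w) (b w) (flipProb (a w) - if w = w₀ then flipProb A else 0)
        (flipProb (b w) - if w = w₁ then flipProb B else 0) + charge (a w) (b w)) ≤
        N.card * 1.31 - (a w₀ - 1) * flipProb A - (b w₁ - 1) * flipProb B := by
      calc _ ≤ ∑ w ∈ N, (1.31 - (if w = w₀ then (a w₀ - 1) * flipProb A else 0) -
            (if w = w₁ then (b w₁ - 1) * flipProb B else 0)) := by
            refine Finset.sum_le_sum fun w _ => ?_
            have h1 := pairCost_add_charge_le (a w) (b w)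
            have h2 := pairCost_sub_le (a := a w) (b := b w) (s := flipProb (a w))
              (t := flipProb (b w)) (x := if w = w₀ then flipProb A else 0)
              (y := if w = w₁ then flipProb B else 0)
              (by split_ifs; exacts [flipProb_nonneg _, le_rfl])
              (by split_ifs; exacts [flipProb_nonneg _, le_rfl])
            have h3 : ((a w : ℝ) - 1) * (if w = w₀ then flipProb A else 0) =
                if w = w₀ then (a w₀ - 1) * flipProb A else 0 := by
              split_ifs with h
              · rw [h]
              · simp
            have h4 : ((b w : ℝ) - 1) * (if w = w₁ then flipProb B else 0) =
                if w = w₁ then (b w₁ - 1) * flipProb B else 0 := by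
              split_ifs with h
              · rw [h]
              · simp
            linarith
        _ = _ := by
            simp only [Finset.sum_sub_distrib, Finset.sum_const, nsmul_eq_mul,
              Finset.sum_ite_eq', h₀, h₁, if_true]
    have side {n : ℕ} (x : ℕ) (hx : 1 ≤ x) (hxn : x + 1 ≤ n) :
        ((n : ℝ) - x - 1 + e) * flipProb n - (x - 1) * flipProb n ≤ 0.193 := by
      have h1 := sub_two_mul_flipProb_le (n := n)
      have h2 : flipProb n ≤ 0.3239 := by
        rw [← flipProb_two]; exact flipProb_anti (by norm_num) (by omega)
      have h3 := flipProb_nonneg n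
      have hx' : (1 : ℝ) ≤ x := by exact_mod_cast hx
      nlinarith [mul_nonneg h3 (sub_nonneg.2 hx'), mul_le_mul he' h2 h3 (by norm_num)]
    have hA' := side (a w₀) ha' (n := A) (by
      have := Finset.single_le_sum (f := a) (fun _ _ => Nat.zero_le _) h₀; omega)
    have hB' := side (b w₁) hb' (n := B) (by
      have := Finset.single_le_sum (f := b) (fun _ _ => Nat.zero_le _) h₁; omega)
    have hN' : (3 : ℝ) ≤ N.card := by exact_mod_cast hN
    nlinarith [mul_le_mul_of_nonneg_left he' (by positivity : (0 : ℝ) ≤ N.card)]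

/-- Kantorovich duality on a finite space: the Wasserstein distance is bounded by the largest
difference of expectations of a Lipschitz function. -/
lemma wass_le_of_lipschitz {Ω : Type} [Fintype Ω] {d : Ω → Ω → ℝ} (hd0 : ∀ x, d x x = 0)
    (hd : ∀ x y, 0 ≤ d x y) (htri : ∀ x y z, d x z ≤ d x y + d y z) {μ ν : Ω → ℝ}
    (hμ : IsDist μ) (hν : IsDist ν) {C : ℝ}
    (h : ∀ F : Ω → ℝ, (∀ x y, F x - F y ≤ d x y) → ∑ x, μ x * F x - ∑ x, ν x * F x ≤ C) :
    Wass d μ ν ≤ C := by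
  classical
  by_cases hex : ∃ π : Ω × Ω → ℝ, IsCoupling π μ ν ∧ ∑ p : Ω × Ω, π p * d p.1 p.2 ≤ C
  · obtain ⟨π, hπ, hc⟩ := hex
    refine le_trans ?_ hc
    unfold Wass
    refine csInf_le ⟨0, ?_⟩ ⟨π, hπ, rfl⟩
    rintro _ ⟨ρ, hρ, rfl⟩
    exact Finset.sum_nonneg fun p _ => mul_nonneg (hρ.1 p) (hd _ _)
  exfalso
  let T : (Ω × Ω → ℝ) →ₗ[ℝ] (Ω → ℝ) × (Ω → ℝ) × ℝ :=
    { toFun := fun π => (fun x => ∑ y, π (x, y), fun y => ∑ x, π (x, y),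
        ∑ p : Ω × Ω, π p * d p.1 p.2)
      map_add' := fun π ρ => by
        simp only [Pi.add_apply, Finset.sum_add_distrib, add_mul]; rfl
      map_smul' := fun c π => by
        simp only [Pi.smul_apply, smul_eq_mul, mul_assoc, ← Finset.mul_sum]; rfl }
  have hTc : Continuous T := LinearMap.continuous_of_finiteDimensional T
  have hK : IsCompact (T '' stdSimplex ℝ (Ω × Ω)) := (isCompact_stdSimplex ℝ (Ω × Ω)).image hTc
  have hKc : Convex ℝ (T '' stdSimplex ℝ (Ω × Ω)) := (convex_stdSimplex ℝ _).linear_image T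
  let S : Set ((Ω → ℝ) × (Ω → ℝ) × ℝ) := {μ} ×ˢ ({ν} ×ˢ Set.Iic C)
  have hS : IsClosed S := isClosed_singleton.prod (isClosed_singleton.prod isClosed_Iic)
  have hSc : Convex ℝ S :=
    (convex_singleton μ).prod ((convex_singleton ν).prod (convex_Iic C))
  have hdisj : Disjoint (T '' stdSimplex ℝ (Ω × Ω)) S := by
    rw [Set.disjoint_left]
    rintro _ ⟨π, hπ, rfl⟩ ⟨h1, h2, h3⟩
    exact hex ⟨π, ⟨hπ.1, fun x => congrFun h1 x, fun y => congrFun h2 y⟩, h3⟩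
  obtain ⟨f, u, v, hu, huv, hv⟩ := geometric_hahn_banach_compact_closed hKc hK hSc hS hdisj
  set φ : Ω → ℝ := fun x => f (Pi.single x 1, 0, 0) with hφ
  set γ : Ω → ℝ := fun y => f (0, Pi.single y 1, 0) with hγ
  set s : ℝ := -f (0, 0, 1) with hs
  have hfφ (m : Ω → ℝ) : f (m, 0, 0) = ∑ x, m x * φ x := by
    have := LinearMap.pi_apply_eq_sum_univ
      (f.toLinearMap ∘ₗ LinearMap.inl ℝ (Ω → ℝ) ((Ω → ℝ) × ℝ)) m
    simp only [LinearMap.comp_apply, LinearMap.inl_apply, ContinuousLinearMap.coe_coe,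
      smul_eq_mul] at this
    rw [show ((m, 0, 0) : (Ω → ℝ) × (Ω → ℝ) × ℝ) = (m, 0) from rfl, this]
    refine Finset.sum_congr rfl fun x _ => ?_
    rw [hφ]
    congr 3
    ext y
    simp [Pi.single_apply, eq_comm]
  have hfγ (m : Ω → ℝ) : f (0, m, 0) = ∑ x, m x * γ x := by
    have := LinearMap.pi_apply_eq_sum_univ
      (f.toLinearMap ∘ₗ LinearMap.inr ℝ (Ω → ℝ) ((Ω → ℝ) × ℝ) ∘ₗ LinearMap.inl ℝ (Ω → ℝ) ℝ) m
    simp only [LinearMap.comp_apply, LinearMap.inl_apply, LinearMap.inr_apply,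
      ContinuousLinearMap.coe_coe, smul_eq_mul] at this
    rw [this]
    refine Finset.sum_congr rfl fun x _ => ?_
    rw [hγ]
    congr 4
    ext y
    simp [Pi.single_apply, eq_comm]
  have hf (a b : Ω → ℝ) (c : ℝ) :
      f (a, b, c) = ∑ x, a x * φ x + ∑ y, b y * γ y - c * s := by
    have h1 : ((a, b, c) : (Ω → ℝ) × (Ω → ℝ) × ℝ) = (a, 0, 0) + (0, b, 0) + c • (0, 0, 1) := by
      simp
    rw [h1, map_add, map_add, map_smul, hfφ, hfγ, hs, smul_eq_mul]
    ring
  have hpair (x y : Ω) : φ x + γ y - d x y * s < u := by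
    have h1 := hu (T (Pi.single (x, y) 1)) ⟨_, single_mem_stdSimplex ℝ (x, y), rfl⟩
    have h2 : T (Pi.single (x, y) 1) = (Pi.single x 1, Pi.single y 1, d x y) := by
      refine Prod.ext ?_ (Prod.ext ?_ ?_)
      · ext z
        by_cases hz : z = x
        · subst hz
          simp [T, Pi.single_apply]
          exact Finset.card_eq_one.2 ⟨_, by ext; simp; rfl⟩
        · simp [T, Pi.single_apply, hz]
      · ext z
        by_cases hz : z = y
        · subst hz
          simp [T, Pi.single_apply]
          exact Finset.card_eq_one.2 ⟨_, by ext; simp; rfl⟩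
        · simp [T, Pi.single_apply, hz]
      · simp [T, Pi.single_apply]
    rw [h2, hf] at h1
    simpa [Pi.single_apply] using h1
  have hlow (c : ℝ) (hc : c ≤ C) : v < ∑ x, μ x * φ x + ∑ y, ν y * γ y - c * s := by
    rw [← hf]; exact hv _ ⟨rfl, rfl, hc⟩
  have hs0 : 0 ≤ s := by
    by_contra! hneg
    set M := ∑ x, μ x * φ x + ∑ y, ν y * γ y
    have h1 := hlow (min C ((M - v) / s)) (min_le_left _ _)
    have h2 : (M - v) / s * s = M - v := div_mul_cancel₀ _ hneg.ne
    nlinarith [min_le_right C ((M - v) / s)]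
  have hne : Nonempty Ω := by
    by_contra hemp
    rw [not_nonempty_iff] at hemp
    have := hμ.2
    simp at this
  set F : Ω → ℝ := fun x => Finset.univ.inf' Finset.univ_nonempty fun y => d x y * s - γ y with hF
  have hFlip (x y : Ω) : F x - F y ≤ d x y * s := by
    obtain ⟨z, -, hz⟩ := Finset.exists_mem_eq_inf' (Finset.univ_nonempty (α := Ω))
      (fun z => d y z * s - γ z)
    have h1 : F x ≤ d x z * s - γ z := Finset.inf'_le _ (Finset.mem_univ z)
    have h2 : F y = d y z * s - γ z := hz
    nlinarith [htri x y z]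
  have hFφ (x : Ω) : φ x - u ≤ F x := by
    refine (Finset.le_inf'_iff _ _).2 fun y _ => ?_
    linarith [hpair x y]
  have hFγ (y : Ω) : F y ≤ -γ y := by
    have : F y ≤ d y y * s - γ y := Finset.inf'_le _ (Finset.mem_univ y)
    simpa [hd0] using this
  have h1 : ∑ x, μ x * φ x - u ≤ ∑ x, μ x * F x := by
    have : ∑ x, μ x * (φ x - u) ≤ ∑ x, μ x * F x :=
      Finset.sum_le_sum fun x _ => mul_le_mul_of_nonneg_left (hFφ x) (hμ.1 x)
    simpa [mul_sub, Finset.sum_sub_distrib, ← Finset.sum_mul, hμ.2] using this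
  have h2 : ∑ x, ν x * F x ≤ -∑ x, ν x * γ x := by
    rw [← Finset.sum_neg_distrib]
    exact Finset.sum_le_sum fun x _ => by
      rw [← mul_neg]; exact mul_le_mul_of_nonneg_left (hFγ x) (hν.1 x)
  have h3 := hlow C le_rfl
  have hgap : 0 < ∑ x, μ x * F x - ∑ x, ν x * F x - C * s := by linarith
  have scale (k : ℝ) (hk : 0 ≤ k) (hks : k * s ≤ 1) :
      k * (∑ x, μ x * F x - ∑ x, ν x * F x) ≤ C := by
    have := h (fun x => k * F x) fun x y => by
      have h4 := mul_le_mul_of_nonneg_left (hFlip x y) hk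
      have h5 := mul_le_mul_of_nonneg_left hks (hd x y)
      nlinarith
    simpa only [mul_left_comm _ k, ← Finset.mul_sum, ← mul_sub] using this
  rcases hs0.eq_or_lt with h0 | h0
  · rw [← h0] at hgap scale
    simp only [mul_zero, sub_zero] at hgap scale
    have := scale ((|C| + 1) / (∑ x, μ x * F x - ∑ x, ν x * F x)) (by positivity) zero_le_one
    rw [div_mul_cancel₀ _ hgap.ne'] at this
    linarith [le_abs_self C]
  · have := scale s⁻¹ (by positivity) (inv_mul_cancel₀ h0.ne').le
    rw [inv_mul_le_iff₀ h0] at this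
    linarith

set_option linter.unusedSectionVars false

variable {V : Type} [Fintype V] [DecidableEq V] {q : ℕ} (G : SimpleGraph V)

/-- Adjacency between a vertex of colour `a` and a vertex of colour `b`. -/
def AltAdj (X : V → Fin q) (a b : Fin q) (s t : V) : Prop :=
  G.Adj s t ∧ ((X s = a ∧ X t = b) ∨ (X s = b ∧ X t = a))

/-- The Kempe component of `u` for the colours `X u` and `c`. -/
def kempe (X : V → Fin q) (u : V) (c : Fin q) : Finset V :=
  Finset.univ.filter fun w => Relation.ReflTransGen (AltAdj G X (X u) c) u w

/-- The colouring obtained by exchanging the two colours in a Kempe component. -/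
def flip (X : V → Fin q) (u : V) (c : Fin q) : V → Fin q :=
  fun w => if w ∈ kempe G X u c then Equiv.swap (X u) c (X w) else X w

/-- The colourings obtained from `X` by flipping one Kempe component. -/
def flips (X : V → Fin q) : Finset (V → Fin q) :=
  Finset.univ.filter fun Z => ∃ u, Z u ≠ X u ∧ Z = flip G X u (Z u)

/-- The set of vertices where two colourings differ. -/
def diff (X Z : V → Fin q) : Finset V := Finset.univ.filter fun u => Z u ≠ X u

/-- The number of disagreements, replaced by `7` if some vertex of `Λ` is concerned. -/
def effSize (Λ : Finset V) (X Z : V → Fin q) : ℕ :=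
  if Disjoint (diff X Z) Λ then (diff X Z).card else 7

/-- The rate of the transition from `X` to `Z`. -/
def rate (Λ : Finset V) (X Z : V → Fin q) : ℝ := flipProb (effSize Λ X Z)

/-- The generator of the flip dynamics with pinned vertices `Λ`. -/
def drift (Λ : Finset V) (F : (V → Fin q) → ℝ) (X : V → Fin q) : ℝ :=
  ∑ Z ∈ flips G X, rate Λ X Z * (F Z - F X)

variable {G} {X Y Z : V → Fin q} {u v w : V} {a b c : Fin q} {Λ : Finset V}

lemma AltAdj.symm {s t : V} (h : AltAdj G X a b s t) : AltAdj G X a b t s :=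
  ⟨h.1.symm, h.2.elim (fun h => Or.inr ⟨h.2, h.1⟩) fun h => Or.inl ⟨h.2, h.1⟩⟩

lemma altAdj_comm : AltAdj G X a b = AltAdj G X b a := by
  ext s t; unfold AltAdj; tauto

lemma mem_kempe : w ∈ kempe G X u c ↔ Relation.ReflTransGen (AltAdj G X (X u) c) u w := by
  simp [kempe]

lemma self_mem_kempe : u ∈ kempe G X u c := mem_kempe.2 .refl

lemma mem_kempe_of_altAdj {s t : V} (hs : s ∈ kempe G X u c) (h : AltAdj G X (X u) c s t) :
    t ∈ kempe G X u c := mem_kempe.2 ((mem_kempe.1 hs).tail h)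

lemma kempe_induction {P : V → Prop} (h0 : P u)
    (hs : ∀ s ∈ kempe G X u c, P s → ∀ t, AltAdj G X (X u) c s t → P t) :
    ∀ w ∈ kempe G X u c, P w := by
  intro w hw
  have := mem_kempe.1 hw
  clear hw
  induction this with
  | refl => exact h0
  | tail h1 h2 ih => exact hs _ (mem_kempe.2 h1) ih _ h2

lemma eq_or_eq_of_mem_kempe (hw : w ∈ kempe G X u c) : X w = X u ∨ X w = c := by
  refine kempe_induction (P := fun w => X w = X u ∨ X w = c) (Or.inl rfl) ?_ w hw
  intro s _ _ t h
  rcases h.2 with h | h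
  · exact Or.inr h.2
  · exact Or.inl h.2

lemma rtg_altAdj_symm {s t : V} (h : Relation.ReflTransGen (AltAdj G X a b) s t) :
    Relation.ReflTransGen (AltAdj G X a b) t s :=
  Relation.ReflTransGen.mono (fun _ _ h => AltAdj.symm h) _ _ h.swap

lemma kempe_eq_of_mem (hw : w ∈ kempe G X u c) (hX : X w = X u) :
    kempe G X w c = kempe G X u c := by
  have h := mem_kempe.1 hw
  ext t
  rw [mem_kempe, mem_kempe, hX]
  exact ⟨fun h' => h.trans h', fun h' => (rtg_altAdj_symm h).trans h'⟩

lemma kempe_eq_of_mem' (hw : w ∈ kempe G X u c) (hX : X w = c) :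
    kempe G X w (X u) = kempe G X u c := by
  have h := mem_kempe.1 hw
  ext t
  rw [mem_kempe, mem_kempe, hX, altAdj_comm]
  exact ⟨fun h' => h.trans h', fun h' => (rtg_altAdj_symm h).trans h'⟩

lemma flip_of_notMem (hw : w ∉ kempe G X u c) : flip G X u c w = X w := by simp [flip, hw]

lemma flip_of_eq (hw : w ∈ kempe G X u c) (hX : X w = X u) : flip G X u c w = c := by
  simp [flip, hw, hX]

lemma flip_of_eq' (hw : w ∈ kempe G X u c) (hX : X w = c) : flip G X u c w = X u := by
  simp [flip, hw, hX]

@[simp] lemma flip_self : flip G X u c u = c := flip_of_eq self_mem_kempe rfl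

lemma flip_ne (hc : c ≠ X u) (hw : w ∈ kempe G X u c) : flip G X u c w ≠ X w := by
  rcases eq_or_eq_of_mem_kempe hw with h | h
  · rw [flip_of_eq hw h, h]; exact hc
  · rw [flip_of_eq' hw h, h]; exact hc.symm

lemma diff_flip (hc : c ≠ X u) : diff X (flip G X u c) = kempe G X u c := by
  ext w
  simp only [diff, Finset.mem_filter, Finset.mem_univ, true_and]
  exact ⟨fun h => by by_contra h'; exact h (flip_of_notMem h'), flip_ne hc⟩

lemma kempe_flip_eq (hw : w ∈ kempe G X u c) :
    kempe G X w (flip G X u c w) = kempe G X u c := by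
  rcases eq_or_eq_of_mem_kempe hw with h | h
  · rw [flip_of_eq hw h, kempe_eq_of_mem hw h]
  · rw [flip_of_eq' hw h, kempe_eq_of_mem' hw h]

lemma flip_flip_eq (hw : w ∈ kempe G X u c) : flip G X w (flip G X u c w) = flip G X u c := by
  have hk := kempe_flip_eq hw
  ext1 t
  unfold flip at hk ⊢
  rw [if_pos hw] at hk ⊢
  rw [hk]
  congr 1
  rcases eq_or_eq_of_mem_kempe hw with h | h
  · rw [h, Equiv.swap_apply_left]
  · rw [h, Equiv.swap_apply_right, Equiv.swap_comm]

lemma flip_mem_flips (hc : c ≠ X u) : flip G X u c ∈ flips G X := by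
  simp only [flips, Finset.mem_filter, Finset.mem_univ, true_and]
  exact ⟨u, by simpa using hc, by simp⟩

lemma eq_flip_of_mem_flips (hZ : Z ∈ flips G X) (hw : Z w ≠ X w) : Z = flip G X w (Z w) := by
  simp only [flips, Finset.mem_filter, Finset.mem_univ, true_and] at hZ
  obtain ⟨u, -, hZ⟩ := hZ
  have hmem : w ∈ kempe G X u (Z u) := by
    by_contra h
    exact hw (by rw [hZ, flip_of_notMem h])
  have := flip_flip_eq hmem
  rw [← hZ] at this
  exact this.symm

lemma exists_ne_of_mem_flips (hZ : Z ∈ flips G X) : ∃ u, Z u ≠ X u := by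
  simp only [flips, Finset.mem_filter, Finset.mem_univ, true_and] at hZ
  exact hZ.imp fun _ h => h.1

lemma kempe_congr (hY : ∀ s ∈ kempe G X u c, Y s = X s)
    (hout : ∀ s ∈ kempe G X u c, ∀ t ∉ kempe G X u c, ¬ AltAdj G Y (X u) c s t) :
    kempe G Y u c = kempe G X u c := by
  have hu : Y u = X u := hY u self_mem_kempe
  apply Finset.Subset.antisymm
  · intro w hw
    refine kempe_induction (P := fun w => w ∈ kempe G X u c) self_mem_kempe ?_ w hw
    intro s _ hs t h
    by_contra ht
    rw [hu] at h
    exact hout s hs t ht h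
  · intro w hw
    refine kempe_induction (P := fun w => w ∈ kempe G Y u c) self_mem_kempe ?_ w hw
    intro s hs hs' t h
    refine mem_kempe_of_altAdj hs' ?_
    have ht := mem_kempe_of_altAdj hs h
    rw [hu]
    exact ⟨h.1, by rw [hY s hs, hY t ht]; exact h.2⟩

lemma diff_comm : diff X Z = diff Z X := by
  ext w; simp [diff, eq_comm]

lemma mem_diff : w ∈ diff X Z ↔ Z w ≠ X w := by simp [diff]

lemma effSize_pos (hZ : Z ∈ flips G X) : 1 ≤ effSize Λ X Z := by
  obtain ⟨u, hu⟩ := exists_ne_of_mem_flips hZ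
  unfold effSize
  split_ifs
  · exact Finset.card_pos.2 ⟨u, mem_diff.2 hu⟩
  · norm_num

lemma effSize_of_disjoint (h : Disjoint (diff X Z) Λ) : effSize Λ X Z = (diff X Z).card := if_pos h

lemma effSize_of_not_disjoint (h : ¬ Disjoint (diff X Z) Λ) : effSize Λ X Z = 7 := if_neg h

lemma disjoint_of_effSize_lt (h : effSize Λ X Z < 7) : Disjoint (diff X Z) Λ := by
  by_contra h'
  rw [effSize_of_not_disjoint h'] at h
  exact lt_irrefl _ h

lemma rate_nonneg : 0 ≤ rate Λ X Z := flipProb_nonneg _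

lemma rate_le_one : rate Λ X Z ≤ 1 := flipProb_le_one _

lemma disjoint_of_rate_ne_zero (h : rate Λ X Z ≠ 0) : Disjoint (diff X Z) Λ := by
  by_contra h'
  exact h (by rw [rate, effSize_of_not_disjoint h', flipProb_of_ge le_rfl])

/-- A component of one vertex. -/
lemma kempe_eq_singleton (h : ∀ t, G.Adj u t → X t ≠ c) : kempe G X u c = {u} := by
  ext w
  rw [Finset.mem_singleton]
  refine ⟨fun hw => ?_, fun hw => hw ▸ self_mem_kempe⟩
  refine kempe_induction (P := fun w => w = u) rfl ?_ w hw
  rintro s - rfl t ht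
  rcases ht.2 with h' | h'
  · exact (h t ht.1 h'.2).elim
  · exact (h t ht.1 (h'.2.trans h'.1)).elim

lemma ne_of_kempe_eq_singleton (h : kempe G X u c = {u}) {t : V} (ht : G.Adj u t) :
    X t ≠ c := by
  intro hX
  have : t ∈ kempe G X u c := mem_kempe_of_altAdj self_mem_kempe ⟨ht, Or.inl ⟨rfl, hX⟩⟩
  rw [h, Finset.mem_singleton] at this
  exact ht.ne' this

lemma flip_eq_update (h : ∀ t, G.Adj u t → X t ≠ c) :
    flip G X u c = Function.update X u c := by
  have hk := kempe_eq_singleton (G := G) h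
  ext1 w
  by_cases hw : w = u
  · subst hw; simp
  · rw [Function.update_of_ne hw, flip_of_notMem]
    rw [hk, Finset.mem_singleton]; exact hw

end FlipDynamics

namespace FlipDynamics

set_option linter.unusedSectionVars false

variable {V : Type} [Fintype V] [DecidableEq V] {q : ℕ} {G : SimpleGraph V}
  {X Y Z : V → Fin q} {u v w : V} {a b c i j : Fin q} {Λ : Finset V}

/-- `F` is `1`-Lipschitz for the Hamming distance, for changes outside `Λ`. -/
def HamLip (Λ : Finset V) (F : (V → Fin q) → ℝ) : Prop :=
  ∀ Z Z' : V → Fin q, Disjoint (diff Z Z') Λ → F Z - F Z' ≤ (diff Z Z').card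

lemma HamLip.neg {F : (V → Fin q) → ℝ} (h : HamLip Λ F) : HamLip Λ fun X => -F X := by
  intro Z Z' hd
  rw [diff_comm] at hd ⊢
  have := h Z' Z hd
  linarith

lemma HamLip.sub_le_card {F : (V → Fin q) → ℝ} (h : HamLip Λ F) {T : Finset V}
    (hT : diff Y Z ⊆ T) (hd : Disjoint T Λ) : F Y - F Z ≤ T.card :=
  (h Y Z (hd.mono_left hT)).trans (by exact_mod_cast Finset.card_le_card hT)

lemma kempe_subset_kempe (hY : Y = Function.update X v j) (hw : G.Adj v w) (hc : X w = c)
    (hv : v ∉ kempe G Y w (X v)) :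
    kempe G Y w (X v) ⊆ kempe G X v c := by
  intro s hs
  have hYw : Y w = c := by rw [hY, Function.update_of_ne hw.ne', hc]
  refine kempe_induction (P := fun s => s ∈ kempe G X v c) ?_ ?_ s hs
  · exact mem_kempe_of_altAdj self_mem_kempe ⟨hw, Or.inl ⟨rfl, hc⟩⟩
  · intro s hs hs' t ht
    have hsv : s ≠ v := fun h => hv (h ▸ hs)
    have htv : t ≠ v := by
      rintro rfl
      exact hv (mem_kempe_of_altAdj hs ht)
    refine mem_kempe_of_altAdj hs' ⟨ht.1, ?_⟩
    have := ht.2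
    rw [hYw, hY, Function.update_of_ne hsv, Function.update_of_ne htv] at this
    tauto

lemma eq_or_exists_of_mem_kempe (hY : Y = Function.update X v j) (hc : c ≠ X v)
    (hs : w ∈ kempe G X v c) :
    w = v ∨ ∃ x, G.Adj v x ∧ X x = c ∧ w ∈ kempe G Y x (X v) := by
  refine kempe_induction
    (P := fun w => w = v ∨ ∃ x, G.Adj v x ∧ X x = c ∧ w ∈ kempe G Y x (X v))
    (Or.inl rfl) ?_ w hs
  have start {t : V} (ht : AltAdj G X (X v) c v t) :
      t = v ∨ ∃ x, G.Adj v x ∧ X x = c ∧ t ∈ kempe G Y x (X v) := by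
    rcases ht.2 with h | h
    · exact Or.inr ⟨t, ht.1, h.2, self_mem_kempe⟩
    · exact (hc h.1.symm).elim
  intro s _ hs t ht
  by_cases htv : t = v
  · exact Or.inl htv
  by_cases hsv : s = v
  · subst hsv; exact start ht
  rcases hs with hs | ⟨x, hx, hxc, hsx⟩
  · exact (hsv hs).elim
  · refine Or.inr ⟨x, hx, hxc, mem_kempe_of_altAdj hsx ⟨ht.1, ?_⟩⟩
    have := ht.2
    rw [hY, Function.update_of_ne hsv, Function.update_of_ne htv, Function.update_of_ne hx.ne',
      hxc]
    tauto

lemma notMem_kempe_update (hY : Y = Function.update X v j) (hcj : c ≠ j) (hj : j ≠ X v)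
    (hw : G.Adj v w) (hwc : X w = c) : v ∉ kempe G Y w (X v) := by
  intro h
  have := eq_or_eq_of_mem_kempe h
  rw [hY, Function.update_self, Function.update_of_ne hw.ne', hwc] at this
  exact this.elim (fun h => hcj h.symm) hj

lemma diff_flip_flip_subset (hY : Y = Function.update X v j) (hw : G.Adj v w) (hwc : X w = c)
    (hv : v ∉ kempe G Y w (X v)) :
    diff (flip G X v c) (flip G Y w (X v)) ⊆ kempe G X v c \ kempe G Y w (X v) := by
  have hYw : Y w = c := by rw [hY, Function.update_of_ne hw.ne', hwc]
  have hsub := kempe_subset_kempe hY hw hwc hv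
  intro s hs
  rw [mem_diff] at hs
  rw [Finset.mem_sdiff]
  by_cases hsk : s ∈ kempe G Y w (X v)
  · exfalso
    have hsv : s ≠ v := fun h => hv (h ▸ hsk)
    have hYs : Y s = X s := by rw [hY, Function.update_of_ne hsv]
    apply hs
    rw [flip, if_pos hsk, flip, if_pos (hsub hsk), hYw, hYs, Equiv.swap_comm]
  · refine ⟨?_, hsk⟩
    by_contra hsx
    have hsv : s ≠ v := fun h => hsx (h ▸ self_mem_kempe)
    apply hs
    rw [flip_of_notMem hsk, flip_of_notMem hsx, hY, Function.update_of_ne hsv]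

lemma flip_eq_flip {w w' : V} (hc : Y w = c) (hc' : Y w' = c) {s : V}
    (hs : s ∈ kempe G Y w i) (hs' : s ∈ kempe G Y w' i) : flip G Y w i = flip G Y w' i := by
  rw [← flip_flip_eq hs, ← flip_flip_eq hs']
  congr 1
  rw [flip, if_pos hs, flip, if_pos hs', hc, hc']

/-- The flips of a component touching a `c`-coloured neighbour of `v` and recolouring it to `i`,
which leave `v` unchanged. -/
def sideFlips (G : SimpleGraph V) (Y : V → Fin q) (v : V) (c i : Fin q) : Finset (V → Fin q) :=
  (flips G Y).filter fun Z => Z v = Y v ∧ ∃ w, G.Adj v w ∧ Y w = c ∧ Z w = i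

/-- The `c`-coloured neighbours of `v`. -/
def colNbrs (G : SimpleGraph V) (X : V → Fin q) (v : V) (c : Fin q) : Finset V :=
  Finset.univ.filter fun w => G.Adj v w ∧ X w = c

lemma mem_colNbrs : w ∈ colNbrs G X v c ↔ G.Adj v w ∧ X w = c := by simp [colNbrs]

lemma sideFlips_eq (hc : c ≠ i) : sideFlips G Y v c i =
    ((colNbrs G Y v c).filter fun w => v ∉ kempe G Y w i).image fun w => flip G Y w i := by
  ext Z
  simp only [sideFlips, Finset.mem_filter, Finset.mem_image, mem_colNbrs]
  constructor
  · rintro ⟨hZ, hv, w, hw, hwc, hwi⟩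
    have h := eq_flip_of_mem_flips (w := w) hZ (by rw [hwi, hwc]; exact hc.symm)
    rw [hwi] at h
    refine ⟨w, ⟨⟨hw, hwc⟩, fun hmem => ?_⟩, h.symm⟩
    exact flip_ne (by rw [hwc]; exact hc.symm) hmem (by rw [← h, hv])
  · rintro ⟨w, ⟨⟨hw, hwc⟩, hv⟩, rfl⟩
    exact ⟨flip_mem_flips (by rw [hwc]; exact hc.symm), flip_of_notMem hv, w, hw, hwc, flip_self⟩

/-- A choice of one neighbour in each component met by `sideFlips`. -/
lemma exists_reps (hc : c ≠ i) :
    ∃ R ⊆ colNbrs G Y v c, (∀ w ∈ R, v ∉ kempe G Y w i) ∧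
      (∀ g : (V → Fin q) → ℝ, ∑ Z ∈ sideFlips G Y v c i, g Z = ∑ w ∈ R, g (flip G Y w i)) ∧
      (∀ w ∈ R, ∀ w' ∈ R, w ≠ w' → Disjoint (kempe G Y w i) (kempe G Y w' i)) ∧
      (∀ w ∈ colNbrs G Y v c, v ∉ kempe G Y w i →
        ∃ r ∈ R, kempe G Y w i = kempe G Y r i) := by
  obtain ⟨R, hR, hinj, himg⟩ : ∃ R ⊆ (colNbrs G Y v c).filter (fun w => v ∉ kempe G Y w i),
      Set.InjOn (fun w => flip G Y w i) R ∧
        R.image (fun w => flip G Y w i) = sideFlips G Y v c i := by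
    obtain ⟨R, hR, hb⟩ := Finset.exists_subset_injOn_image_eq_of_surjOn
      ((colNbrs G Y v c).filter (fun w => v ∉ kempe G Y w i) : Finset V)
      (sideFlips G Y v c i) (f := fun w => flip G Y w i) (by
        rw [sideFlips_eq hc, Finset.coe_image]; exact Set.surjOn_image _ _)
    exact ⟨R, by exact_mod_cast hR, hb.1, hb.2⟩
  have hRc : ∀ w ∈ R, G.Adj v w ∧ Y w = c := fun w hw =>
    mem_colNbrs.1 (Finset.mem_filter.1 (hR hw)).1
  refine ⟨R, fun w hw => (Finset.mem_filter.1 (hR hw)).1,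
    fun w hw => (Finset.mem_filter.1 (hR hw)).2, ?_, ?_, ?_⟩
  · intro g
    rw [← himg, Finset.sum_image hinj]
  · intro w hw w' hw' hne
    rw [Finset.disjoint_left]
    intro s hs hs'
    exact hne (hinj hw hw' (flip_eq_flip (hRc w hw).2 (hRc w' hw').2 hs hs'))
  · intro w hw hv
    have : flip G Y w i ∈ R.image (fun w => flip G Y w i) := by
      rw [himg, sideFlips_eq hc]
      exact Finset.mem_image_of_mem _ (Finset.mem_filter.2 ⟨hw, hv⟩)
    obtain ⟨r, hr, hrw⟩ := Finset.mem_image.1 this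
    refine ⟨r, hr, ?_⟩
    rw [← diff_flip (X := Y) (u := w) (by rw [(mem_colNbrs.1 hw).2]; exact hc.symm),
      ← diff_flip (X := Y) (u := r) (by rw [(hRc r hr).2]; exact hc.symm)]
    exact congrArg _ hrw.symm

/-- Sizes of the components chosen by a set of representatives. -/
def repSize (G : SimpleGraph V) (Λ : Finset V) (Y : V → Fin q) (i : Fin q) (R : Finset V) (w : V) :
    ℕ :=
  if w ∈ R then effSize Λ Y (flip G Y w i) else 0

lemma repSize_pos {R : Finset V} (hw : w ∈ R) (h : i ≠ Y w) : 1 ≤ repSize G Λ Y i R w := by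
  rw [repSize, if_pos hw]; exact effSize_pos (flip_mem_flips h)

lemma effSize_flip_of_disjoint (hc : i ≠ Y w) (h : Disjoint (kempe G Y w i) Λ) :
    effSize Λ Y (flip G Y w i) = (kempe G Y w i).card := by
  rw [effSize_of_disjoint (by rwa [diff_flip hc]), diff_flip hc]

lemma disjoint_of_effSize_flip_lt (hc : i ≠ Y w) (h : effSize Λ Y (flip G Y w i) < 7) :
    Disjoint (kempe G Y w i) Λ := by
  rw [← diff_flip hc]; exact disjoint_of_effSize_lt h

end FlipDynamics

namespace FlipDynamics

lemma class_abstract {ι : Type*} [DecidableEq ι] {N : Finset ι} {a b : ι → ℕ} {w₀ w₁ : ι}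
    (h₀ : w₀ ∈ N) (h₁ : w₁ ∈ N) (ha' : 1 ≤ a w₀) (hb' : 1 ≤ b w₁) {A B : ℕ}
    (hA : a w₀ ≤ A) (hB : b w₁ ≤ B) {α β ex g : ι → ℝ} {fA fB x y e : ℝ}
    (h1 : flipProb A ≠ 0 → fA - α w₀ ≤ A - a w₀) (h2 : flipProb B ≠ 0 → β w₁ - fB ≤ B - b w₁)
    (h3 : ∀ w ∈ N, flipProb (a w) ≠ 0 → y - α w ≤ a w)
    (h4 : ∀ w ∈ N, flipProb (b w) ≠ 0 → β w - x ≤ b w)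
    (h5 : ∀ w ∈ N, flipProb (a w) ≠ 0 → flipProb (b w) ≠ 0 →
      β w - α w ≤ 1 - e + ex w + (a w + b w - 1) - g w)
    (hex : ∀ w ∈ N, 0 ≤ ex w) :
    ∃ r : ι → ℝ,
      (∀ w, r w = min (flipProb (a w) - if w = w₀ then flipProb A else 0)
        (flipProb (b w) - if w = w₁ then flipProb B else 0)) ∧ (∀ w ∈ N, 0 ≤ r w) ∧
      flipProb A * (fA - x) + ∑ w ∈ N, flipProb (b w) * (β w - x) -
        (flipProb B * (fB - y) + ∑ w ∈ N, flipProb (a w) * (α w - y)) ≤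
      (flipProb A + flipProb B + ∑ w ∈ N, r w) * (1 - e - (x - y)) +
        (((A : ℝ) - a w₀ - 1 + e) * flipProb A + ((B : ℝ) - b w₁ - 1 + e) * flipProb B +
        ∑ w ∈ N, pairCost (a w) (b w) (flipProb (a w) - if w = w₀ then flipProb A else 0)
        (flipProb (b w) - if w = w₁ then flipProb B else 0)) +
        ∑ w ∈ N, flipProb (b w) * ex w - ∑ w ∈ N, r w * g w := by
  have nn (n : ℕ) := flipProb_nonneg n
  set s : ι → ℝ := fun w => flipProb (a w) - if w = w₀ then flipProb A else 0 with hs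
  set t : ι → ℝ := fun w => flipProb (b w) - if w = w₁ then flipProb B else 0 with ht
  have hs0 (w : ι) : 0 ≤ s w := by
    simp only [hs]
    split_ifs with h
    · rw [h]; linarith [flipProb_anti ha' hA]
    · linarith [nn (a w)]
  have ht0 (w : ι) : 0 ≤ t w := by
    simp only [ht]
    split_ifs with h
    · rw [h]; linarith [flipProb_anti hb' hB]
    · linarith [nn (b w)]
  have hs1 (w : ι) : s w ≤ flipProb (a w) := by
    simp only [hs]; split_ifs <;> linarith [nn A]
  have ht1 (w : ι) : t w ≤ flipProb (b w) := by
    simp only [ht]; split_ifs <;> linarith [nn B]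
  refine ⟨fun w => min (s w) (t w), fun w => rfl, fun w _ => le_min (hs0 w) (ht0 w), ?_⟩
  have e1 : ∑ w ∈ N, flipProb (a w) * (α w - y) =
      flipProb A * (α w₀ - y) - ∑ w ∈ N, s w * (y - α w) := by
    have : ∑ w ∈ N, s w * (y - α w) = ∑ w ∈ N, (flipProb (a w) * (y - α w) -
        if w = w₀ then flipProb A * (y - α w₀) else 0) := by
      refine Finset.sum_congr rfl fun w _ => ?_
      simp only [hs]
      split_ifs with h
      · rw [h]; ring
      · ring
    rw [this, Finset.sum_sub_distrib, Finset.sum_ite_eq', if_pos h₀]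
    have : ∑ w ∈ N, flipProb (a w) * (y - α w) = -∑ w ∈ N, flipProb (a w) * (α w - y) := by
      rw [← Finset.sum_neg_distrib]; exact Finset.sum_congr rfl fun w _ => by ring
    rw [this]; ring
  have e2 : ∑ w ∈ N, flipProb (b w) * (β w - x) =
      flipProb B * (β w₁ - x) + ∑ w ∈ N, t w * (β w - x) := by
    have : ∑ w ∈ N, t w * (β w - x) = ∑ w ∈ N, (flipProb (b w) * (β w - x) -
        if w = w₁ then flipProb B * (β w₁ - x) else 0) := by
      refine Finset.sum_congr rfl fun w _ => ?_
      simp only [ht]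
      split_ifs with h
      · rw [h]; ring
      · ring
    rw [this, Finset.sum_sub_distrib, Finset.sum_ite_eq', if_pos h₁]
    ring
  have hterm : ∑ w ∈ N, s w * (y - α w) + ∑ w ∈ N, t w * (β w - x) ≤
      (∑ w ∈ N, min (s w) (t w)) * (1 - e - (x - y)) + ∑ w ∈ N, pairCost (a w) (b w) (s w) (t w) +
        ∑ w ∈ N, flipProb (b w) * ex w - ∑ w ∈ N, min (s w) (t w) * g w := by
    rw [Finset.sum_mul, ← Finset.sum_add_distrib, ← Finset.sum_add_distrib,
      ← Finset.sum_add_distrib, ← Finset.sum_sub_distrib]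
    refine Finset.sum_le_sum fun w hw => ?_
    have k1 {z : ℝ} (hz0 : 0 ≤ z) (hz : z ≤ s w) : z * (y - α w) ≤ z * a w := by
      rcases hz0.eq_or_lt with h | h
      · rw [← h]; simp
      · exact mul_le_mul_of_nonneg_left
          (h3 w hw fun h' => by linarith [hs1 w]) hz0
    have k2 {z : ℝ} (hz0 : 0 ≤ z) (hz : z ≤ t w) : z * (β w - x) ≤ z * b w := by
      rcases hz0.eq_or_lt with h | h
      · rw [← h]; simp
      · exact mul_le_mul_of_nonneg_left
          (h4 w hw fun h' => by linarith [ht1 w]) hz0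
    have hr0 : 0 ≤ min (s w) (t w) := le_min (hs0 w) (ht0 w)
    have hrs : min (s w) (t w) ≤ s w := min_le_left _ _
    have hrt : min (s w) (t w) ≤ t w := min_le_right _ _
    unfold pairCost
    generalize hr : min (s w) (t w) = r at *
    have k3 := k1 (z := s w - r) (by linarith) (by linarith)
    have k4 := k2 (z := t w - r) (by linarith) (by linarith)
    have k5 : r * (β w - α w) ≤ r * (1 - e + ex w + (a w + b w - 1) - g w) := by
      rcases hr0.eq_or_lt with h | h
      · rw [← h]; simp
      · exact mul_le_mul_of_nonneg_left
          (h5 w hw (fun h' => by linarith [hs1 w]) (fun h' => by linarith [ht1 w])) hr0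
    have k6 : r * ex w ≤ flipProb (b w) * ex w :=
      mul_le_mul_of_nonneg_right (by linarith [ht1 w]) (hex w hw)
    nlinarith
  have l1 : flipProb A * (fA - α w₀) ≤ flipProb A * (A - a w₀) := by
    by_cases h : flipProb A = 0
    · rw [h]; simp
    · exact mul_le_mul_of_nonneg_left (h1 h) (nn A)
  have l2 : flipProb B * (β w₁ - fB) ≤ flipProb B * (B - b w₁) := by
    by_cases h : flipProb B = 0
    · rw [h]; simp
    · exact mul_le_mul_of_nonneg_left (h2 h) (nn B)
  rw [e1, e2]
  nlinarith

/-- The analogue of `class_abstract` for the two colour classes of the disagreement. -/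
lemma half_abstract {ι : Type*} [DecidableEq ι] {N : Finset ι} {a : ι → ℕ} {w₀ : ι}
    (h₀ : w₀ ∈ N) (ha' : 1 ≤ a w₀) {A m : ℕ} (hA : a w₀ + 1 ≤ A) (hm : N.card ≤ m)
    (hA1 : m = 1 → a w₀ = 1 → A = 2) {α : ι → ℝ} {fA x y e : ℝ} (he : 0 ≤ e) (he' : e ≤ 0.0475)
    (h1 : flipProb A ≠ 0 → fA - α w₀ ≤ A - a w₀ - 1)
    (h3 : ∀ w ∈ N, flipProb (a w) ≠ 0 → y - α w ≤ a w) :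
    flipProb A * (fA - x) - ∑ w ∈ N, flipProb (a w) * (α w - y) ≤
      flipProb A * (1 - e - (x - y)) + (-1 + e + m * (1.8085 - 0.3522 * e)) := by
  have nn (n : ℕ) := flipProb_nonneg n
  have l1 : flipProb A * (fA - α w₀) ≤ flipProb A * (A - a w₀ - 1) := by
    by_cases h : flipProb A = 0
    · rw [h]; simp
    · exact mul_le_mul_of_nonneg_left (h1 h) (nn A)
  have l3 (w : ι) (hw : w ∈ N) : flipProb (a w) * (y - α w) ≤ flipProb (a w) * a w := by
    by_cases h : flipProb (a w) = 0
    · rw [h]; simp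
    · exact mul_le_mul_of_nonneg_left (h3 w hw h) (nn _)
  have l4 : ∑ w ∈ N.erase w₀, flipProb (a w) * (y - α w) ≤ m - 1 := by
    calc _ ≤ ∑ w ∈ N.erase w₀, (1 : ℝ) := Finset.sum_le_sum fun w hw =>
          (l3 w (Finset.mem_of_mem_erase hw)).trans (by
            rw [mul_comm]; exact mul_flipProb_le_one _)
      _ ≤ m - 1 := by
          have : ((N.erase w₀).card : ℝ) + 1 ≤ m := by
            exact_mod_cast (Finset.card_erase_add_one h₀).trans_le hm
          simp only [Finset.sum_const, nsmul_eq_mul, mul_one]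
          linarith
  have l5 : ∑ w ∈ N, flipProb (a w) * (α w - y) =
      -(flipProb (a w₀) * (y - α w₀)) - ∑ w ∈ N.erase w₀, flipProb (a w) * (y - α w) := by
    have h : ∑ w ∈ N.erase w₀, flipProb (a w) * (α w - y) =
        -∑ w ∈ N.erase w₀, flipProb (a w) * (y - α w) := by
      rw [← Finset.sum_neg_distrib]
      exact Finset.sum_congr rfl fun w _ => by ring
    rw [← Finset.add_sum_erase N _ h₀, h]
    ring
  have l6 : (flipProb (a w₀) - flipProb A) * (y - α w₀) ≤
      (flipProb (a w₀) - flipProb A) * a w₀ := by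
    have := flipProb_anti ha' (show a w₀ ≤ A by omega)
    by_cases h : flipProb (a w₀) = 0
    · have : flipProb A = 0 := le_antisymm (h ▸ this) (nn A)
      rw [h, this]; simp
    · exact mul_le_mul_of_nonneg_left (h3 w₀ h₀ h) (by linarith)
  rw [l5]
  have key : flipProb A * (A - a w₀ - 1) + (flipProb (a w₀) - flipProb A) * a w₀ -
      flipProb A * (1 - e) + (m - 1) ≤ -1 + e + m * (1.8085 - 0.3522 * e) := by
    have hm1 : 1 ≤ m := (Nat.succ_le_of_lt (Finset.card_pos.2 ⟨w₀, h₀⟩)).trans hm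
    have c1 := mul_flipProb_le_one (a w₀)
    have c2 : ((A : ℝ) - 4) * flipProb A ≤ 0.05 := by
      rcases Nat.lt_or_ge A 7 with h | h
      · interval_cases A <;> norm_num [flipProb, flipParam]
      · rw [flipProb_of_ge h]; norm_num
    have c3 : flipProb A * e ≤ 0.0475 := by
      nlinarith [flipProb_le_one A, nn A]
    have ha1 : (1 : ℝ) ≤ a w₀ := by exact_mod_cast ha'
    have c4 : flipProb A * (4 - 2 - 2 * a w₀) ≤ 0 :=
      mul_nonpos_of_nonneg_of_nonpos (nn A) (by linarith)
    rcases (show m = 1 ∨ 2 ≤ m by omega) with h | h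
    · subst h
      rcases (show a w₀ = 1 ∨ 2 ≤ a w₀ by omega) with h' | h'
      · rw [hA1 rfl h'] at c3 ⊢
        rw [h', flipProb_two] at *
        norm_num at *
        linarith
      · have c5 : a w₀ * flipProb (a w₀) ≤ 0.65 := by
          rcases Nat.lt_or_ge (a w₀) 7 with h | h
          · interval_cases a w₀ <;> norm_num [flipProb, flipParam]
          · rw [flipProb_of_ge h]; norm_num
        push_cast
        linarith
    · have : (2 : ℝ) ≤ m := by exact_mod_cast h
      nlinarith
  linarith

set_option linter.unusedSectionVars false

variable {V : Type} [Fintype V] [DecidableEq V] {q : ℕ} {G : SimpleGraph V}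
  {X Y Z : V → Fin q} {u v w : V} {a b c i j : Fin q} {Λ : Finset V} {Δ : ℕ}

/-- The neighbours `w ∉ Λ` of `v` such that `v` is the only vertex among `w` and its neighbours
which may have one of the colours `i`, `j`. -/
def freeNbrs (G : SimpleGraph V) (Λ : Finset V) (X : V → Fin q) (v : V) (i j : Fin q) : Finset V :=
  Finset.univ.filter fun w => G.Adj v w ∧ w ∉ Λ ∧ (X w ≠ i ∧ X w ≠ j) ∧
    ∀ x, G.Adj w x → x ≠ v → X x ≠ i ∧ X x ≠ j

lemma mem_freeNbrs : w ∈ freeNbrs G Λ X v i j ↔ G.Adj v w ∧ w ∉ Λ ∧ (X w ≠ i ∧ X w ≠ j) ∧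
    ∀ x, G.Adj w x → x ≠ v → X x ≠ i ∧ X x ≠ j := by simp [freeNbrs]

lemma freeNbrs_comm : freeNbrs G Λ X v i j = freeNbrs G Λ X v j i := by
  ext w; simp only [mem_freeNbrs, and_comm (a := _ ≠ i)]

lemma freeNbrs_update : freeNbrs G Λ (Function.update X v a) v i j = freeNbrs G Λ X v i j := by
  ext w
  simp only [mem_freeNbrs]
  refine and_congr_right fun hw => and_congr_right fun _ => ?_
  rw [Function.update_of_ne hw.ne']
  refine and_congr_right fun _ => forall_congr' fun x => forall_congr' fun _ =>
    forall_congr' fun hx => ?_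
  rw [Function.update_of_ne hx]

lemma freeNbrs_subset : freeNbrs G Λ X v i j ⊆ Finset.univ.filter (G.Adj v) := fun w hw => by
  simpa using (mem_freeNbrs.1 hw).1

/-- The length of the edge between `X` and its modification `j` at `v`. -/
def wt (G : SimpleGraph V) (Λ : Finset V) (Δ : ℕ) (X : V → Fin q) (v : V) (j : Fin q) : ℝ :=
  1 - 0.0475 * (freeNbrs G Λ X v (X v) j).card / Δ

lemma wt_update : wt G Λ Δ (Function.update X v j) v (X v) = wt G Λ Δ X v j := by
  rw [wt, freeNbrs_update, Function.update_self, freeNbrs_comm, wt]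

lemma wt_le_one : wt G Λ Δ X v j ≤ 1 := by
  unfold wt
  have : (0 : ℝ) ≤ 0.0475 * (freeNbrs G Λ X v (X v) j).card / Δ := by positivity
  linarith

lemma card_freeNbrs_div_le (hΔ : ∀ v, (Finset.univ.filter (G.Adj v)).card ≤ Δ) :
    ((freeNbrs G Λ X v i j).card : ℝ) / Δ ≤ 1 := by
  have h : (freeNbrs G Λ X v i j).card ≤ Δ := (Finset.card_le_card freeNbrs_subset).trans (hΔ v)
  exact div_le_one_of_le₀ (by exact_mod_cast h) (by positivity)

lemma le_wt (hΔ : ∀ v, (Finset.univ.filter (G.Adj v)).card ≤ Δ) :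
    0.9525 ≤ wt G Λ Δ X v j := by
  have := card_freeNbrs_div_le (Λ := Λ) (X := X) (v := v) (i := X v) (j := j) hΔ
  unfold wt
  rw [mul_div_assoc]
  linarith

/-- `F` is `1`-Lipschitz for the path metric with edge lengths `wt`, for changes outside `Λ`. -/
def WtLip (G : SimpleGraph V) (Λ : Finset V) (Δ : ℕ) (F : (V → Fin q) → ℝ) : Prop :=
  ∀ X v j, v ∉ Λ → j ≠ X v → F X - F (Function.update X v j) ≤ wt G Λ Δ X v j

lemma WtLip.neg {F : (V → Fin q) → ℝ} (h : WtLip G Λ Δ F) : WtLip G Λ Δ fun X => -F X := by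
  intro X v j hv hj
  have := h (Function.update X v j) v (X v) hv (by simpa using hj.symm)
  rw [wt_update, Function.update_idem, Function.update_eq_self] at this
  linarith

lemma WtLip.hamLip {F : (V → Fin q) → ℝ} (h : WtLip G Λ Δ F) : HamLip Λ F := by
  intro Z Z' hd
  induction hn : (diff Z Z').card generalizing Z with
  | zero =>
    have : Z = Z' := by
      ext1 u
      by_contra hu
      have := Finset.card_eq_zero.1 hn ▸ (mem_diff (X := Z) (Z := Z')).2 (fun h => hu h.symm)
      simp at this
    simp [this]
  | succ n ih =>
    obtain ⟨u, hu⟩ := Finset.card_pos.1 (by omega : 0 < (diff Z Z').card)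
    have hu' : Z' u ≠ Z u := mem_diff.1 hu
    have he : diff (Function.update Z u (Z' u)) Z' = (diff Z Z').erase u := by
      ext w
      rw [Finset.mem_erase, mem_diff, mem_diff]
      by_cases hw : w = u
      · subst hw; simp
      · simp [hw]
    have h1 := ih (Function.update Z u (Z' u)) (by
      rw [he]; exact hd.mono_left (Finset.erase_subset _ _)) (by
      rw [he, Finset.card_erase_of_mem hu, hn]; rfl)
    have h2 := h Z u (Z' u) (Finset.disjoint_left.1 hd hu) hu'
    have h3 := wt_le_one (G := G) (Λ := Λ) (Δ := Δ) (X := Z) (v := u) (j := Z' u)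
    push_cast
    linarith

lemma colNbrs_update : colNbrs G (Function.update X v j) v c = colNbrs G X v c := by
  ext w
  simp only [mem_colNbrs]
  refine and_congr_right fun hw => ?_
  rw [Function.update_of_ne hw.ne']

lemma mem_colNbrs_update (hY : Y = Function.update X v j) :
    w ∈ colNbrs G Y v c ↔ G.Adj v w ∧ X w = c := by
  rw [hY, colNbrs_update, mem_colNbrs]

/-- The component of `v` for `X` is made of `v` and of the components of its neighbours for `Y`. -/
lemma kempe_subset_insert (hY : Y = Function.update X v j) (hc : c ≠ X v) {R : Finset V}
    (hR : ∀ w ∈ colNbrs G Y v c, ∃ r ∈ R, kempe G Y w (X v) = kempe G Y r (X v)) :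
    kempe G X v c ⊆ insert v (R.biUnion fun w => kempe G Y w (X v)) := by
  intro s hs
  rw [Finset.mem_insert, Finset.mem_biUnion]
  rcases eq_or_exists_of_mem_kempe hY hc hs with h | ⟨x, hx, hxc, hsx⟩
  · exact Or.inl h
  · obtain ⟨r, hr, hrk⟩ := hR x ((mem_colNbrs_update hY).2 ⟨hx, hxc⟩)
    exact Or.inr ⟨r, hr, hrk ▸ hsx⟩

lemma kempe_eq_insert (hY : Y = Function.update X v j) (hc : c ≠ X v) {R : Finset V}
    (hRs : R ⊆ colNbrs G Y v c)
    (hRv : ∀ w ∈ R, v ∉ kempe G Y w (X v))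
    (hR : ∀ w ∈ colNbrs G Y v c, ∃ r ∈ R, kempe G Y w (X v) = kempe G Y r (X v)) :
    kempe G X v c = insert v (R.biUnion fun w => kempe G Y w (X v)) := by
  refine (kempe_subset_insert hY hc hR).antisymm ?_
  rw [Finset.insert_subset_iff]
  refine ⟨self_mem_kempe, Finset.biUnion_subset.2 fun w hw => ?_⟩
  have := (mem_colNbrs_update hY).1 (hRs hw)
  exact kempe_subset_kempe hY this.1 this.2 (hRv w hw)

lemma rate_flip_eq (hY : Y = Function.update X v j) (hv : v ∉ Λ) (hc : c ≠ X v) {R : Finset V}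
    (hRs : R ⊆ colNbrs G Y v c)
    (hRv : ∀ w ∈ R, v ∉ kempe G Y w (X v))
    (hRd : ∀ w ∈ R, ∀ w' ∈ R, w ≠ w' → Disjoint (kempe G Y w (X v)) (kempe G Y w' (X v)))
    (hR : ∀ w ∈ colNbrs G Y v c, ∃ r ∈ R, kempe G Y w (X v) = kempe G Y r (X v)) :
    rate Λ X (flip G X v c) =
      flipProb (1 + ∑ w ∈ colNbrs G Y v c, repSize G Λ Y (X v) R w) ∧
    (rate Λ X (flip G X v c) ≠ 0 → (kempe G X v c).card =
      1 + ∑ w ∈ colNbrs G Y v c, repSize G Λ Y (X v) R w) := by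
  have hk := kempe_eq_insert hY hc hRs hRv hR
  have hYc (w : V) (hw : w ∈ R) : X v ≠ Y w := by
    have := (mem_colNbrs_update hY).1 (hRs hw)
    rw [hY, Function.update_of_ne this.1.ne', this.2]; exact hc.symm
  have hsum : ∑ w ∈ colNbrs G Y v c, repSize G Λ Y (X v) R w =
      ∑ w ∈ R, effSize Λ Y (flip G Y w (X v)) := by
    simp only [repSize]
    rw [← Finset.sum_filter, Finset.filter_mem_eq_inter, Finset.inter_eq_right.2 hRs]
  rw [hsum]
  by_cases hd : Disjoint (kempe G X v c) Λ
  · have hcard : (kempe G X v c).card = 1 + ∑ w ∈ R, effSize Λ Y (flip G Y w (X v)) := by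
      have hd' := hd
      rw [hk, Finset.disjoint_insert_left, Finset.disjoint_biUnion_left] at hd'
      rw [hk, Finset.card_insert_of_notMem, Finset.card_biUnion hRd, add_comm]
      · congr 1
        exact Finset.sum_congr rfl fun w hw =>
          (effSize_flip_of_disjoint (hYc w hw) (hd'.2 w hw)).symm
      · simp only [Finset.mem_biUnion, not_exists, not_and]
        exact hRv
    refine ⟨?_, fun _ => hcard⟩
    rw [rate, effSize_of_disjoint (by rwa [diff_flip hc]), diff_flip hc, hcard]
  · have hr : rate Λ X (flip G X v c) = 0 := by
      rw [rate, effSize_of_not_disjoint (by rwa [diff_flip hc]), flipProb_of_ge le_rfl]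
    refine ⟨?_, fun h => (h hr).elim⟩
    rw [hr, flipProb_of_ge]
    rw [hk, Finset.disjoint_insert_left, Finset.disjoint_biUnion_left] at hd
    push Not at hd
    obtain ⟨w, hw, hwd⟩ := hd hv
    have h7 : effSize Λ Y (flip G Y w (X v)) = 7 :=
      effSize_of_not_disjoint (by rwa [diff_flip (hYc w hw)])
    have := Finset.single_le_sum (f := fun w => effSize Λ Y (flip G Y w (X v)))
      (fun _ _ => Nat.zero_le _) hw
    simp only [h7] at this
    omega

/-- The neighbours `w ∉ Λ` of `v` which would be in `freeNbrs` if exactly one vertex `x ∉ Λ` was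
recoloured. -/
def nearNbrs (G : SimpleGraph V) (Λ : Finset V) (X : V → Fin q) (v : V) (i j : Fin q) : Finset V :=
  Finset.univ.filter fun w => G.Adj v w ∧ w ∉ Λ ∧ (X w ≠ i ∧ X w ≠ j) ∧
    ∃ x, G.Adj w x ∧ x ≠ v ∧ x ∉ Λ ∧ (X x = i ∨ X x = j) ∧
      ∀ y, G.Adj w y → y ≠ v → (X y = i ∨ X y = j) → y = x

lemma mem_nearNbrs : w ∈ nearNbrs G Λ X v i j ↔ G.Adj v w ∧ w ∉ Λ ∧ (X w ≠ i ∧ X w ≠ j) ∧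
    ∃ x, G.Adj w x ∧ x ≠ v ∧ x ∉ Λ ∧ (X x = i ∨ X x = j) ∧
      ∀ y, G.Adj w y → y ≠ v → (X y = i ∨ X y = j) → y = x := by simp [nearNbrs]

lemma sum_sideFlips {R N : Finset V} (hR : R ⊆ N)
    (hs : ∀ g : (V → Fin q) → ℝ, ∑ Z ∈ sideFlips G Y v c i, g Z = ∑ w ∈ R, g (flip G Y w i))
    (h : (V → Fin q) → ℝ) : ∑ Z ∈ sideFlips G Y v c i, rate Λ Y Z * h Z =
      ∑ w ∈ N, flipProb (repSize G Λ Y i R w) * h (flip G Y w i) := by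
  rw [hs, ← Finset.sum_subset hR fun w _ hw => by rw [repSize, if_neg hw]; simp]
  exact Finset.sum_congr rfl fun w hw => by rw [repSize, if_pos hw, rate]

lemma repSize_eq_card {R : Finset V} (hw : w ∈ R) (hi : i ≠ Y w)
    (h : flipProb (repSize G Λ Y i R w) ≠ 0) :
    repSize G Λ Y i R w = (kempe G Y w i).card ∧ Disjoint (kempe G Y w i) Λ := by
  rw [repSize, if_pos hw] at h ⊢
  have hd := disjoint_of_rate_ne_zero h
  rw [diff_flip hi] at hd
  exact ⟨effSize_flip_of_disjoint hi hd, hd⟩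

lemma mem_of_flipProb_repSize_ne_zero {R : Finset V} (h : flipProb (repSize G Λ Y i R w) ≠ 0) :
    w ∈ R := by
  by_contra hw
  rw [repSize, if_neg hw] at h
  simp at h

/-- The sizes of the components of the neighbours of `v` of colour `c`, and their relation with
the component of `v`. -/
lemma exists_sizes (hY : Y = Function.update X v j) (hv : v ∉ Λ) (hj : j ≠ X v) (hc : c ≠ X v)
    (hcj : c ≠ j) (hN : (colNbrs G X v c).Nonempty) :
    ∃ a : V → ℕ, ∃ w₀ ∈ colNbrs G X v c, (∀ w ∈ colNbrs G X v c, a w ≤ a w₀) ∧ 1 ≤ a w₀ ∧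
      (∀ h : (V → Fin q) → ℝ, ∑ Z ∈ sideFlips G Y v c (X v), rate Λ Y Z * h Z =
        ∑ w ∈ colNbrs G X v c, flipProb (a w) * h (flip G Y w (X v))) ∧
      rate Λ X (flip G X v c) = flipProb (1 + ∑ w ∈ colNbrs G X v c, a w) ∧
      (flipProb (1 + ∑ w ∈ colNbrs G X v c, a w) ≠ 0 → ∀ F, HamLip Λ F →
        F (flip G X v c) - F (flip G Y w₀ (X v)) ≤
          ((1 + ∑ w ∈ colNbrs G X v c, a w : ℕ) : ℝ) - a w₀) ∧
      (∀ w ∈ colNbrs G X v c, flipProb (a w) ≠ 0 →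
        a w = (kempe G Y w (X v)).card ∧ Disjoint (kempe G Y w (X v)) Λ) ∧
      (∀ w ∈ colNbrs G X v c, w ∉ Λ → kempe G Y w (X v) = {w} → a w = 1) := by
  obtain ⟨R, hRN, hRv, hRs, hRd, hRr⟩ := exists_reps (G := G) (Y := Y) (v := v) hc
  have hNN : colNbrs G Y v c = colNbrs G X v c := by rw [hY, colNbrs_update]
  rw [hNN] at hRN hRr
  have hadj (w : V) (hw : w ∈ colNbrs G X v c) : G.Adj v w ∧ X w = c := mem_colNbrs.1 hw
  have hYw (w : V) (hw : w ∈ colNbrs G X v c) : X v ≠ Y w := by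
    rw [hY, Function.update_of_ne (hadj w hw).1.ne', (hadj w hw).2]; exact hc.symm
  have hRr' : ∀ w ∈ colNbrs G X v c, ∃ r ∈ R, kempe G Y w (X v) = kempe G Y r (X v) :=
    fun w hw => hRr w hw (notMem_kempe_update hY hcj hj (hadj w hw).1 (hadj w hw).2)
  obtain ⟨w₀, hw₀, hmax⟩ := Finset.exists_max_image _ (repSize G Λ Y (X v) R) hN
  have hpos : 1 ≤ repSize G Λ Y (X v) R w₀ := by
    obtain ⟨r, hr, -⟩ := hRr' w₀ hw₀
    exact (repSize_pos hr (hYw r (hRN hr))).trans (hmax r (hRN hr))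
  have hw₀R : w₀ ∈ R := by
    by_contra h
    rw [repSize, if_neg h] at hpos
    omega
  have hrate := rate_flip_eq hY hv hc (by rwa [hNN]) hRv hRd (by rwa [hNN])
  rw [hNN] at hrate
  refine ⟨repSize G Λ Y (X v) R, w₀, hw₀, hmax, hpos, sum_sideFlips hRN hRs, hrate.1, ?_, ?_, ?_⟩
  · intro hA F hF
    have hA' := hrate.2 (by rwa [hrate.1])
    have hd := disjoint_of_rate_ne_zero (by rwa [hrate.1])
    rw [diff_flip hc] at hd
    have hsub := kempe_subset_kempe hY (hadj w₀ hw₀).1 (hadj w₀ hw₀).2 (hRv w₀ hw₀R)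
    have h := hF.sub_le_card (diff_flip_flip_subset hY (hadj w₀ hw₀).1 (hadj w₀ hw₀).2
      (hRv w₀ hw₀R)) (hd.mono_left Finset.sdiff_subset)
    rw [Finset.card_sdiff_of_subset hsub, Nat.cast_sub (Finset.card_le_card hsub), hA'] at h
    rwa [repSize, if_pos hw₀R, effSize_flip_of_disjoint (hYw w₀ hw₀) (hd.mono_left hsub)]
  · intro w hw h
    exact repSize_eq_card (mem_of_flipProb_repSize_ne_zero h) (hYw w hw) h
  · intro w hw hwΛ hk
    obtain ⟨r, hr, hrk⟩ := hRr' w hw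
    have hrw : r = w := by
      have : r ∈ kempe G Y w (X v) := hrk ▸ self_mem_kempe
      rwa [hk, Finset.mem_singleton] at this
    subst hrw
    rw [repSize, if_pos hr, effSize_flip_of_disjoint (hYw r hw) (by rw [hk]; simpa using hwΛ), hk,
      Finset.card_singleton]

lemma freeNbrs_subset_update (hX : X v = i) :
    freeNbrs G Λ X w i j ⊆ freeNbrs G Λ (Function.update X v j) w i j := by
  intro x hx
  rw [mem_freeNbrs] at hx ⊢
  obtain ⟨h1, h2, h3, h4⟩ := hx
  have hxv : x ≠ v := fun h => h3.1 (by rw [h, hX])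
  refine ⟨h1, h2, by rwa [Function.update_of_ne hxv], fun t ht htw => ?_⟩
  have := h4 t ht htw
  rwa [Function.update_of_ne]
  rintro rfl
  exact this.1 hX

lemma kempe_eq_singleton_of_mem_freeNbrs (hw : w ∈ freeNbrs G Λ X v i j) (hX : X v ≠ c)
    (hc : c = i ∨ c = j) : kempe G X w c = {w} := by
  apply kempe_eq_singleton
  intro t ht
  by_cases htv : t = v
  · rw [htv]; exact hX
  · have := (mem_freeNbrs.1 hw).2.2.2 t ht htv
    rcases hc with rfl | rfl
    · exact this.1
    · exact this.2

/-- The part of `drift` due to the flips at `v` to the colour `c`, and to the flips which leave `v`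
unchanged and recolour some `c`-coloured neighbour of `v` to the colour `j`. -/
def classDrift (G : SimpleGraph V) (Λ : Finset V) (F : (V → Fin q) → ℝ) (X : V → Fin q) (v : V)
    (j c : Fin q) : ℝ :=
  (if c = X v then 0 else rate Λ X (flip G X v c) * (F (flip G X v c) - F X)) +
    if c = j then 0 else ∑ Z ∈ sideFlips G X v c j, rate Λ X Z * (F Z - F X)

/-- The contribution of a neighbour of `v`, apart from the loss of free neighbours. -/
def nbrCost (G : SimpleGraph V) (Λ : Finset V) (Δ : ℕ) (X : V → Fin q) (v : V) (j : Fin q) (w : V) :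
    ℝ :=
  1.8085 - 0.3522 * (1 - wt G Λ Δ X v j) +
    (if w ∈ nearNbrs G Λ X v (X v) j then 0.0376675 else 0 : ℝ) -
    (if w ∈ freeNbrs G Λ X v (X v) j then
      0.13208325 + 0.6761 * (0.0475 * (freeNbrs G Λ X w (X v) j).card / Δ) else 0 : ℝ)

/-- The loss of free neighbours in a transition from `X` to `Z`. -/
def freeLoss (G : SimpleGraph V) (Λ : Finset V) (Δ : ℕ) (X : V → Fin q) (v : V) (j : Fin q)
    (Z : V → Fin q) : ℝ :=
  0.0475 * (freeNbrs G Λ X v (X v) j \ freeNbrs G Λ Z v (X v) j).card / Δ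

lemma freeLoss_nonneg : 0 ≤ freeLoss G Λ Δ X v j Z := by unfold freeLoss; positivity

lemma wt_le_add_freeLoss (h : Z v = X v) :
    wt G Λ Δ Z v j ≤ wt G Λ Δ X v j + freeLoss G Λ Δ X v j Z := by
  unfold wt freeLoss
  rw [h]
  have h1 : (freeNbrs G Λ X v (X v) j).card ≤ (freeNbrs G Λ Z v (X v) j).card +
      (freeNbrs G Λ X v (X v) j \ freeNbrs G Λ Z v (X v) j).card := by
    have := Finset.le_card_sdiff (freeNbrs G Λ Z v (X v) j) (freeNbrs G Λ X v (X v) j)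
    omega
  have h2 : ((freeNbrs G Λ X v (X v) j).card : ℝ) ≤ (freeNbrs G Λ Z v (X v) j).card +
      (freeNbrs G Λ X v (X v) j \ freeNbrs G Λ Z v (X v) j).card := by exact_mod_cast h1
  have h3 : 0.0475 * ((freeNbrs G Λ X v (X v) j).card : ℝ) / Δ ≤
      0.0475 * ((freeNbrs G Λ Z v (X v) j).card +
      (freeNbrs G Λ X v (X v) j \ freeNbrs G Λ Z v (X v) j).card : ℝ) / Δ := by gcongr
  rw [mul_add, add_div] at h3
  linarith

/-- The distance between two flips at the same neighbour of `v`. -/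
lemma flip_sub_flip_le {F : (V → Fin q) → ℝ} (hF : WtLip G Λ Δ F)
    (hY : Y = Function.update X v j) (hv : v ∉ Λ) (hj : j ≠ X v) (hw : G.Adj v w)
    (hi : X w ≠ X v) (hwj : X w ≠ j)
    (hX : Disjoint (kempe G X w j) Λ) (hYd : Disjoint (kempe G Y w (X v)) Λ) :
    F (flip G X w j) - F (flip G Y w (X v)) ≤
      wt G Λ Δ X v j + freeLoss G Λ Δ X v j (flip G X w j) +
        ((kempe G Y w (X v)).card + (kempe G X w j).card - 1) -
        (if w ∈ freeNbrs G Λ X v (X v) j then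
          0.0475 * (freeNbrs G Λ X w (X v) j).card / Δ else 0 : ℝ) := by
  have hYw : Y w = X w := by rw [hY, Function.update_of_ne hw.ne']
  have hYv : Y v = j := by rw [hY, Function.update_self]
  have hXY : X = Function.update Y v (X v) := by rw [hY]; simp
  have hvY : v ∉ kempe G Y w (X v) := notMem_kempe_update hY hwj hj hw rfl
  have hvX : v ∉ kempe G X w j := by
    have := notMem_kempe_update (G := G) (c := X w) hXY hi (by rw [hYv]; exact hj.symm) hw hYw
    rwa [hYv] at this
  have hZv : flip G X w j v = X v := flip_of_notMem hvX
  have h1 := hF (flip G X w j) v j hv (by rwa [hZv])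
  have h2 := wt_le_add_freeLoss (G := G) (Λ := Λ) (Δ := Δ) (j := j) hZv
  suffices h3 : F (Function.update (flip G X w j) v j) - F (flip G Y w (X v)) ≤
      ((kempe G Y w (X v)).card + (kempe G X w j).card - 1) -
        (if w ∈ freeNbrs G Λ X v (X v) j then
          0.0475 * (freeNbrs G Λ X w (X v) j).card / Δ else 0 : ℝ) by linarith
  split_ifs with hU
  · have kX : kempe G X w j = {w} :=
      kempe_eq_singleton_of_mem_freeNbrs hU hj.symm (Or.inr rfl)
    have hU' : w ∈ freeNbrs G Λ Y v (X v) j := by rw [hY, freeNbrs_update]; exact hU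
    have kY : kempe G Y w (X v) = {w} :=
      kempe_eq_singleton_of_mem_freeNbrs hU' (by rwa [hYv]) (Or.inl rfl)
    have e1 : flip G X w j = Function.update X w j :=
      flip_eq_update fun t ht => ne_of_kempe_eq_singleton kX ht
    have e2 : flip G Y w (X v) = Function.update Y w (X v) :=
      flip_eq_update fun t ht => ne_of_kempe_eq_singleton kY ht
    have e3 : Function.update (flip G X w j) v j = Function.update Y w j := by
      rw [e1, hY, Function.update_comm hw.ne']
    have h := hF (Function.update Y w j) w (X v) (mem_freeNbrs.1 hU).2.1 (by simpa using hj.symm)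
    rw [Function.update_idem] at h
    rw [e3, e2, kX, kY]
    have h4 : (freeNbrs G Λ X w (X v) j).card ≤ (freeNbrs G Λ (Function.update Y w j) w
        (Function.update Y w j w) (X v)).card := by
      rw [freeNbrs_update, Function.update_self, freeNbrs_comm (i := j), hY]
      exact Finset.card_le_card (freeNbrs_subset_update rfl)
    have h5 : 0.0475 * ((freeNbrs G Λ X w (X v) j).card : ℝ) / Δ ≤ 0.0475 *
        ((freeNbrs G Λ (Function.update Y w j) w (Function.update Y w j w) (X v)).card : ℝ) /
          Δ := by
      gcongr
    unfold wt at h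
    simp only [Finset.card_singleton, Nat.cast_one]
    linarith
  · have hsub : diff (Function.update (flip G X w j) v j) (flip G Y w (X v)) ⊆
        kempe G Y w (X v) ∪ kempe G X w j := by
      intro s hs
      rw [mem_diff] at hs
      by_contra h
      rw [Finset.mem_union, not_or] at h
      rw [flip_of_notMem h.1] at hs
      apply hs
      by_cases hsv : s = v
      · rw [hsv, Function.update_self, hYv]
      · rw [Function.update_of_ne hsv, flip_of_notMem h.2, hY, Function.update_of_ne hsv]
    have h := hF.hamLip.sub_le_card hsub (Finset.disjoint_union_left.2 ⟨hYd, hX⟩)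
    have h6 := Finset.card_union_add_card_inter (kempe G Y w (X v)) (kempe G X w j)
    have h7 : 1 ≤ (kempe G Y w (X v) ∩ kempe G X w j).card :=
      Finset.card_pos.2 ⟨w, Finset.mem_inter.2 ⟨self_mem_kempe, self_mem_kempe⟩⟩
    have h8 : ((kempe G Y w (X v) ∪ kempe G X w j).card : ℝ) + 1 ≤
        (kempe G Y w (X v)).card + (kempe G X w j).card := by
      exact_mod_cast (by omega : (kempe G Y w (X v) ∪ kempe G X w j).card + 1 ≤
        (kempe G Y w (X v)).card + (kempe G X w j).card)
    linarith

lemma HamLip.sub_flip_le {F : (V → Fin q) → ℝ} (hF : HamLip Λ F) (hi : i ≠ Y w)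
    (hd : Disjoint (kempe G Y w i) Λ) : F Y - F (flip G Y w i) ≤ (kempe G Y w i).card := by
  have := hF.sub_le_card (Y := Y) (Z := flip G Y w i) (diff_flip hi).le hd
  exact this

lemma HamLip.flip_sub_le {F : (V → Fin q) → ℝ} (hF : HamLip Λ F) (hi : i ≠ Y w)
    (hd : Disjoint (kempe G Y w i) Λ) : F (flip G Y w i) - F Y ≤ (kempe G Y w i).card := by
  have := hF.neg.sub_flip_le hi hd
  linarith

lemma le_charge {x : ℝ} (a b : ℕ) (hx : 0 ≤ x)
    (h : (a = 1 ∧ b = 2) ∨ (a = 2 ∧ b = 1) → x = 0.0376675) : -charge a b ≤ x := by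
  unfold charge chargeInt
  split_ifs with h1 h2
  · norm_num; linarith
  · rw [h h2]; norm_num
  · simpa using hx

lemma mem_nearNbrs_of_card (hw : G.Adj v w) (hwΛ : w ∉ Λ) (hi : X w ≠ i) (hj : X w ≠ j)
    (hXv : X v = i) (hY : Y = Function.update X v j) (hij : i ≠ j)
    (h : ((kempe G Y w i).card = 1 ∧ (kempe G X w j).card = 2 ∧ Disjoint (kempe G X w j) Λ) ∨
      ((kempe G Y w i).card = 2 ∧ (kempe G X w j).card = 1 ∧ Disjoint (kempe G Y w i) Λ)) :
    w ∈ nearNbrs G Λ X v i j := by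
  have key {Y₁ Y₂ : V → Fin q} {i j : Fin q} (e : ∀ x, x ≠ v → Y₁ x = X x ∧ Y₂ x = X x)
      (h2 : Y₂ v = i) (hij : i ≠ j) (k1 : kempe G Y₁ w i = {w}) (k2 : (kempe G Y₂ w j).card = 2)
      (hj : X w ≠ j) (hd : Disjoint (kempe G Y₂ w j) Λ) :
      ∃ x, G.Adj w x ∧ x ≠ v ∧ x ∉ Λ ∧ X x = j ∧
        ∀ y, G.Adj w y → y ≠ v → (X y = i ∨ X y = j) → y = x := by
    have hw2 : Y₂ w = X w := (e w hw.ne').2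
    have hex : ∃ x, G.Adj w x ∧ Y₂ x = j := by
      by_contra hno
      push Not at hno
      rw [kempe_eq_singleton hno, Finset.card_singleton] at k2
      omega
    obtain ⟨x, hx, hxj⟩ := hex
    have mem {y : V} (hy : G.Adj w y) (hyj : Y₂ y = j) : y ∈ kempe G Y₂ w j :=
      mem_kempe_of_altAdj self_mem_kempe ⟨hy, Or.inl ⟨rfl, hyj⟩⟩
    have hxv : x ≠ v := by rintro rfl; exact hij (h2.symm.trans hxj)
    refine ⟨x, hx, hxv, Finset.disjoint_left.1 hd (mem hx hxj), (e x hxv).2 ▸ hxj, ?_⟩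
    intro y hy hyv hyc
    rcases hyc with hyc | hyc
    · exact (ne_of_kempe_eq_singleton k1 hy ((e y hyv).1.trans hyc)).elim
    · by_contra hyx
      have hsub : ({w, x, y} : Finset V) ⊆ kempe G Y₂ w j := by
        intro s hs
        simp only [Finset.mem_insert, Finset.mem_singleton] at hs
        rcases hs with rfl | rfl | rfl
        · exact self_mem_kempe
        · exact mem hx hxj
        · exact mem hy ((e s hyv).2.trans hyc)
      have := Finset.card_le_card hsub
      rw [k2, Finset.card_eq_three.2 ⟨w, x, y, hx.ne, hy.ne, fun h => hyx h.symm, rfl⟩] at this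
      omega
  have single {Y : V → Fin q} {i : Fin q} (h : (kempe G Y w i).card = 1) :
      kempe G Y w i = {w} := by
    obtain ⟨x, hx⟩ := Finset.card_eq_one.1 h
    have : w ∈ kempe G Y w i := self_mem_kempe
    rw [hx, Finset.mem_singleton] at this
    rw [hx, this]
  have eY (x : V) (hx : x ≠ v) : Y x = X x := by rw [hY, Function.update_of_ne hx]
  rw [mem_nearNbrs]
  refine ⟨hw, hwΛ, ⟨hi, hj⟩, ?_⟩
  rcases h with ⟨h1, h2, h3⟩ | ⟨h1, h2, h3⟩
  · obtain ⟨x, k1, k2, k3, k4, k5⟩ :=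
      key (fun x hx => ⟨eY x hx, rfl⟩) hXv hij (single h1) h2 hj h3
    exact ⟨x, k1, k2, k3, Or.inr k4, k5⟩
  · obtain ⟨x, k1, k2, k3, k4, k5⟩ :=
      key (fun x hx => ⟨rfl, eY x hx⟩) (by rw [hY, Function.update_self]) hij.symm
        (single h2) h1 hi h3
    exact ⟨x, k1, k2, k3, Or.inl k4, fun y hy hyv hyc => k5 y hy hyv hyc.symm⟩

lemma notMem_nearNbrs_of_mem_freeNbrs (h : w ∈ freeNbrs G Λ X v i j) :
    w ∉ nearNbrs G Λ X v i j := by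
  rw [mem_nearNbrs]
  rintro ⟨-, -, -, x, hx, hxv, -, hxc, -⟩
  have := (mem_freeNbrs.1 h).2.2.2 x hx hxv
  tauto

/-- The drift of a class of colour `c`, different from the colours of the disagreement. -/
lemma classDrift_sub_le (hΔ : ∀ v, (Finset.univ.filter (G.Adj v)).card ≤ Δ)
    (hY : Y = Function.update X v j) (hv : v ∉ Λ) (hj : j ≠ X v) (hc : c ≠ X v) (hcj : c ≠ j) :
    ∃ R : ℝ, 0 ≤ R ∧ ∀ F, WtLip G Λ Δ F →
      classDrift G Λ F X v j c - classDrift G Λ F Y v (X v) c ≤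
        R * (wt G Λ Δ X v j - (F X - F Y)) - wt G Λ Δ X v j +
          ∑ w ∈ colNbrs G X v c, nbrCost G Λ Δ X v j w +
          ∑ Z ∈ sideFlips G X v c j, rate Λ X Z * freeLoss G Λ Δ X v j Z := by
  have hg0 (n : ℕ) : (0 : ℝ) ≤ 0.0475 * n / Δ := by positivity
  have hYv : Y v = j := by rw [hY, Function.update_self]
  have hXY : X = Function.update Y v (X v) := by rw [hY]; simp
  have hcY : c ≠ Y v := by rwa [hYv]
  have hNN : colNbrs G Y v c = colNbrs G X v c := by rw [hY, colNbrs_update]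
  have hadj (w : V) (hw : w ∈ colNbrs G X v c) : G.Adj v w ∧ X w = c := mem_colNbrs.1 hw
  have hYw (w : V) (hw : w ∈ colNbrs G X v c) : Y w = c := by
    rw [hY, Function.update_of_ne (hadj w hw).1.ne', (hadj w hw).2]
  have hcd (F : (V → Fin q) → ℝ) : classDrift G Λ F X v j c - classDrift G Λ F Y v (X v) c =
      rate Λ X (flip G X v c) * (F (flip G X v c) - F X) +
        ∑ Z ∈ sideFlips G X v c j, rate Λ X Z * (F Z - F X) -
      (rate Λ Y (flip G Y v c) * (F (flip G Y v c) - F Y) +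
        ∑ Z ∈ sideFlips G Y v c (X v), rate Λ Y Z * (F Z - F Y)) := by
    simp only [classDrift, if_neg hc, if_neg hcj, if_neg hcY]
  simp only [hcd]
  rcases (colNbrs G X v c).eq_empty_or_nonempty with hN | hN
  · refine ⟨1, zero_le_one, fun F hF => ?_⟩
    have side (Y : V → Fin q) (i : Fin q) (h : colNbrs G Y v c = ∅) (hci : c ≠ i) :
        sideFlips G Y v c i = ∅ := by rw [sideFlips_eq hci, h]; simp
    have rt (Y : V → Fin q) (h : colNbrs G Y v c = ∅) (hc : c ≠ Y v) :
        rate Λ Y (flip G Y v c) = 1 ∧ flip G Y v c = Function.update Y v c := by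
      have hn : ∀ t, G.Adj v t → Y t ≠ c := fun t ht htc => by
        have := mem_colNbrs.2 ⟨ht, htc⟩
        rw [h] at this
        simp at this
      have hk := kempe_eq_singleton hn
      refine ⟨?_, flip_eq_update hn⟩
      rw [rate, effSize_flip_of_disjoint hc (by rw [hk]; simpa using hv), hk]
      simp
    rw [side X j hN hcj, side Y (X v) (hNN.trans hN) hc, (rt X hN hc).1, (rt X hN hc).2,
      (rt Y (hNN.trans hN) hcY).1, (rt Y (hNN.trans hN) hcY).2, hN, hY, Function.update_idem]
    simp only [Finset.sum_empty]
    linarith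
  obtain ⟨a, w₀, hw₀, ha, ha', haS, haR, haF, hac, ha1⟩ := exists_sizes hY hv hj hc hcj hN
  obtain ⟨b, w₁, hw₁, hb, hb', hbS, hbR, hbF, hbc, hb1⟩ := exists_sizes (G := G) (c := c) hXY hv
    (by rw [hYv]; exact hj.symm) hcY hc (by rwa [hNN])
  rw [hNN] at hw₁ hb hbS hbR hbF hbc hb1
  rw [hYv] at hbS hbF hbc hb1
  set N := colNbrs G X v c with hNdef
  set e := 1 - wt G Λ Δ X v j with he
  have he0 : 0 ≤ e := by linarith [wt_le_one (G := G) (Λ := Λ) (Δ := Δ) (X := X) (v := v) (j := j)]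
  have he1 : e ≤ 0.0475 := by linarith [le_wt (Λ := Λ) (X := X) (v := v) (j := j) hΔ]
  set A := 1 + ∑ w ∈ N, a w with hA
  set B := 1 + ∑ w ∈ N, b w with hB
  have haA : a w₀ + 1 ≤ A := by
    have := Finset.single_le_sum (f := a) (fun _ _ => Nat.zero_le _) hw₀
    omega
  have hbB : b w₁ + 1 ≤ B := by
    have := Finset.single_le_sum (f := b) (fun _ _ => Nat.zero_le _) hw₁
    omega
  set s : V → ℝ := fun w => flipProb (a w) - if w = w₀ then flipProb A else 0 with hs
  set t : V → ℝ := fun w => flipProb (b w) - if w = w₁ then flipProb B else 0 with ht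
  have hs0 (w : V) : 0 ≤ s w := by
    simp only [hs]
    split_ifs with h
    · rw [h]; linarith [flipProb_anti ha' (by omega : a w₀ ≤ A)]
    · linarith [flipProb_nonneg (a w)]
  have ht0 (w : V) : 0 ≤ t w := by
    simp only [ht]
    split_ifs with h
    · rw [h]; linarith [flipProb_anti hb' (by omega : b w₁ ≤ B)]
    · linarith [flipProb_nonneg (b w)]
  refine ⟨flipProb A + flipProb B + ∑ w ∈ N, min (s w) (t w), ?_, fun F hF => ?_⟩
  · have := Finset.sum_nonneg fun w (_ : w ∈ N) => le_min (hs0 w) (ht0 w)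
    linarith [flipProb_nonneg A, flipProb_nonneg B]
  set g : V → ℝ := fun w => if w ∈ freeNbrs G Λ X v (X v) j then
    0.0475 * (freeNbrs G Λ X w (X v) j).card / Δ else 0 with hg
  obtain ⟨r, hr, hr0, hmain⟩ := class_abstract (α := fun w => F (flip G Y w (X v)))
    (β := fun w => F (flip G X w j)) (fA := F (flip G X v c)) (fB := F (flip G Y v c)) (x := F X)
    (y := F Y) (e := e) (ex := fun w => freeLoss G Λ Δ X v j (flip G X w j)) (g := g)
    hw₀ hw₁ ha' hb' (by omega : a w₀ ≤ A) (by omega : b w₁ ≤ B)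
    (fun h => haF h F hF.hamLip)
    (fun h => by
      have := hbF h _ hF.hamLip.neg
      linarith)
    (fun w hw h => by
      rw [(hac w hw h).1]
      exact hF.hamLip.sub_flip_le (by rw [hYw w hw]; exact hc.symm) (hac w hw h).2)
    (fun w hw h => by
      rw [(hbc w hw h).1]
      exact hF.hamLip.flip_sub_le (by rw [(hadj w hw).2]; exact hcj.symm) (hbc w hw h).2)
    (fun w hw h h' => by
      have := flip_sub_flip_le hF hY hv hj (hadj w hw).1 (by rwa [(hadj w hw).2])
        (by rwa [(hadj w hw).2]) (hbc w hw h').2 (hac w hw h).2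
      rw [(hbc w hw h').1, (hac w hw h).1]
      simp only [he, hg]
      linarith)
    (fun w _ => freeLoss_nonneg)
  have hcost := class_cost_le hw₀ hw₁ ha hb ha' hb' hA hB he0 he1
  rw [Finset.sum_add_distrib] at hcost
  have hrr : ∑ w ∈ N, min (s w) (t w) = ∑ w ∈ N, r w :=
    Finset.sum_congr rfl fun w _ => (hr w).symm
  rw [hrr, haR, hbR, hbS, haS, hbS]
  have hpt : ∑ w ∈ N, (1.8085 - 0.3522 * e) - ∑ w ∈ N, charge (a w) (b w) - ∑ w ∈ N, r w * g w ≤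
      ∑ w ∈ N, nbrCost G Λ Δ X v j w := by
    rw [← Finset.sum_sub_distrib, ← Finset.sum_sub_distrib]
    refine Finset.sum_le_sum fun w hw => ?_
    unfold nbrCost
    rw [← he]
    by_cases hU : w ∈ freeNbrs G Λ X v (X v) j
    · have hU' : w ∈ freeNbrs G Λ Y v (X v) j := by rw [hY, freeNbrs_update]; exact hU
      have a1 := ha1 w hw (mem_freeNbrs.1 hU).2.1
        (kempe_eq_singleton_of_mem_freeNbrs hU' (by rwa [hYv]) (Or.inl rfl))
      have b1 := hb1 w hw (mem_freeNbrs.1 hU).2.1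
        (kempe_eq_singleton_of_mem_freeNbrs hU hj.symm (Or.inr rfl))
      have hr1 : 0.6761 ≤ r w := by
        rw [hr, a1, b1, flipProb_one]
        have hA2 := flipProb_anti (m := 2) (by omega) (by omega : 2 ≤ A)
        have hB2 := flipProb_anti (m := 2) (by omega) (by omega : 2 ≤ B)
        rw [flipProb_two] at hA2 hB2
        refine le_min ?_ ?_ <;> split_ifs <;> norm_num at * <;> linarith
      rw [if_pos hU, if_neg (notMem_nearNbrs_of_mem_freeNbrs hU), a1, b1]
      have hgw : g w = 0.0475 * ((freeNbrs G Λ X w (X v) j).card : ℝ) / Δ := by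
        simp only [hg, if_pos hU]
      rw [hgw]
      have := mul_le_mul_of_nonneg_right hr1 (hg0 (freeNbrs G Λ X w (X v) j).card)
      have hch : charge 1 1 = 0.13208325 := by norm_num [charge, chargeInt]
      rw [hch]
      linarith
    · have hgw : g w = 0 := by simp only [hg, if_neg hU]
      rw [if_neg hU, hgw]
      have := le_charge (x := if w ∈ nearNbrs G Λ X v (X v) j then 0.0376675 else 0) (a w) (b w)
        (by split_ifs <;> norm_num) (fun h => if_pos ?_)
      · linarith
      have hne (n : ℕ) (hn : n = 1 ∨ n = 2) : flipProb n ≠ 0 := by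
        rcases hn with rfl | rfl
        · simp
        · rw [flipProb_two]; norm_num
      have hca := hac w hw (hne _ (by omega))
      have hcb := hbc w hw (hne _ (by omega))
      refine mem_nearNbrs_of_card (hadj w hw).1 (Finset.disjoint_left.1 hca.2 self_mem_kempe)
        (by rwa [(hadj w hw).2]) (by rwa [(hadj w hw).2]) rfl hY hj.symm ?_
      rcases h with h | h
      · exact Or.inl ⟨hca.1 ▸ h.1, hcb.1 ▸ h.2, hcb.2⟩
      · exact Or.inr ⟨hca.1 ▸ h.1, hcb.1 ▸ h.2, hca.2⟩
  rw [Finset.sum_const, nsmul_eq_mul] at hpt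
  have hw1 : wt G Λ Δ X v j = 1 - e := by rw [he]; ring
  rw [hw1]
  linarith

/-- The drift of the class of one of the two colours of the disagreement. -/
lemma classDrift_sub_le_self (hΔ : ∀ v, (Finset.univ.filter (G.Adj v)).card ≤ Δ)
    (hY : Y = Function.update X v j) (hv : v ∉ Λ) (hj : j ≠ X v) :
    ∃ R : ℝ, 0 ≤ R ∧ ∀ F, WtLip G Λ Δ F →
      classDrift G Λ F X v j j - classDrift G Λ F Y v (X v) j ≤
        R * (wt G Λ Δ X v j - (F X - F Y)) - wt G Λ Δ X v j +
          (colNbrs G X v j).card * (1.8085 - 0.3522 * (1 - wt G Λ Δ X v j)) := by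
  have hYv : Y v = j := by rw [hY, Function.update_self]
  have hNN : colNbrs G Y v j = colNbrs G X v j := by rw [hY, colNbrs_update]
  have hcd (F : (V → Fin q) → ℝ) : classDrift G Λ F X v j j - classDrift G Λ F Y v (X v) j =
      rate Λ X (flip G X v j) * (F (flip G X v j) - F X) -
        ∑ Z ∈ sideFlips G Y v j (X v), rate Λ Y Z * (F Z - F Y) := by
    simp only [classDrift, if_neg hj, hYv, if_true]
    ring
  simp only [hcd]
  have hwt0 := le_wt (Λ := Λ) (X := X) (v := v) (j := j) hΔ
  have hwt1 := wt_le_one (G := G) (Λ := Λ) (Δ := Δ) (X := X) (v := v) (j := j)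
  obtain ⟨R, hRN, hRv, hRs, -, -⟩ := exists_reps (G := G) (Y := Y) (v := v) hj
  rw [hNN] at hRN
  have hadj (w : V) (hw : w ∈ R) : G.Adj v w ∧ X w = j := mem_colNbrs.1 (hRN hw)
  have hYw (w : V) (hw : w ∈ R) : X v ≠ Y w := by
    rw [hY, Function.update_of_ne (hadj w hw).1.ne', (hadj w hw).2]; exact hj.symm
  set m := (colNbrs G X v j).card with hm
  simp only [hRs]
  rcases R.eq_empty_or_nonempty with hR | ⟨w₀, hw₀⟩
  · refine ⟨rate Λ X (flip G X v j), rate_nonneg, fun F hF => ?_⟩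
    rw [hR, Finset.sum_empty]
    suffices h : rate Λ X (flip G X v j) * (F (flip G X v j) - F Y) ≤
        rate Λ X (flip G X v j) * wt G Λ Δ X v j - wt G Λ Δ X v j +
          m * (1.8085 - 0.3522 * (1 - wt G Λ Δ X v j)) by linarith
    rcases Nat.eq_zero_or_pos m with h0 | hpos
    · have hn : ∀ t, G.Adj v t → X t ≠ j := fun t ht htc => by
        have := mem_colNbrs.2 ⟨ht, htc⟩
        rw [Finset.card_eq_zero.1 h0] at this
        simp at this
      have hk := kempe_eq_singleton hn
      have hr : rate Λ X (flip G X v j) = 1 := by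
        rw [rate, effSize_flip_of_disjoint hj (by rw [hk]; simpa using hv), hk]
        simp
      rw [hr, h0, flip_eq_update hn, ← hY]
      simp
    · have hm1 : (1 : ℝ) ≤ m := by exact_mod_cast hpos
      have hrhs : 0.7 ≤ -wt G Λ Δ X v j + m * (1.8085 - 0.3522 * (1 - wt G Λ Δ X v j)) := by
        nlinarith
      by_cases hr : rate Λ X (flip G X v j) = 0
      · rw [hr]; linarith
      have hd := disjoint_of_rate_ne_zero hr
      rw [diff_flip hj] at hd
      have hsub : diff (flip G X v j) Y ⊆ (kempe G X v j).erase v := by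
        intro s hs
        rw [mem_diff] at hs
        rw [Finset.mem_erase]
        have hsv : s ≠ v := by rintro rfl; exact hs (by rw [hYv, flip_self])
        refine ⟨hsv, ?_⟩
        by_contra h
        exact hs (by rw [flip_of_notMem h, hY, Function.update_of_ne hsv])
      have h := hF.hamLip.sub_le_card hsub (hd.mono_left (Finset.erase_subset _ _))
      rw [Finset.card_erase_of_mem self_mem_kempe,
        Nat.cast_sub (Finset.card_pos.2 ⟨v, self_mem_kempe⟩)] at h
      have h' := mul_le_mul_of_nonneg_left h (rate_nonneg (Λ := Λ) (X := X) (Z := flip G X v j))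
      have hrate : rate Λ X (flip G X v j) = flipProb (kempe G X v j).card := by
        rw [rate, effSize_flip_of_disjoint hj hd]
      have h2 := sub_two_mul_flipProb_le (n := (kempe G X v j).card)
      rw [hrate] at h' ⊢
      have h3 := mul_le_mul_of_nonneg_left (sub_le_sub_left hwt0 1)
        (flipProb_nonneg (kempe G X v j).card)
      have h4 := flipProb_le_one (kempe G X v j).card
      norm_num at h' h3
      linarith
  set a : V → ℕ := fun w => effSize Λ Y (flip G Y w (X v)) with ha
  set A : ℕ := if Disjoint (kempe G X v j) Λ then (kempe G X v j).card else a w₀ + 7 with hA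
  have hrate : rate Λ X (flip G X v j) = flipProb A := by
    rw [hA]
    split_ifs with hd
    · rw [rate, effSize_flip_of_disjoint hj hd]
    · rw [rate, effSize_of_not_disjoint (by rwa [diff_flip hj]), flipProb_of_ge le_rfl,
        flipProb_of_ge (by omega)]
  have hsub := kempe_subset_kempe hY (hadj w₀ hw₀).1 (hadj w₀ hw₀).2 (hRv w₀ hw₀)
  have ha0 (hd : Disjoint (kempe G X v j) Λ) : a w₀ = (kempe G Y w₀ (X v)).card :=
    effSize_flip_of_disjoint (hYw w₀ hw₀) (hd.mono_left hsub)
  have hins : insert v (kempe G Y w₀ (X v)) ⊆ kempe G X v j :=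
    Finset.insert_subset self_mem_kempe hsub
  have hcins := Finset.card_insert_of_notMem (hRv w₀ hw₀)
  refine ⟨flipProb A, flipProb_nonneg A, fun F hF => ?_⟩
  have := half_abstract (N := R) (a := a) (w₀ := w₀) hw₀
    (effSize_pos (flip_mem_flips (hYw w₀ hw₀))) (A := A) (m := m) ?_ (Finset.card_le_card hRN) ?_
    (α := fun w => F (flip G Y w (X v))) (fA := F (flip G X v j)) (x := F X) (y := F Y)
    (e := 1 - wt G Λ Δ X v j) (by linarith) (by linarith) ?_ ?_
  · rw [hrate]
    change _ - ∑ w ∈ R, flipProb (a w) * (F (flip G Y w (X v)) - F Y) ≤ _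
    linarith
  · rw [hA]
    split_ifs with hd
    · rw [ha0 hd, ← hcins]; exact Finset.card_le_card hins
    · omega
  · intro hm1 ha1
    have hd0 := disjoint_of_effSize_flip_lt (Λ := Λ) (hYw w₀ hw₀)
      (by change a w₀ < 7; omega)
    have hcol : colNbrs G Y v j ⊆ {w₀} := by
      obtain ⟨x, hx⟩ := Finset.card_eq_one.1 hm1
      have := hRN hw₀
      rw [hx, Finset.mem_singleton] at this
      rw [hNN, hx, this]
    have hk := kempe_subset_insert hY hj (R := {w₀}) fun w hw =>
      ⟨w₀, by simp, by rw [Finset.mem_singleton.1 (hcol hw)]⟩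
    rw [Finset.singleton_biUnion] at hk
    have hkk := hk.antisymm hins
    have hd : Disjoint (kempe G X v j) Λ := by
      rw [hkk, Finset.disjoint_insert_left]; exact ⟨hv, hd0⟩
    rw [hA, if_pos hd, hkk, hcins, ← ha0 hd, ha1]
  · intro hAne
    have hd : Disjoint (kempe G X v j) Λ := by
      by_contra hd
      rw [hA, if_neg hd, flipProb_of_ge (by omega)] at hAne
      exact hAne rfl
    have hsub' : diff (flip G X v j) (flip G Y w₀ (X v)) ⊆
        kempe G X v j \ insert v (kempe G Y w₀ (X v)) := by
      intro s hs
      have h1 := diff_flip_flip_subset hY (hadj w₀ hw₀).1 (hadj w₀ hw₀).2 (hRv w₀ hw₀) hs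
      rw [Finset.mem_sdiff] at h1 ⊢
      refine ⟨h1.1, ?_⟩
      rw [Finset.mem_insert, not_or]
      refine ⟨?_, h1.2⟩
      rintro rfl
      rw [mem_diff, flip_self, flip_of_notMem h1.2, hYv] at hs
      exact hs rfl
    have h := hF.hamLip.sub_le_card hsub' (hd.mono_left Finset.sdiff_subset)
    rw [Finset.card_sdiff_of_subset hins, Nat.cast_sub (Finset.card_le_card hins), hcins,
      ← ha0 hd] at h
    rw [hA, if_pos hd]
    push_cast at h
    linarith
  · intro w hw h
    have hd := disjoint_of_rate_ne_zero h
    rw [diff_flip (hYw w hw)] at hd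
    change _ ≤ ((effSize Λ Y (flip G Y w (X v)) : ℕ) : ℝ)
    rw [effSize_flip_of_disjoint (hYw w hw) hd]
    exact hF.hamLip.sub_flip_le (hYw w hw) hd

lemma classDrift_neg {F : (V → Fin q) → ℝ} :
    classDrift G Λ (fun Z => -F Z) X v j c = -classDrift G Λ F X v j c := by
  unfold classDrift
  have h (Z : V → Fin q) : rate Λ X Z * (-F Z - -F X) = -(rate Λ X Z * (F Z - F X)) := by ring
  simp only [h, Finset.sum_neg_distrib]
  split_ifs <;> ring

lemma classDrift_sub_le_self' (hΔ : ∀ v, (Finset.univ.filter (G.Adj v)).card ≤ Δ)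
    (hY : Y = Function.update X v j) (hv : v ∉ Λ) (hj : j ≠ X v) :
    ∃ R : ℝ, 0 ≤ R ∧ ∀ F, WtLip G Λ Δ F →
      classDrift G Λ F X v j (X v) - classDrift G Λ F Y v (X v) (X v) ≤
        R * (wt G Λ Δ X v j - (F X - F Y)) - wt G Λ Δ X v j +
          (colNbrs G X v (X v)).card * (1.8085 - 0.3522 * (1 - wt G Λ Δ X v j)) := by
  have hYv : Y v = j := by rw [hY, Function.update_self]
  have hXY : X = Function.update Y v (X v) := by rw [hY]; simp
  obtain ⟨R, hR, h⟩ := classDrift_sub_le_self hΔ hXY hv (by rw [hYv]; exact hj.symm)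
  refine ⟨R, hR, fun F hF => ?_⟩
  have := h _ hF.neg
  rw [classDrift_neg, classDrift_neg, hYv, hY, wt_update, colNbrs_update, ← hY] at this
  linarith

/-- The flips which leave `v` unchanged, and recolour no neighbour of `v` to the colour `j`. -/
def farFlips (G : SimpleGraph V) (X : V → Fin q) (v : V) (j : Fin q) : Finset (V → Fin q) :=
  (flips G X).filter fun Z => Z v = X v ∧ ∀ w, G.Adj v w → X w ≠ j → Z w ≠ j

lemma mem_farFlips : Z ∈ farFlips G X v j ↔
    Z ∈ flips G X ∧ Z v = X v ∧ ∀ w, G.Adj v w → X w ≠ j → Z w ≠ j := by simp [farFlips]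

lemma mem_sideFlips : Z ∈ sideFlips G X v c j ↔
    Z ∈ flips G X ∧ Z v = X v ∧ ∃ w, G.Adj v w ∧ X w = c ∧ Z w = j := by simp [sideFlips]

lemma sum_flips (h : (V → Fin q) → ℝ) : ∑ Z ∈ flips G X, h Z =
    ∑ c, ((if c = X v then 0 else h (flip G X v c)) +
      if c = j then 0 else ∑ Z ∈ sideFlips G X v c j, h Z) + ∑ Z ∈ farFlips G X v j, h Z := by
  have h1 : ∑ Z ∈ (flips G X).filter (fun Z => Z v ≠ X v), h Z =
      ∑ c, if c = X v then 0 else h (flip G X v c) := by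
    rw [← Finset.sum_filter_add_sum_filter_not Finset.univ fun c => c = X v]
    rw [Finset.sum_congr rfl fun c hc => if_pos (Finset.mem_filter.1 hc).2, Finset.sum_const_zero,
      zero_add, Finset.sum_congr rfl fun c hc => if_neg (Finset.mem_filter.1 hc).2]
    symm
    refine Finset.sum_bij (fun c _ => flip G X v c) ?_ ?_ ?_ fun _ _ => rfl
    · intro c hc
      have hc := (Finset.mem_filter.1 hc).2
      exact Finset.mem_filter.2 ⟨flip_mem_flips hc, by simpa using hc⟩
    · intro c _ c' _ he
      simpa using congrFun he v
    · intro Z hZ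
      have hZ := Finset.mem_filter.1 hZ
      exact ⟨Z v, by simpa using hZ.2, (eq_flip_of_mem_flips hZ.1 hZ.2).symm⟩
  have h2 : ∑ Z ∈ (flips G X).filter (fun Z => Z v = X v ∧ ∃ w, G.Adj v w ∧ X w ≠ j ∧ Z w = j),
      h Z = ∑ c, if c = j then 0 else ∑ Z ∈ sideFlips G X v c j, h Z := by
    rw [← Finset.sum_filter_add_sum_filter_not Finset.univ fun c => c = j]
    rw [Finset.sum_congr rfl fun c hc => if_pos (Finset.mem_filter.1 hc).2, Finset.sum_const_zero,
      zero_add, Finset.sum_congr rfl fun c hc => if_neg (Finset.mem_filter.1 hc).2]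
    rw [← Finset.sum_biUnion]
    · refine Finset.sum_congr ?_ fun _ _ => rfl
      ext Z
      simp only [Finset.mem_filter, Finset.mem_biUnion, Finset.mem_univ, true_and, mem_sideFlips]
      constructor
      · rintro ⟨hZ, hv, w, hw, hwj, hZw⟩
        exact ⟨X w, hwj, hZ, hv, w, hw, rfl, hZw⟩
      · rintro ⟨c, hc, hZ, hv, w, hw, rfl, hZw⟩
        exact ⟨hZ, hv, w, hw, hc, hZw⟩
    · intro c hc c' hc' hne
      rw [Function.onFun, Finset.disjoint_left]
      intro Z hZ hZ'
      obtain ⟨hZf, -, w, -, hwc, hwj⟩ := mem_sideFlips.1 hZ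
      obtain ⟨-, -, w', -, hwc', hwj'⟩ := mem_sideFlips.1 hZ'
      have hcj : c ≠ j := by simpa using hc
      have hcj' : c' ≠ j := by simpa using hc'
      have hZe := eq_flip_of_mem_flips (w := w) hZf (by rw [hwc, hwj]; exact hcj.symm)
      have hmem : w' ∈ kempe G X w (Z w) := by
        by_contra hn
        have := flip_of_notMem hn
        rw [← hZe, hwj', hwc'] at this
        exact hcj' this.symm
      rcases eq_or_eq_of_mem_kempe hmem with h | h
      · exact hne (hwc.symm.trans (h.symm.trans hwc'))
      · exact hcj' (hwc'.symm.trans (h.trans hwj))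
  rw [Finset.sum_add_distrib, ← h1, ← h2,
    ← Finset.sum_filter_add_sum_filter_not (flips G X) fun Z => Z v ≠ X v, add_assoc]
  congr 1
  rw [← Finset.sum_filter_add_sum_filter_not _
    fun Z : V → Fin q => ∃ w, G.Adj v w ∧ X w ≠ j ∧ Z w = j, Finset.filter_filter,
    Finset.filter_filter]
  congr 1
  · refine Finset.sum_congr ?_ fun _ _ => rfl
    ext Z; simp only [Finset.mem_filter, not_not]
  · refine Finset.sum_congr ?_ fun _ _ => rfl
    ext Z; simp only [Finset.mem_filter, not_not, farFlips, not_exists, not_and, ne_eq]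

lemma drift_eq (F : (V → Fin q) → ℝ) : drift G Λ F X =
    ∑ c, classDrift G Λ F X v j c + ∑ Z ∈ farFlips G X v j, rate Λ X Z * (F Z - F X) :=
  sum_flips _

lemma update_mem_farFlips (hY : Y = Function.update X v j) (hZ : Z ∈ farFlips G X v j) :
    Function.update Z v j ∈ farFlips G Y v (X v) := by
  obtain ⟨hZf, hZv, hZw⟩ := mem_farFlips.1 hZ
  obtain ⟨u, hu⟩ := exists_ne_of_mem_flips hZf
  have he := eq_flip_of_mem_flips hZf hu
  set c := Z u with hc
  have hvK : v ∉ kempe G X u c := fun h => flip_ne hu h (by rw [← he, hZv])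
  have huv : u ≠ v := by rintro rfl; exact hu hZv
  have hYX (s : V) (hs : s ∈ kempe G X u c) : Y s = X s := by
    rw [hY, Function.update_of_ne]
    rintro rfl
    exact hvK hs
  have hk : kempe G Y u c = kempe G X u c := by
    refine kempe_congr hYX ?_
    intro s hs t ht hst
    by_cases htv : t = v
    · subst htv
      have hYt : Y t = j := by rw [hY, Function.update_self]
      have h := hst.2
      rw [hYt, hYX s hs] at h
      rcases h with ⟨h1, h2⟩ | ⟨h1, h2⟩
      · refine hZw s hst.1.symm (by rw [h1, h2]; exact hu.symm) ?_
        rw [he, flip_of_eq hs h1, h2]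
      · refine hZw s hst.1.symm (by rw [h1, h2]; exact hu) ?_
        rw [he, flip_of_eq' hs h1, h2]
    · refine ht (mem_kempe_of_altAdj hs ⟨hst.1, ?_⟩)
      have h := hst.2
      rwa [hYX s hs, hY, Function.update_of_ne htv] at h
  have hYu : Y u = X u := hYX u self_mem_kempe
  have hfl : Function.update Z v j = flip G Y u c := by
    ext1 s
    by_cases hsv : s = v
    · rw [hsv, Function.update_self, flip_of_notMem (by rwa [hk]), hY, Function.update_self]
    · rw [Function.update_of_ne hsv, he, flip, flip, hk, hYu, hY, Function.update_of_ne hsv]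
  rw [mem_farFlips]
  refine ⟨hfl ▸ flip_mem_flips (by rwa [hYu]), by rw [hY, Function.update_self,
    Function.update_self], fun w hw hwi => ?_⟩
  rw [hY, Function.update_of_ne hw.ne'] at hwi
  rw [Function.update_of_ne hw.ne']
  intro hZi
  have hew := eq_flip_of_mem_flips (w := w) hZf (by rw [hZi]; exact hwi.symm)
  rw [hZi] at hew
  have : v ∈ kempe G X w (X v) :=
    mem_kempe_of_altAdj self_mem_kempe ⟨hw.symm, Or.inl ⟨rfl, rfl⟩⟩
  exact flip_ne hwi.symm this (by rw [← hew, hZv])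

lemma rate_update (hY : Y = Function.update X v j) (hZ : Z v = X v) :
    rate Λ Y (Function.update Z v j) = rate Λ X Z := by
  have : diff Y (Function.update Z v j) = diff X Z := by
    ext s
    rw [mem_diff, mem_diff, hY]
    by_cases hs : s = v
    · subst hs; simp [hZ]
    · rw [Function.update_of_ne hs, Function.update_of_ne hs]
  rw [rate, rate, effSize, effSize, this]

lemma sum_farFlips_update (hY : Y = Function.update X v j) (h : (V → Fin q) → ℝ) :
    ∑ Z ∈ farFlips G Y v (X v), rate Λ Y Z * h Z =
      ∑ Z ∈ farFlips G X v j, rate Λ X Z * h (Function.update Z v j) := by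
  have hXY : X = Function.update Y v (X v) := by rw [hY]; simp
  have hYv : Y v = j := by rw [hY, Function.update_self]
  symm
  refine Finset.sum_bij' (fun Z _ => Function.update Z v j) (fun Z _ => Function.update Z v (X v))
    (fun Z hZ => update_mem_farFlips hY hZ) ?_ ?_ ?_ ?_
  · intro Z hZ
    have := update_mem_farFlips hXY hZ
    rwa [hYv] at this
  · intro Z hZ
    simp only [Function.update_idem]
    rw [← (mem_farFlips.1 hZ).2.1, Function.update_eq_self]
  · intro Z hZ
    simp only [Function.update_idem]
    rw [← hYv, ← (mem_farFlips.1 hZ).2.1, Function.update_eq_self]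
  · intro Z hZ
    rw [rate_update hY (mem_farFlips.1 hZ).2.1]

lemma drift_sub_drift (hY : Y = Function.update X v j) (F : (V → Fin q) → ℝ) :
    drift G Λ F X - drift G Λ F Y =
      ∑ c, (classDrift G Λ F X v j c - classDrift G Λ F Y v (X v) c) +
      ∑ Z ∈ farFlips G X v j,
        rate Λ X Z * ((F Z - F (Function.update Z v j)) - (F X - F Y)) := by
  rw [drift_eq (v := v) (j := j), drift_eq (X := Y) (v := v) (j := X v), sum_farFlips_update hY,
    Finset.sum_sub_distrib]
  have : ∑ Z ∈ farFlips G X v j, rate Λ X Z * ((F Z - F (Function.update Z v j)) - (F X - F Y)) =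
      ∑ Z ∈ farFlips G X v j, rate Λ X Z * (F Z - F X) -
      ∑ Z ∈ farFlips G X v j, rate Λ X Z * (F (Function.update Z v j) - F Y) := by
    rw [← Finset.sum_sub_distrib]
    exact Finset.sum_congr rfl fun Z _ => by ring
  rw [this]
  ring

end FlipDynamics

namespace FlipDynamics

set_option linter.unusedSectionVars false

variable {V : Type} [Fintype V] [DecidableEq V] {q : ℕ} {G : SimpleGraph V}
  {X Y Z : V → Fin q} {u v w x : V} {a b c i j : Fin q} {Λ : Finset V} {Δ : ℕ}

lemma sum_sideFlips_add_sum_farFlips (h : (V → Fin q) → ℝ) :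
    ∑ c, (if c = j then 0 else ∑ Z ∈ sideFlips G X v c j, h Z) + ∑ Z ∈ farFlips G X v j, h Z =
      ∑ Z ∈ (flips G X).filter fun Z => Z v = X v, h Z := by
  rw [Finset.sum_filter, sum_flips (v := v) (j := j)]
  congr 1
  · refine Finset.sum_congr rfl fun c _ => ?_
    have h1 : (if c = X v then (0 : ℝ) else
        if flip G X v c v = X v then h (flip G X v c) else 0) = 0 := by
      rw [flip_self]; split_ifs <;> rfl
    rw [h1, zero_add]
    refine if_congr Iff.rfl rfl (Finset.sum_congr rfl fun Z hZ => ?_)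
    rw [if_pos (mem_sideFlips.1 hZ).2.1]
  · exact Finset.sum_congr rfl fun Z hZ => by rw [if_pos (mem_farFlips.1 hZ).2.1]

lemma rate_flip_le_of_adj (hc : c ≠ X x) {t : V} (ht : G.Adj x t) (htc : X t = c) :
    rate Λ X (flip G X x c) ≤ 0.3239 := by
  rw [← flipProb_two]
  refine flipProb_anti (by norm_num) ?_
  unfold effSize
  rw [diff_flip hc]
  split_ifs
  · have h : ({x, t} : Finset V) ⊆ kempe G X x c := by
      intro s hs
      rw [Finset.mem_insert, Finset.mem_singleton] at hs
      rcases hs with rfl | rfl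
      · exact self_mem_kempe
      · exact mem_kempe_of_altAdj self_mem_kempe ⟨ht, Or.inl ⟨rfl, htc⟩⟩
    have := Finset.card_le_card h
    rwa [Finset.card_pair ht.ne] at this
  · norm_num

lemma rate_flip_of_mem (hc : c ≠ X x) (hx : x ∈ Λ) : rate Λ X (flip G X x c) = 0 := by
  by_contra h
  have := disjoint_of_rate_ne_zero h
  rw [diff_flip hc] at this
  exact Finset.disjoint_left.1 this self_mem_kempe hx

lemma rate_flip_add_rate_flip_le (hwx : G.Adj w x) (hi : X x ≠ i) (hj : X x ≠ j) :
    rate Λ X (flip G X x i) + rate Λ X (flip G X x j) ≤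
      1.3239 + if x ∈ freeNbrs G Λ X w i j then 0.6761 else 0 := by
  have hi1 := rate_le_one (Λ := Λ) (X := X) (Z := flip G X x i)
  have hj1 := rate_le_one (Λ := Λ) (X := X) (Z := flip G X x j)
  split_ifs with hx
  · norm_num; linarith
  rw [mem_freeNbrs] at hx
  by_cases hxΛ : x ∈ Λ
  · rw [rate_flip_of_mem hi.symm hxΛ, rate_flip_of_mem hj.symm hxΛ]; norm_num
  have : ∃ t, G.Adj x t ∧ (X t = i ∨ X t = j) := by
    by_contra hno
    push Not at hno
    exact hx ⟨hwx, hxΛ, ⟨hi, hj⟩, fun t ht _ => hno t ht⟩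
  obtain ⟨t, ht, h | h⟩ := this
  · have := rate_flip_le_of_adj (Λ := Λ) hi.symm ht h
    linarith
  · have := rate_flip_le_of_adj (Λ := Λ) hj.symm ht h
    linarith

/-- The rate at which a free neighbour is lost. -/
lemma sum_rate_notMem_freeNbrs_le (hΔ : ∀ v, (Finset.univ.filter (G.Adj v)).card ≤ Δ)
    (hw : w ∈ freeNbrs G Λ X v (X v) j) :
    ∑ Z ∈ (flips G X).filter (fun Z => Z v = X v),
      rate Λ X Z * (if w ∉ freeNbrs G Λ Z v (X v) j then 1 else 0) ≤
      1.3239 * Δ + 0.6761 * (freeNbrs G Λ X w (X v) j).card := by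
  obtain ⟨hvw, hwΛ, ⟨hwi, hwj⟩, hfar⟩ := mem_freeNbrs.1 hw
  set N := (Finset.univ.filter (G.Adj w)).erase v with hN
  have hNmem (x : V) (hx : x ∈ N) : G.Adj w x ∧ x ≠ v := by
    simpa [hN, and_comm] using hx
  have hpt (Z : V → Fin q) (hZ : Z ∈ (flips G X).filter (fun Z => Z v = X v)) :
      rate Λ X Z * (if w ∉ freeNbrs G Λ Z v (X v) j then 1 else 0) ≤
        (if Z = flip G X w j then rate Λ X Z else 0) +
        ∑ x ∈ N, ((if Z = flip G X x (X v) then rate Λ X Z else 0) +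
          if Z = flip G X x j then rate Λ X Z else 0) := by
    have hr := rate_nonneg (Λ := Λ) (X := X) (Z := Z)
    have n1 (W : V → Fin q) : 0 ≤ if Z = W then rate Λ X Z else 0 := by split_ifs <;> linarith
    have n2 : 0 ≤ ∑ x ∈ N, ((if Z = flip G X x (X v) then rate Λ X Z else 0) +
          if Z = flip G X x j then rate Λ X Z else 0) :=
      Finset.sum_nonneg fun x _ => add_nonneg (n1 _) (n1 _)
    obtain ⟨hZf, hZv⟩ := Finset.mem_filter.1 hZ
    split_ifs with hU h h
    · linarith
    · linarith
    · linarith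
    · rw [mul_one, zero_add]
      rw [mem_freeNbrs] at hU
      have : ∃ x ∈ N, Z x = X v ∨ Z x = j := by
        by_contra hno
        push Not at hno
        refine hU ⟨hvw, hwΛ, ⟨fun hZw => ?_, fun hZw => ?_⟩, fun x hx hxv => ?_⟩
        · have he := eq_flip_of_mem_flips hZf (by rw [hZw]; exact hwi.symm : Z w ≠ X w)
          rw [hZw] at he
          have : v ∈ kempe G X w (X v) :=
            mem_kempe_of_altAdj self_mem_kempe ⟨hvw.symm, Or.inl ⟨rfl, rfl⟩⟩
          exact flip_ne hwi.symm this (by rw [← he, hZv])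
        · have he := eq_flip_of_mem_flips hZf (by rw [hZw]; exact hwj.symm : Z w ≠ X w)
          rw [hZw] at he
          exact h he
        · exact hno x (by simpa [hN] using ⟨hxv, hx⟩)
      obtain ⟨x, hx, hxZ⟩ := this
      have hxX := hfar x (hNmem x hx).1 (hNmem x hx).2
      refine le_trans ?_ (Finset.single_le_sum (fun x _ => add_nonneg (n1 _) (n1 _)) hx)
      rcases hxZ with hxZ | hxZ
      · have he := eq_flip_of_mem_flips hZf (by rw [hxZ]; exact hxX.1.symm : Z x ≠ X x)
        rw [hxZ] at he
        rw [if_pos he]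
        linarith [n1 (flip G X x j)]
      · have he := eq_flip_of_mem_flips hZf (by rw [hxZ]; exact hxX.2.symm : Z x ≠ X x)
        rw [hxZ] at he
        rw [if_pos he]
        linarith [n1 (flip G X x (X v))]
  have hone (W : V → Fin q) : ∑ Z ∈ (flips G X).filter (fun Z => Z v = X v),
      (if Z = W then rate Λ X Z else 0) ≤ rate Λ X W := by
    rw [Finset.sum_ite_eq']
    split_ifs
    · exact le_rfl
    · exact rate_nonneg
  have hcardN : (N.card : ℝ) + 1 ≤ Δ := by
    have : N.card + 1 ≤ Δ := by
      rw [hN, Finset.card_erase_add_one (by simpa using hvw.symm)]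
      exact hΔ w
    exact_mod_cast this
  calc _ ≤ ∑ Z ∈ (flips G X).filter (fun Z => Z v = X v),
        ((if Z = flip G X w j then rate Λ X Z else 0) +
        ∑ x ∈ N, ((if Z = flip G X x (X v) then rate Λ X Z else 0) +
          if Z = flip G X x j then rate Λ X Z else 0)) := Finset.sum_le_sum hpt
    _ ≤ rate Λ X (flip G X w j) +
        ∑ x ∈ N, (rate Λ X (flip G X x (X v)) + rate Λ X (flip G X x j)) := by
      rw [Finset.sum_add_distrib, Finset.sum_comm]
      refine add_le_add (hone _) (Finset.sum_le_sum fun x _ => ?_)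
      rw [Finset.sum_add_distrib]
      exact add_le_add (hone _) (hone _)
    _ ≤ 1 + ∑ x ∈ N, (1.3239 + if x ∈ freeNbrs G Λ X w (X v) j then 0.6761 else 0) := by
      refine add_le_add rate_le_one (Finset.sum_le_sum fun x hx => ?_)
      have hxX := hfar x (hNmem x hx).1 (hNmem x hx).2
      exact rate_flip_add_rate_flip_le (hNmem x hx).1 hxX.1 hxX.2
    _ ≤ _ := by
      rw [Finset.sum_add_distrib, Finset.sum_const, nsmul_eq_mul, ← Finset.sum_filter,
        Finset.sum_const, nsmul_eq_mul]
      have : ((N.filter fun x => x ∈ freeNbrs G Λ X w (X v) j).card : ℝ) ≤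
          (freeNbrs G Λ X w (X v) j).card := by
        exact_mod_cast Finset.card_le_card fun x hx => (Finset.mem_filter.1 hx).2
      norm_num
      linarith

lemma card_sdiff_eq_sum {α : Type*} [DecidableEq α] (A B : Finset α) :
    ((A \ B).card : ℝ) = ∑ w ∈ A, if w ∉ B then 1 else 0 := by
  rw [← Finset.sum_filter, Finset.sum_const, nsmul_eq_mul, mul_one, Finset.sdiff_eq_filter]

lemma sum_rate_mul_freeLoss_le (hΔ : ∀ v, (Finset.univ.filter (G.Adj v)).card ≤ Δ) :
    ∑ Z ∈ (flips G X).filter (fun Z => Z v = X v), rate Λ X Z * freeLoss G Λ Δ X v j Z ≤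
      ∑ w ∈ freeNbrs G Λ X v (X v) j,
        (0.0475 / Δ * (1.3239 * Δ + 0.6761 * ((freeNbrs G Λ X w (X v) j).card : ℝ)) : ℝ) := by
  have h (Z : V → Fin q) : rate Λ X Z * freeLoss G Λ Δ X v j Z =
      ∑ w ∈ freeNbrs G Λ X v (X v) j, (0.0475 / Δ : ℝ) *
        (rate Λ X Z * if w ∉ freeNbrs G Λ Z v (X v) j then 1 else 0) := by
    rw [← Finset.mul_sum, ← Finset.mul_sum, ← card_sdiff_eq_sum, freeLoss]
    ring
  simp only [h]
  rw [Finset.sum_comm]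
  refine Finset.sum_le_sum fun w hw => ?_
  rw [← Finset.mul_sum]
  exact mul_le_mul_of_nonneg_left (sum_rate_notMem_freeNbrs_le hΔ hw) (by positivity)

/-- The rate at which a near neighbour becomes free. -/
lemma le_sum_rate_mem_freeNbrs (hΔ : ∀ v, (Finset.univ.filter (G.Adj v)).card ≤ Δ)
    (hw : w ∈ nearNbrs G Λ X v (X v) j) :
    (q : ℝ) - Δ - 2 ≤ ∑ Z ∈ farFlips G X v j, rate Λ X Z *
      if w ∈ freeNbrs G Λ Z v (X v) j \ freeNbrs G Λ X v (X v) j then 1 else 0 := by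
  obtain ⟨hvw, hwΛ, ⟨hwi, hwj⟩, x, hwx, hxv, hxΛ, hxc, huniq⟩ := mem_nearNbrs.1 hw
  set S : Finset (Fin q) := Finset.univ.filter fun c =>
    c ≠ X v ∧ c ≠ j ∧ ∀ t, G.Adj x t → X t ≠ c with hS
  have hSmem (c : Fin q) (hc : c ∈ S) : c ≠ X v ∧ c ≠ j ∧ ∀ t, G.Adj x t → X t ≠ c := by
    simpa [hS] using hc
  have hcard : (q : ℝ) - Δ - 2 ≤ S.card := by
    have h : (Finset.univ : Finset (Fin q)) ⊆
        S ∪ ({X v, j} ∪ (Finset.univ.filter (G.Adj x)).image X) := by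
      intro c _
      by_contra hc
      simp only [hS, Finset.mem_union, Finset.mem_filter, Finset.mem_univ, true_and,
        Finset.mem_insert, Finset.mem_singleton, Finset.mem_image, not_or, not_exists,
        not_and] at hc
      exact hc.1 hc.2.1.1 hc.2.1.2 hc.2.2
    have h1 := (Finset.card_le_card h).trans (Finset.card_union_le _ _)
    have h2 := Finset.card_union_le {X v, j} ((Finset.univ.filter (G.Adj x)).image X)
    have h3 := (Finset.card_image_le (s := Finset.univ.filter (G.Adj x)) (f := X)).trans (hΔ x)
    have h4 : ({X v, j} : Finset (Fin q)).card ≤ 2 := Finset.card_le_two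
    rw [Finset.card_univ, Fintype.card_fin] at h1
    have : (q : ℝ) ≤ S.card + (2 + Δ) := by
      exact_mod_cast h1.trans (by omega)
    linarith
  have hne (c : Fin q) (hc : c ∈ S) : c ≠ X x := by
    rintro rfl
    rcases hxc with h | h
    · exact (hSmem _ hc).1 h
    · exact (hSmem _ hc).2.1 h
  have hfl (c : Fin q) (hc : c ∈ S) : flip G X x c = Function.update X x c :=
    flip_eq_update (hSmem c hc).2.2
  have hfar (c : Fin q) (hc : c ∈ S) : Function.update X x c ∈ farFlips G X v j := by
    rw [mem_farFlips]
    refine ⟨hfl c hc ▸ flip_mem_flips (hne c hc), Function.update_of_ne hxv.symm _ _, ?_⟩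
    intro t _ htj
    by_cases htx : t = x
    · rw [htx, Function.update_self]; exact (hSmem c hc).2.1
    · rwa [Function.update_of_ne htx]
  have hrate (c : Fin q) (hc : c ∈ S) : rate Λ X (Function.update X x c) = 1 := by
    have hk := kempe_eq_singleton (hSmem c hc).2.2
    rw [← hfl c hc, rate, effSize_flip_of_disjoint (hne c hc) (by rw [hk]; simpa using hxΛ), hk]
    simp
  have hmem (c : Fin q) (hc : c ∈ S) : w ∈ freeNbrs G Λ (Function.update X x c) v (X v) j \
      freeNbrs G Λ X v (X v) j := by
    rw [Finset.mem_sdiff, mem_freeNbrs, mem_freeNbrs]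
    refine ⟨⟨hvw, hwΛ, by rw [Function.update_of_ne hwx.ne]; exact ⟨hwi, hwj⟩, ?_⟩, ?_⟩
    · intro t ht htv
      by_cases htx : t = x
      · rw [htx, Function.update_self]; exact ⟨(hSmem c hc).1, (hSmem c hc).2.1⟩
      · rw [Function.update_of_ne htx]
        exact ⟨fun h => htx (huniq t ht htv (Or.inl h)), fun h => htx (huniq t ht htv (Or.inr h))⟩
    · rintro ⟨-, -, -, h⟩
      have := h x hwx hxv
      tauto
  refine hcard.trans ?_
  have hinj : Set.InjOn (fun c => Function.update X x c) S := by
    intro c _ c' _ h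
    simpa using congrFun h x
  calc (S.card : ℝ) = ∑ c ∈ S, (1 : ℝ) := by simp
    _ = ∑ c ∈ S, rate Λ X (Function.update X x c) * (if w ∈ freeNbrs G Λ (Function.update X x c) v
          (X v) j \ freeNbrs G Λ X v (X v) j then 1 else 0) :=
      Finset.sum_congr rfl fun c hc => by rw [hrate c hc, if_pos (hmem c hc), mul_one]
    _ = ∑ Z ∈ S.image (fun c => Function.update X x c), rate Λ X Z * (if w ∈ freeNbrs G Λ Z v
          (X v) j \ freeNbrs G Λ X v (X v) j then 1 else 0) := by
      rw [Finset.sum_image hinj]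
    _ ≤ _ := by
      refine Finset.sum_le_sum_of_subset_of_nonneg ?_ fun Z _ _ =>
        mul_nonneg rate_nonneg (by split_ifs <;> norm_num)
      intro Z hZ
      obtain ⟨c, hc, rfl⟩ := Finset.mem_image.1 hZ
      exact hfar c hc

/-- The gain of free neighbours in a transition from `X` to `Z`. -/
def freeGain (G : SimpleGraph V) (Λ : Finset V) (Δ : ℕ) (X : V → Fin q) (v : V) (j : Fin q)
    (Z : V → Fin q) : ℝ :=
  0.0475 * (freeNbrs G Λ Z v (X v) j \ freeNbrs G Λ X v (X v) j).card / Δ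

lemma wt_eq_of_eq (h : Z v = X v) :
    wt G Λ Δ Z v j = wt G Λ Δ X v j + freeLoss G Λ Δ X v j Z - freeGain G Λ Δ X v j Z := by
  unfold wt freeLoss freeGain
  rw [h]
  have h1 : ((freeNbrs G Λ X v (X v) j).card : ℝ) +
      (freeNbrs G Λ Z v (X v) j \ freeNbrs G Λ X v (X v) j).card =
      (freeNbrs G Λ Z v (X v) j).card +
      (freeNbrs G Λ X v (X v) j \ freeNbrs G Λ Z v (X v) j).card := by
    have h2 := Finset.card_sdiff_add_card (freeNbrs G Λ Z v (X v) j) (freeNbrs G Λ X v (X v) j)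
    have h3 := Finset.card_sdiff_add_card (freeNbrs G Λ X v (X v) j) (freeNbrs G Λ Z v (X v) j)
    rw [Finset.union_comm] at h3
    exact_mod_cast (by omega)
  linear_combination (0.0475 / Δ : ℝ) * h1

lemma le_sum_rate_mul_freeGain (hΔ : ∀ v, (Finset.univ.filter (G.Adj v)).card ≤ Δ) :
    0.0475 / Δ * ((nearNbrs G Λ X v (X v) j).card * ((q : ℝ) - Δ - 2)) ≤
      ∑ Z ∈ farFlips G X v j, rate Λ X Z * freeGain G Λ Δ X v j Z := by
  have h (Z : V → Fin q) : 0.0475 / Δ * ∑ w ∈ nearNbrs G Λ X v (X v) j, (rate Λ X Z *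
      if w ∈ freeNbrs G Λ Z v (X v) j \ freeNbrs G Λ X v (X v) j then 1 else 0) ≤
      rate Λ X Z * freeGain G Λ Δ X v j Z := by
    rw [← Finset.mul_sum, ← Finset.sum_filter, Finset.sum_const, nsmul_eq_mul, mul_one, freeGain]
    have h1 : (((nearNbrs G Λ X v (X v) j).filter fun w =>
        w ∈ freeNbrs G Λ Z v (X v) j \ freeNbrs G Λ X v (X v) j).card : ℝ) ≤
        (freeNbrs G Λ Z v (X v) j \ freeNbrs G Λ X v (X v) j).card := by
      exact_mod_cast Finset.card_le_card fun w hw => (Finset.mem_filter.1 hw).2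
    have h2 := mul_le_mul_of_nonneg_left h1 (mul_nonneg (by positivity : (0 : ℝ) ≤ 0.0475 / Δ)
      (rate_nonneg (Λ := Λ) (X := X) (Z := Z)))
    calc _ = _ := by ring
      _ ≤ _ := h2
      _ = _ := by ring
  refine le_trans ?_ (Finset.sum_le_sum fun Z _ => h Z)
  rw [← Finset.mul_sum, Finset.sum_comm]
  refine mul_le_mul_of_nonneg_left ?_ (by positivity)
  rw [← nsmul_eq_mul]
  exact Finset.card_nsmul_le_sum _ _ _ fun w hw => le_sum_rate_mem_freeNbrs hΔ hw

/-- The range of parameters in which flip dynamics contracts. -/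
def InRange (Δ q : ℕ) : Prop :=
  (125 ≤ Δ ∧ (1.809 : ℝ) * Δ ≤ q) ∨ (3 ≤ Δ ∧ 11 * Δ ≤ 6 * q)

lemma InRange.of_le (h : (125 ≤ Δ ∧ (1.809 : ℝ) * Δ ≤ q) ∨
    (3 ≤ Δ ∧ ((11 : ℝ) / 6 - 1 / 1000) * Δ ≤ q)) : InRange Δ q := by
  rcases h with h | ⟨h3, h⟩
  · exact Or.inl h
  by_cases hΔ : 125 ≤ Δ
  · refine Or.inl ⟨hΔ, le_trans ?_ h⟩
    gcongr
    norm_num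
  · refine Or.inr ⟨h3, ?_⟩
    have hΔ' : (Δ : ℝ) ≤ 124 := by exact_mod_cast (by omega : Δ ≤ 124)
    have : (11 * Δ : ℝ) < 6 * q + 1 := by linarith
    have : 11 * Δ < 6 * q + 1 := by exact_mod_cast this
    omega

lemma InRange.three_le (h : InRange Δ q) : 3 ≤ Δ := by
  rcases h with h | h <;> omega

lemma InRange.two_le (h : InRange Δ q) : (1.809 : ℝ) * Δ ≤ q := by
  rcases h with h | ⟨h3, h⟩
  · exact h.2
  · have : (11 * Δ : ℝ) ≤ 6 * q := by exact_mod_cast h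
    linarith [(Nat.cast_nonneg Δ : (0 : ℝ) ≤ Δ)]

lemma InRange.succ_le (h : InRange Δ q) : Δ + 1 ≤ q := by
  have h1 := h.two_le
  have h2 : (3 : ℝ) ≤ Δ := by exact_mod_cast h.three_le
  have : (Δ : ℝ) + 1 ≤ q := by linarith
  exact_mod_cast this

lemma InRange.drift_bound (h : InRange Δ q) {s t : ℝ} (hs1 : s ≤ 1)
    (ht0 : 0 ≤ t) (ht1 : t ≤ 1) :
    -q + 1.8085 * Δ + 0.0475 * s * (q - 1.809 * Δ) + 0.0475 * t * (1.793 * Δ + 2 - q) ≤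
      -0.005 := by
  have h1 := h.two_le
  have hs : s * (q - 1.809 * Δ) ≤ q - 1.809 * Δ := by
    have := mul_le_mul_of_nonneg_right hs1 (sub_nonneg.2 h1)
    linarith
  have key : -0.9525 * (q - 1.809 * Δ : ℝ) - 0.0005 * Δ ≤ -0.005 ∧
      -0.9525 * (q - 1.809 * Δ : ℝ) - 0.0005 * Δ + 0.0475 * (1.793 * Δ + 2 - q) ≤ -0.005 := by
    rcases h with ⟨hΔ, h⟩ | ⟨hΔ, h⟩
    · have hΔ' : (125 : ℝ) ≤ Δ := by exact_mod_cast hΔ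
      constructor <;> linarith
    · have h' : (11 * Δ : ℝ) ≤ 6 * q := by exact_mod_cast h
      by_cases h3 : Δ = 3
      · subst h3
        have : (6 : ℝ) ≤ q := by exact_mod_cast (by omega : 6 ≤ q)
        constructor <;> norm_num <;> linarith
      · have hΔ' : (4 : ℝ) ≤ Δ := by exact_mod_cast (by omega : 4 ≤ Δ)
        constructor <;> linarith
  have ht : -0.9525 * (q - 1.809 * Δ : ℝ) - 0.0005 * Δ + 0.0475 * (t * (1.793 * Δ + 2 - q)) ≤
      -0.005 := by
    nlinarith [mul_le_mul_of_nonneg_left key.2 ht0,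
      mul_le_mul_of_nonneg_left key.1 (sub_nonneg.2 ht1)]
  linarith

lemma sum_colNbrs (h : V → ℝ) :
    ∑ c, ∑ w ∈ colNbrs G X v c, h w = ∑ w ∈ Finset.univ.filter (G.Adj v), h w := by
  rw [← Finset.sum_fiberwise (Finset.univ.filter (G.Adj v)) X h]
  refine Finset.sum_congr rfl fun c _ => Finset.sum_congr ?_ fun _ _ => rfl
  ext w
  simp [mem_colNbrs]

lemma sum_nbrCost_le (hΔ : ∀ v, (Finset.univ.filter (G.Adj v)).card ≤ Δ) :
    ∑ w ∈ Finset.univ.filter (G.Adj v), nbrCost G Λ Δ X v j w ≤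
      Δ * (1.8085 - 0.3522 * (1 - wt G Λ Δ X v j)) +
        0.0376675 * (nearNbrs G Λ X v (X v) j).card -
        ∑ w ∈ freeNbrs G Λ X v (X v) j,
          ((0.13208325 + 0.6761 * (0.0475 * (freeNbrs G Λ X w (X v) j).card / Δ)) : ℝ) := by
  unfold nbrCost
  rw [Finset.sum_sub_distrib, Finset.sum_add_distrib, Finset.sum_const, nsmul_eq_mul,
    ← Finset.sum_filter, ← Finset.sum_filter, Finset.sum_const, nsmul_eq_mul]
  have h1 : ((Finset.univ.filter (G.Adj v)).filter
      fun w => w ∈ nearNbrs G Λ X v (X v) j) = nearNbrs G Λ X v (X v) j := by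
    ext w
    simp only [Finset.mem_filter, Finset.mem_univ, true_and, and_iff_right_iff_imp]
    exact fun h => (mem_nearNbrs.1 h).1
  have h2 : ((Finset.univ.filter (G.Adj v)).filter
      fun w => w ∈ freeNbrs G Λ X v (X v) j) = freeNbrs G Λ X v (X v) j := by
    ext w
    simp only [Finset.mem_filter, Finset.mem_univ, true_and, and_iff_right_iff_imp]
    exact fun h => (mem_freeNbrs.1 h).1
  rw [h1, h2]
  have h3 : ((Finset.univ.filter (G.Adj v)).card : ℝ) *
      (1.8085 - 0.3522 * (1 - wt G Λ Δ X v j)) ≤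
      Δ * (1.8085 - 0.3522 * (1 - wt G Λ Δ X v j)) := by
    refine mul_le_mul_of_nonneg_right (by exact_mod_cast hΔ v) ?_
    linarith [le_wt (Λ := Λ) (X := X) (v := v) (j := j) hΔ]
  linarith

lemma sum_colNbrs_nbrCost_of_eq (hc : c = X v ∨ c = j) :
    ∑ w ∈ colNbrs G X v c, nbrCost G Λ Δ X v j w =
      (colNbrs G X v c).card * (1.8085 - 0.3522 * (1 - wt G Λ Δ X v j)) := by
  rw [← nsmul_eq_mul, ← Finset.sum_const]
  refine Finset.sum_congr rfl fun w hw => ?_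
  obtain ⟨_, hwc⟩ := mem_colNbrs.1 hw
  have h (h' : X w ≠ X v ∧ X w ≠ j) : False := by
    rcases hc with hc | hc
    · exact h'.1 (hwc.trans hc)
    · exact h'.2 (hwc.trans hc)
  rw [nbrCost, if_neg fun hw => h (mem_nearNbrs.1 hw).2.2.1,
    if_neg fun hw => h (mem_freeNbrs.1 hw).2.2.1, add_zero, sub_zero]

lemma exists_classDrift_sub_le (hΔ : ∀ v, (Finset.univ.filter (G.Adj v)).card ≤ Δ)
    (hY : Y = Function.update X v j) (hv : v ∉ Λ) (hj : j ≠ X v) (c : Fin q) :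
    ∃ R : ℝ, 0 ≤ R ∧ ∀ F, WtLip G Λ Δ F →
      classDrift G Λ F X v j c - classDrift G Λ F Y v (X v) c ≤
        R * (wt G Λ Δ X v j - (F X - F Y)) - wt G Λ Δ X v j +
          ∑ w ∈ colNbrs G X v c, nbrCost G Λ Δ X v j w +
          if c = j then 0 else ∑ Z ∈ sideFlips G X v c j, rate Λ X Z * freeLoss G Λ Δ X v j Z := by
  by_cases hcj : c = j
  · subst hcj
    obtain ⟨R, hR, h⟩ := classDrift_sub_le_self hΔ hY hv hj
    refine ⟨R, hR, fun F hF => ?_⟩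
    rw [if_pos rfl, sum_colNbrs_nbrCost_of_eq (Or.inr rfl), add_zero]
    exact h F hF
  rw [if_neg hcj]
  by_cases hcv : c = X v
  · obtain ⟨R, hR, h⟩ := classDrift_sub_le_self' hΔ hY hv hj
    refine ⟨R, hR, fun F hF => ?_⟩
    rw [sum_colNbrs_nbrCost_of_eq (Or.inl hcv)]
    have h0 : 0 ≤ ∑ Z ∈ sideFlips G X v c j, rate Λ X Z * freeLoss G Λ Δ X v j Z :=
      Finset.sum_nonneg fun Z _ => mul_nonneg rate_nonneg freeLoss_nonneg
    have := h F hF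
    rw [← hcv] at this ⊢
    linarith
  · exact classDrift_sub_le hΔ hY hv hj hcv hcj

/-- Contraction of flip dynamics across one free vertex of disagreement. -/
lemma exists_drift_sub_le (hq : InRange Δ q)
    (hΔ : ∀ v, (Finset.univ.filter (G.Adj v)).card ≤ Δ) (hv : v ∉ Λ) (hj : j ≠ X v) :
    ∃ R : ℝ, 0 ≤ R ∧ ∀ F, WtLip G Λ Δ F →
      drift G Λ F X - drift G Λ F (Function.update X v j) ≤
        R * (wt G Λ Δ X v j - (F X - F (Function.update X v j))) - 0.005 := by
  choose R hR hRF using exists_classDrift_sub_le (Λ := Λ) hΔ (rfl : _ = Function.update X v j) hv hj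
  refine ⟨∑ c, R c + ∑ Z ∈ farFlips G X v j, rate Λ X Z,
    add_nonneg (Finset.sum_nonneg fun c _ => hR c) (Finset.sum_nonneg fun Z _ => rate_nonneg),
    fun F hF => ?_⟩
  rw [drift_sub_drift rfl]
  set D := F X - F (Function.update X v j) with hD
  set W := wt G Λ Δ X v j with hW
  have hfar : ∑ Z ∈ farFlips G X v j, rate Λ X Z * ((F Z - F (Function.update Z v j)) - D) ≤
      ∑ Z ∈ farFlips G X v j, (rate Λ X Z * (W - D) + rate Λ X Z * freeLoss G Λ Δ X v j Z -
        rate Λ X Z * freeGain G Λ Δ X v j Z) := by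
    refine Finset.sum_le_sum fun Z hZ => ?_
    have hZv := (mem_farFlips.1 hZ).2.1
    have h1 := hF Z v j hv (by rwa [hZv])
    rw [wt_eq_of_eq hZv] at h1
    have := mul_le_mul_of_nonneg_left h1 (rate_nonneg (Λ := Λ) (X := X) (Z := Z))
    linarith
  rw [Finset.sum_sub_distrib, Finset.sum_add_distrib, ← Finset.sum_mul] at hfar
  have hcls := Finset.sum_le_sum fun c (_ : c ∈ Finset.univ) => hRF c F hF
  rw [Finset.sum_add_distrib, Finset.sum_add_distrib, Finset.sum_sub_distrib _ (fun _ => W),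
    ← Finset.sum_mul, sum_colNbrs, Finset.sum_const, nsmul_eq_mul, Finset.card_univ,
    Fintype.card_fin] at hcls
  have hloss := sum_rate_mul_freeLoss_le (Λ := Λ) (X := X) (v := v) (j := j) hΔ
  rw [← sum_sideFlips_add_sum_farFlips (v := v) (j := j)] at hloss
  have hgain := le_sum_rate_mul_freeGain (Λ := Λ) (X := X) (v := v) (j := j) hΔ
  have hcost := sum_nbrCost_le (Λ := Λ) (X := X) (v := v) (j := j) hΔ
  have h3 : (3 : ℝ) ≤ Δ := by exact_mod_cast hq.three_le
  have hU : ∑ w ∈ freeNbrs G Λ X v (X v) j,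
        (0.0475 / Δ * (1.3239 * Δ + 0.6761 * ((freeNbrs G Λ X w (X v) j).card : ℝ)) : ℝ) -
      ∑ w ∈ freeNbrs G Λ X v (X v) j,
          ((0.13208325 + 0.6761 * (0.0475 * (freeNbrs G Λ X w (X v) j).card / Δ)) : ℝ) =
      -0.069198 * (freeNbrs G Λ X v (X v) j).card := by
    rw [← Finset.sum_sub_distrib, mul_comm (-0.069198),
      ← nsmul_eq_mul (freeNbrs G Λ X v (X v) j).card,
      ← Finset.sum_const]
    refine Finset.sum_congr rfl fun w _ => ?_
    field_simp
    ring
  have hnum := hq.drift_bound (s := (freeNbrs G Λ X v (X v) j).card / Δ)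
    (t := (nearNbrs G Λ X v (X v) j).card / Δ) ?_ (by positivity) ?_
  · have e1 : W = 1 - 0.0475 * ((freeNbrs G Λ X v (X v) j).card / Δ) := by
      rw [hW, wt]; ring
    set u : ℝ := ((freeNbrs G Λ X v (X v) j).card : ℝ)
    set b : ℝ := ((nearNbrs G Λ X v (X v) j).card : ℝ)
    have e2 : u / Δ * Δ = u := by field_simp
    have e3 : b / Δ * Δ = b := by field_simp
    have e4 : 0.0475 / (Δ : ℝ) * (b * (q - Δ - 2)) = 0.0475 * (b / Δ) * (q - Δ - 2) := by ring
    rw [e4] at hgain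
    have e5 : -q + 1.8085 * Δ + 0.0475 * (u / Δ) * (q - 1.809 * Δ) +
        0.0475 * (b / Δ) * (1.793 * Δ + 2 - q) =
        -q * W + Δ * (1.8085 - 0.3522 * (1 - W)) + 0.0376675 * b - 0.069198 * u -
        0.0475 * (b / Δ) * (q - Δ - 2) := by
      rw [e1]
      linear_combination (-0.069198 : ℝ) * e2 + 0.0376675 * e3
    linarith
  · refine div_le_one_of_le₀ ?_ (by positivity)
    exact_mod_cast (Finset.card_le_card freeNbrs_subset).trans (hΔ v)
  · refine div_le_one_of_le₀ ?_ (by positivity)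
    exact_mod_cast (Finset.card_le_card fun w hw => by
      simpa using (mem_nearNbrs.1 hw).1).trans (hΔ v)

end FlipDynamics

namespace FlipDynamics

set_option linter.unusedSectionVars false

variable {V : Type} [Fintype V] [DecidableEq V] {q : ℕ} {G : SimpleGraph V}
  {X Y Z : V → Fin q} {u v w x : V} {a b c i j : Fin q} {Λ : Finset V} {Δ : ℕ}
  {F : (V → Fin q) → ℝ} {K M N : ℝ}

lemma rate_mul_le_one (hF : HamLip Λ F) : rate Λ X Z * (F Z - F X) ≤ 1 := by
  by_cases hr : rate Λ X Z = 0
  · rw [hr]; norm_num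
  have hd := disjoint_of_rate_ne_zero hr
  rw [diff_comm] at hd
  have h1 := mul_le_mul_of_nonneg_left (hF Z X hd) (rate_nonneg (Λ := Λ) (X := X) (Z := Z))
  rw [diff_comm] at hd h1
  refine h1.trans ?_
  rw [rate, effSize_of_disjoint hd, mul_comm]
  exact mul_flipProb_le_one _

lemma classDrift_le_card (hF : HamLip Λ F) (hv : v ∈ Λ) :
    classDrift G Λ F X v j c ≤ (colNbrs G X v c).card := by
  unfold classDrift
  have h1 : (if c = X v then 0 else
      rate Λ X (flip G X v c) * (F (flip G X v c) - F X)) = 0 := by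
    split_ifs with h
    · rfl
    · rw [rate_flip_of_mem h hv, zero_mul]
  rw [h1, zero_add]
  split_ifs with hcj
  · positivity
  · obtain ⟨R, hRN, -, hRs, -, -⟩ := exists_reps (G := G) (Y := X) (v := v) hcj
    rw [hRs]
    calc _ ≤ ∑ w ∈ R, (1 : ℝ) := Finset.sum_le_sum fun w _ => rate_mul_le_one hF
      _ = R.card := by simp
      _ ≤ _ := by exact_mod_cast Finset.card_le_card hRN

lemma sum_card_colNbrs_le (hΔ : ∀ v, (Finset.univ.filter (G.Adj v)).card ≤ Δ) :
    ∑ c, ((colNbrs G X v c).card : ℝ) ≤ Δ := by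
  have h := sum_colNbrs (G := G) (X := X) (v := v) fun _ => (1 : ℝ)
  simp only [Finset.sum_const, nsmul_eq_mul, mul_one] at h
  rw [h]
  exact_mod_cast hΔ v

/-- The drift across one pinned vertex of disagreement. -/
lemma drift_sub_le_of_mem (hΔ : ∀ v, (Finset.univ.filter (G.Adj v)).card ≤ Δ)
    (hF : HamLip Λ F) (hv : v ∈ Λ) :
    drift G Λ F X - drift G Λ F (Function.update X v j) ≤ 2 * Δ +
      ∑ Z ∈ farFlips G X v j, rate Λ X Z *
        ((F Z - F (Function.update Z v j)) - (F X - F (Function.update X v j))) := by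
  rw [drift_sub_drift rfl]
  gcongr
  calc _ ≤ ∑ c, (((colNbrs G X v c).card : ℝ) + (colNbrs G X v c).card) := by
        refine Finset.sum_le_sum fun c _ => ?_
        have h1 := classDrift_le_card (G := G) (X := X) (j := j) (c := c) hF hv
        have h2 := classDrift_le_card (G := G) (X := Function.update X v j) (j := X v) (c := c)
          hF.neg hv
        rw [classDrift_neg, colNbrs_update] at h2
        linarith
    _ ≤ _ := by
      rw [Finset.sum_add_distrib]
      linarith [sum_card_colNbrs_le (X := X) (v := v) hΔ]

/-- One step of flip dynamics, slowed down by the factor `N`. -/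
def step (G : SimpleGraph V) (Λ : Finset V) (N : ℝ) (F : (V → Fin q) → ℝ) (X : V → Fin q) : ℝ :=
  F X + drift G Λ F X / N

lemma drift_const_mul (r : ℝ) : drift G Λ (fun Z => r * F Z) X = r * drift G Λ F X := by
  unfold drift
  rw [Finset.mul_sum]
  exact Finset.sum_congr rfl fun Z _ => by ring

lemma step_const_mul (r : ℝ) : step G Λ N (fun Z => r * F Z) X = r * step G Λ N F X := by
  unfold step
  rw [drift_const_mul]
  ring

/-- A slowdown for which one step of flip dynamics contracts. -/
lemma exists_slowdown (hq : InRange Δ q) (G : SimpleGraph V) (Λ : Finset V)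
    (hΔ : ∀ v, (Finset.univ.filter (G.Adj v)).card ≤ Δ) :
    ∃ N : ℝ, 1 ≤ N ∧ (∀ X : V → Fin q, ∀ v j, ∑ Z ∈ farFlips G X v j, rate Λ X Z ≤ N) ∧
      ∀ F : (V → Fin q) → ℝ, WtLip G Λ Δ F → ∀ X v j, v ∉ Λ → j ≠ X v →
        step G Λ N F X - step G Λ N F (Function.update X v j) ≤
          (1 - 0.005 / N) * wt G Λ Δ X v j := by
  have hex (p : (V → Fin q) × V × Fin q) : ∃ R : ℝ, 0 ≤ R ∧ (p.2.1 ∉ Λ → p.2.2 ≠ p.1 p.2.1 →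
      ∀ F, WtLip G Λ Δ F →
      drift G Λ F p.1 - drift G Λ F (Function.update p.1 p.2.1 p.2.2) ≤
        R * (wt G Λ Δ p.1 p.2.1 p.2.2 - (F p.1 - F (Function.update p.1 p.2.1 p.2.2))) -
          0.005) := by
    by_cases h : p.2.1 ∉ Λ ∧ p.2.2 ≠ p.1 p.2.1
    · obtain ⟨R, hR, h'⟩ := exists_drift_sub_le hq hΔ h.1 h.2
      exact ⟨R, hR, fun _ _ => h'⟩
    · exact ⟨0, le_rfl, fun h1 h2 => absurd ⟨h1, h2⟩ h⟩
  choose R hR hRF using hex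
  have hfar (p : (V → Fin q) × V × Fin q) : 0 ≤ ∑ Z ∈ farFlips G p.1 p.2.1 p.2.2, rate Λ p.1 Z :=
    Finset.sum_nonneg fun Z _ => rate_nonneg
  set B : (V → Fin q) × V × Fin q → ℝ := fun p =>
    R p + ∑ Z ∈ farFlips G p.1 p.2.1 p.2.2, rate Λ p.1 Z with hB
  have hB0 (p) : 0 ≤ B p := add_nonneg (hR p) (hfar p)
  have hle (p) : B p ≤ 1 + ∑ p, B p := by
    linarith [Finset.single_le_sum (fun p _ => hB0 p) (Finset.mem_univ p)]
  have hN1 : 1 ≤ 1 + ∑ p, B p := by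
    linarith [Finset.sum_nonneg fun p (_ : p ∈ Finset.univ) => hB0 p]
  refine ⟨1 + ∑ p, B p, hN1, fun X v j => ?_, fun F hF X v j hv hj => ?_⟩
  · linarith [hle (X, v, j), hR (X, v, j)]
  · have h1 := hRF (X, v, j) hv hj F hF
    have h2 : R (X, v, j) ≤ 1 + ∑ p, B p := by linarith [hle (X, v, j), hfar (X, v, j)]
    generalize 1 + ∑ p, B p = N at hN1 h2
    have hN0 : 0 < N := by linarith
    have h3 := hF X v j hv hj
    have h4 := wt_le_one (G := G) (Λ := Λ) (Δ := Δ) (X := X) (v := v) (j := j)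
    dsimp only at h1
    set W := wt G Λ Δ X v j
    unfold step
    refine le_of_mul_le_mul_left ?_ hN0
    have e1 : N * ((1 - 0.005 / N) * W) = N * W - 0.005 * W := by field_simp
    have e2 : N * (F X + drift G Λ F X / N -
        (F (Function.update X v j) + drift G Λ F (Function.update X v j) / N)) =
        N * (F X - F (Function.update X v j)) +
        (drift G Λ F X - drift G Λ F (Function.update X v j)) := by field_simp; ring
    rw [e1, e2]
    have := mul_le_mul_of_nonneg_right h2 (sub_nonneg.2 h3)
    linarith

/-- `F` is `K`-Lipschitz at free vertices and `M`-Lipschitz at pinned ones. -/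
def PinLip (G : SimpleGraph V) (Λ : Finset V) (Δ : ℕ) (K M : ℝ) (F : (V → Fin q) → ℝ) : Prop :=
  WtLip G Λ Δ (fun X => K⁻¹ * F X) ∧
    ∀ X v j, v ∈ Λ → F X - F (Function.update X v j) ≤ M

lemma PinLip.sub_le (h : PinLip G Λ Δ K M F) (hK : 0 < K) (hd : Disjoint (diff X Y) Λ) :
    F X - F Y ≤ K * Fintype.card V := by
  have h1 := h.1.hamLip X Y hd
  have h2 : ((diff X Y).card : ℝ) ≤ Fintype.card V := by exact_mod_cast Finset.card_le_univ _
  have h3 : K⁻¹ * (F X - F Y) ≤ Fintype.card V := by linarith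
  rwa [inv_mul_le_iff₀ hK] at h3

lemma exists_pinLip_step (hq : InRange Δ q) (G : SimpleGraph V) (Λ : Finset V)
    (hΔ : ∀ v, (Finset.univ.filter (G.Adj v)).card ≤ Δ) :
    ∃ N : ℝ, 1 ≤ N ∧ ∀ (F : (V → Fin q) → ℝ) (K M : ℝ), 0 < K → PinLip G Λ Δ K M F →
      PinLip G Λ Δ ((1 - 0.005 / N) * K) (M + 2 * Δ * K / N) (step G Λ N F) := by
  obtain ⟨N, hN, hfar, hstep⟩ := exists_slowdown hq G Λ hΔ
  refine ⟨N, hN, fun F K M hK hF => ⟨fun X v j hv hj => ?_, fun X v j hv => ?_⟩⟩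
  · have hN0 : 0 < N := by linarith
    have hκ : 0 < 1 - 0.005 / N := by
      rw [sub_pos, div_lt_one hN0]; linarith
    have h := hstep _ hF.1 X v j hv hj
    rw [step_const_mul, step_const_mul] at h
    rw [mul_inv]
    beta_reduce
    rw [mul_assoc, mul_assoc, ← mul_sub, inv_mul_le_iff₀ hκ]
    exact h
  · have hN0 : 0 < N := by linarith
    have hd := drift_sub_le_of_mem (X := X) (j := j) hΔ hF.1.hamLip hv
    have hs : ∑ Z ∈ farFlips G X v j, rate Λ X Z *
        ((K⁻¹ * F Z - K⁻¹ * F (Function.update Z v j)) -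
          (K⁻¹ * F X - K⁻¹ * F (Function.update X v j))) =
        K⁻¹ * ∑ Z ∈ farFlips G X v j, rate Λ X Z *
        ((F Z - F (Function.update Z v j)) - (F X - F (Function.update X v j))) := by
      rw [Finset.mul_sum]
      exact Finset.sum_congr rfl fun Z _ => by ring
    rw [drift_const_mul, drift_const_mul, hs] at hd
    set D := F X - F (Function.update X v j) with hD
    have hsum : ∑ Z ∈ farFlips G X v j, rate Λ X Z * ((F Z - F (Function.update Z v j)) - D) ≤
        N * (M - D) := by
      calc _ ≤ ∑ Z ∈ farFlips G X v j, rate Λ X Z * (M - D) := by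
            refine Finset.sum_le_sum fun Z _ => mul_le_mul_of_nonneg_left ?_ rate_nonneg
            linarith [hF.2 Z v j hv]
        _ ≤ _ := by
          rw [← Finset.sum_mul]
          exact mul_le_mul_of_nonneg_right (hfar X v j) (sub_nonneg.2 (hF.2 X v j hv))
    have hd' : drift G Λ F X - drift G Λ F (Function.update X v j) ≤ 2 * Δ * K +
        ∑ Z ∈ farFlips G X v j, rate Λ X Z * ((F Z - F (Function.update Z v j)) - D) := by
      have := mul_le_mul_of_nonneg_left hd hK.le
      have e : K * K⁻¹ = 1 := mul_inv_cancel₀ hK.ne'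
      linear_combination this - (drift G Λ F X - drift G Λ F (Function.update X v j) -
        ∑ Z ∈ farFlips G X v j, rate Λ X Z * ((F Z - F (Function.update Z v j)) - D)) * e
    unfold step
    refine le_of_mul_le_mul_left ?_ hN0
    have e1 : N * (M + 2 * Δ * K / N) = N * M + 2 * Δ * K := by field_simp
    have e2 : N * (F X + drift G Λ F X / N -
        (F (Function.update X v j) + drift G Λ F (Function.update X v j) / N)) =
        N * D + (drift G Λ F X - drift G Λ F (Function.update X v j)) := by
      rw [hD]; field_simp; ring
    rw [e1, e2]
    linarith

lemma pinLip_iterate {κ : ℝ} (hκ : 0 < κ) (hN : 0 < N) (hκN : κ = 1 - 0.005 / N)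
    (hstep : ∀ (F : (V → Fin q) → ℝ) (K M : ℝ), 0 < K → PinLip G Λ Δ K M F →
      PinLip G Λ Δ (κ * K) (M + 2 * Δ * K / N) (step G Λ N F))
    (hK : 0 < K) (hF : PinLip G Λ Δ K M F) (t : ℕ) :
    PinLip G Λ Δ (κ ^ t * K) (M + 400 * Δ * K * (1 - κ ^ t)) ((step G Λ N)^[t] F) := by
  induction t with
  | zero => simpa using hF
  | succ t ih =>
    rw [Function.iterate_succ_apply']
    have := hstep _ _ _ (by positivity) ih
    convert this using 1
    · ring
    · rw [pow_succ, hκN]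
      field_simp
      ring

end FlipDynamics

namespace FlipDynamics

set_option linter.unusedSectionVars false

variable {V : Type} [Fintype V] [DecidableEq V] {q : ℕ} {G : SimpleGraph V}
  {X Y Z σ τ : V → Fin q} {u v w x : V} {a b c i j : Fin q} {Λ : Finset V} {Δ : ℕ}
  {F : (V → Fin q) → ℝ} {K M N : ℝ}

/-- The support of the conditional distribution for the pinning `σ` on `Λ`. -/
def extensions (G : SimpleGraph V) (Λ : Finset V) (σ : V → Fin q) : Finset (V → Fin q) :=
  Finset.univ.filter fun X => (∀ v ∈ Λ, X v = σ v) ∧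
    ∀ u w, G.Adj u w → ¬ (u ∈ Λ ∧ w ∈ Λ) → X u ≠ X w

lemma mem_extensions : X ∈ extensions G Λ σ ↔ (∀ v ∈ Λ, X v = σ v) ∧
    ∀ u w, G.Adj u w → ¬ (u ∈ Λ ∧ w ∈ Λ) → X u ≠ X w := by simp [extensions]

lemma exists_color_forall_adj_ne (hq : Δ + 1 ≤ q)
    (hΔ : ∀ v, (Finset.univ.filter (G.Adj v)).card ≤ Δ) (X : V → Fin q) (x : V) :
    ∃ c, ∀ t, G.Adj x t → X t ≠ c := by
  by_contra! h
  have h1 : (Finset.univ : Finset (Fin q)) ⊆ (Finset.univ.filter (G.Adj x)).image X := by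
    intro c _
    obtain ⟨t, ht, htc⟩ := h c
    exact Finset.mem_image.2 ⟨t, by simpa using ht, htc⟩
  have h2 := (Finset.card_le_card h1).trans (Finset.card_image_le.trans (hΔ x))
  rw [Finset.card_univ, Fintype.card_fin] at h2
  omega

lemma extensions_nonempty (hq : Δ + 1 ≤ q)
    (hΔ : ∀ v, (Finset.univ.filter (G.Adj v)).card ≤ Δ) (Λ : Finset V) (σ : V → Fin q) :
    (extensions G Λ σ).Nonempty := by
  suffices h : ∀ T : Finset V, ∃ X : V → Fin q, (∀ v ∈ Λ, X v = σ v) ∧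
      ∀ u w, G.Adj u w → ¬ (u ∈ Λ ∧ w ∈ Λ) → u ∈ Λ ∪ T → w ∈ Λ ∪ T → X u ≠ X w by
    obtain ⟨X, hX, hX'⟩ := h Finset.univ
    exact ⟨X, mem_extensions.2 ⟨hX, fun u w h h' => hX' u w h h' (by simp) (by simp)⟩⟩
  intro T
  induction T using Finset.induction_on with
  | empty =>
    refine ⟨σ, fun _ _ => rfl, fun u w _ hn hu hw => ?_⟩
    rw [Finset.union_empty] at hu hw
    exact absurd ⟨hu, hw⟩ hn
  | insert x T _ ih =>
    obtain ⟨X, hX, hX'⟩ := ih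
    by_cases hx : x ∈ Λ
    · refine ⟨X, hX, fun u w h hn hu hw => hX' u w h hn ?_ ?_⟩
      · rw [Finset.union_insert, Finset.insert_eq_of_mem (Finset.mem_union_left _ hx)] at hu
        exact hu
      · rw [Finset.union_insert, Finset.insert_eq_of_mem (Finset.mem_union_left _ hx)] at hw
        exact hw
    obtain ⟨c, hc⟩ := exists_color_forall_adj_ne hq hΔ X x
    refine ⟨Function.update X x c, fun v hv => ?_, fun u w h hn hu hw => ?_⟩
    · rw [Function.update_of_ne (ne_of_mem_of_not_mem hv hx), hX v hv]
    · rw [Finset.union_insert, Finset.mem_insert] at hu hw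
      by_cases hux : u = x
      · subst hux
        rw [Function.update_self, Function.update_of_ne h.ne']
        exact (hc w h).symm
      · by_cases hwx : w = x
        · subst hwx
          rw [Function.update_self, Function.update_of_ne hux]
          exact hc u h.symm
        · rw [Function.update_of_ne hux, Function.update_of_ne hwx]
          exact hX' u w h hn (hu.resolve_left hux) (hw.resolve_left hwx)

lemma edgeFactor_colAE (u w : V) :
    edgeFactor (colAE q) X s(u, w) = if X u = X w then 0 else 1 := by
  unfold edgeFactor colAE
  rw [Sym2.lift_mk]
  by_cases h : X u = X w
  · simp [h]
  · simp [h, Ne.symm h]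

lemma condWeight_eq : condWeight G (colAE q) (colAV q) Λ σ X =
    if X ∈ extensions G Λ σ then 1 else 0 := by
  unfold condWeight colAV
  rw [Finset.prod_const_one, mul_one]
  by_cases hσ : ∀ v ∈ Λ, X v = σ v
  · rw [if_pos hσ, one_mul]
    by_cases hp : ∀ u w, G.Adj u w → ¬ (u ∈ Λ ∧ w ∈ Λ) → X u ≠ X w
    · rw [if_pos (mem_extensions.2 ⟨hσ, hp⟩)]
      refine Finset.prod_eq_one fun e he => ?_
      induction e using Sym2.inductionOn with
      | _ u w =>
        simp only [Finset.mem_filter, Finset.mem_univ, true_and, SimpleGraph.mem_edgeSet,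
          Sym2.mem_iff, forall_eq_or_imp, forall_eq] at he
        rw [edgeFactor_colAE, if_neg (hp u w he.1 he.2)]
    · rw [if_neg fun h => hp (mem_extensions.1 h).2]
      push Not at hp
      obtain ⟨u, w, huw, hn, hX⟩ := hp
      refine Finset.prod_eq_zero (i := s(u, w)) ?_ (by rw [edgeFactor_colAE, if_pos hX])
      simp only [Finset.mem_filter, Finset.mem_univ, true_and, SimpleGraph.mem_edgeSet,
        Sym2.mem_iff, forall_eq_or_imp, forall_eq]
      exact ⟨huw, fun h => hn h.1 h.2⟩
  · rw [if_neg hσ, zero_mul, if_neg fun h => hσ (mem_extensions.1 h).1]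

lemma condZ_eq : condZ G (colAE q) (colAV q) Λ σ = (extensions G Λ σ).card := by
  unfold condZ
  simp only [condWeight_eq]
  rw [Finset.sum_ite_mem, Finset.univ_inter, Finset.sum_const, nsmul_eq_mul, mul_one]

lemma sum_condDist_mul (F : (V → Fin q) → ℝ) :
    ∑ X, condDist G (colAE q) (colAV q) Λ σ X * F X =
      (∑ X ∈ extensions G Λ σ, F X) / (extensions G Λ σ).card := by
  unfold condDist
  simp only [condWeight_eq, condZ_eq]
  rw [Finset.sum_div, ← Finset.univ_inter (extensions G Λ σ), ← Finset.sum_ite_mem]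
  refine Finset.sum_congr rfl fun X _ => ?_
  rw [Finset.univ_inter]
  split_ifs <;> ring

lemma isDist_condDist (h : (extensions G Λ σ).Nonempty) :
    IsDist (condDist G (colAE q) (colAV q) Λ σ) := by
  constructor
  · intro X
    unfold condDist
    rw [condWeight_eq, condZ_eq]
    split_ifs <;> positivity
  · have := sum_condDist_mul (G := G) (Λ := Λ) (σ := σ) fun _ => 1
    simp only [mul_one, Finset.sum_const, nsmul_eq_mul] at this
    rw [this, div_self]
    exact_mod_cast h.card_pos.ne'

lemma rate_comm : rate Λ X Z = rate Λ Z X := by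
  unfold rate effSize
  rw [diff_comm]

lemma flip_eq_or (hw : w ∈ kempe G X u c) :
    (X w = X u ∧ flip G X u c w = c) ∨ (X w = c ∧ flip G X u c w = X u) := by
  rcases eq_or_eq_of_mem_kempe hw with h | h
  · exact Or.inl ⟨h, flip_of_eq hw h⟩
  · exact Or.inr ⟨h, flip_of_eq' hw h⟩

lemma flip_mem_extensions (hX : X ∈ extensions G Λ σ) (hc : c ≠ X u)
    (hd : Disjoint (kempe G X u c) Λ) : flip G X u c ∈ extensions G Λ σ := by
  rw [mem_extensions] at hX ⊢
  have hb (s t : V) (hst : G.Adj s t) (hn : ¬ (s ∈ Λ ∧ t ∈ Λ)) (hs : s ∈ kempe G X u c)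
      (ht : t ∉ kempe G X u c) : flip G X u c s ≠ flip G X u c t := by
    have hne := hX.2 s t hst hn
    rw [flip_of_notMem ht]
    intro h
    refine ht (mem_kempe_of_altAdj hs ⟨hst, ?_⟩)
    rcases flip_eq_or hs with h1 | h1
    · exact Or.inl ⟨h1.1, by rw [← h, h1.2]⟩
    · exact Or.inr ⟨h1.1, by rw [← h, h1.2]⟩
  refine ⟨fun v hv => ?_, fun s t hst hn => ?_⟩
  · rw [flip_of_notMem (Finset.disjoint_right.1 hd hv), hX.1 v hv]
  · by_cases hs : s ∈ kempe G X u c <;> by_cases ht : t ∈ kempe G X u c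
    · have hne := hX.2 s t hst hn
      rcases flip_eq_or hs with h1 | h1 <;> rcases flip_eq_or ht with h2 | h2
      · exact absurd (h1.1.trans h2.1.symm) hne
      · rw [h1.2, h2.2]; exact hc
      · rw [h1.2, h2.2]; exact hc.symm
      · exact absurd (h1.1.trans h2.1.symm) hne
    · exact hb s t hst hn hs ht
    · exact (hb t s hst.symm (fun h => hn h.symm) ht hs).symm
    · rw [flip_of_notMem hs, flip_of_notMem ht]
      exact hX.2 s t hst hn

lemma mem_flips_flip (hX : X ∈ extensions G Λ σ) (hc : c ≠ X u)
    (hd : Disjoint (kempe G X u c) Λ) : X ∈ flips G (flip G X u c) := by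
  set Z := flip G X u c with hZ
  have hZu : Z u = c := flip_self
  have h1 : ∀ s ∈ kempe G X u c, s ∈ kempe G Z u (X u) := by
    refine kempe_induction self_mem_kempe fun s hs hsZ t hst => ?_
    have ht := mem_kempe_of_altAdj hs hst
    refine mem_kempe_of_altAdj hsZ ⟨hst.1, ?_⟩
    rw [hZu]
    rcases hst.2 with h | h
    · exact Or.inl ⟨flip_of_eq hs h.1, flip_of_eq' ht h.2⟩
    · exact Or.inr ⟨flip_of_eq' hs h.1, flip_of_eq ht h.2⟩
  have h2 : ∀ s ∈ kempe G Z u (X u), s ∈ kempe G X u c := by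
    refine kempe_induction self_mem_kempe fun s _ hs t hst => ?_
    by_contra ht
    have hne := (mem_extensions.1 (flip_mem_extensions hX hc hd)).2 s t hst.1
      fun h => Finset.disjoint_left.1 hd hs h.1
    have hneX := (mem_extensions.1 hX).2 s t hst.1 fun h => Finset.disjoint_left.1 hd hs h.1
    have h := hst.2
    rw [hZu, hZ, flip_of_notMem ht] at h
    rcases flip_eq_or hs with h3 | h3
    · rcases h with h | h
      · exact hneX (h3.1.trans h.2.symm)
      · exact hc (h3.2.symm.trans h.1)
    · rcases h with h | h
      · exact hc (h.1.symm.trans h3.2)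
      · exact hneX (h3.1.trans h.2.symm)
  have hk : kempe G Z u (X u) = kempe G X u c := Finset.ext fun s => ⟨h2 s, h1 s⟩
  have hfl : flip G Z u (X u) = X := by
    ext1 s
    by_cases hs : s ∈ kempe G X u c
    · rcases flip_eq_or hs with h | h
      · rw [flip_of_eq (hk ▸ hs) (by rw [hZu]; exact h.2), h.1]
      · rw [flip_of_eq' (hk ▸ hs) h.2, flip_self, h.1]
    · rw [flip_of_notMem (hk ▸ hs), hZ, flip_of_notMem hs]
  have := flip_mem_flips (G := G) (X := Z) (u := u) (c := X u) (by rw [hZu]; exact hc.symm)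
  rwa [hfl] at this

lemma mem_extensions_of_rate_ne_zero (hX : X ∈ extensions G Λ σ) (hZ : Z ∈ flips G X)
    (hr : rate Λ X Z ≠ 0) : Z ∈ extensions G Λ σ ∧ X ∈ flips G Z := by
  obtain ⟨u, hu⟩ := exists_ne_of_mem_flips hZ
  have he := eq_flip_of_mem_flips hZ hu
  have hd := disjoint_of_rate_ne_zero hr
  rw [he, diff_flip hu] at hd
  rw [he]
  exact ⟨flip_mem_extensions hX hu hd, mem_flips_flip hX hu hd⟩

/-- The uniform distribution is stationary under flip dynamics. -/
lemma sum_drift_eq_zero : ∑ X ∈ extensions G Λ σ, drift G Λ F X = 0 := by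
  set A : (V → Fin q) → (V → Fin q) → ℝ := fun X Z => if Z ∈ flips G X then rate Λ X Z else 0
    with hA
  have hsub (X : V → Fin q) (hX : X ∈ extensions G Λ σ) :
      drift G Λ F X = ∑ Z ∈ extensions G Λ σ, A X Z * (F Z - F X) := by
    unfold drift
    have h1 : ∑ Z ∈ flips G X, rate Λ X Z * (F Z - F X) = ∑ Z, A X Z * (F Z - F X) := by
      rw [← Finset.univ_inter (flips G X), ← Finset.sum_ite_mem]
      refine Finset.sum_congr rfl fun Z _ => ?_
      rw [hA, ite_mul, zero_mul]
    rw [h1]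
    symm
    refine Finset.sum_subset (Finset.subset_univ _) fun Z _ hZ => ?_
    rw [hA]
    beta_reduce
    split_ifs with hf
    · by_cases hr : rate Λ X Z = 0
      · rw [hr, zero_mul]
      · exact absurd (mem_extensions_of_rate_ne_zero hX hf hr).1 hZ
    · rw [zero_mul]
  have hsymm (X Z : V → Fin q) (hX : X ∈ extensions G Λ σ) (hZ : Z ∈ extensions G Λ σ) :
      A X Z = A Z X := by
    have aux (X Z : V → Fin q) (hX : X ∈ extensions G Λ σ) (hr : rate Λ X Z ≠ 0)
        (h : Z ∈ flips G X) : X ∈ flips G Z := (mem_extensions_of_rate_ne_zero hX h hr).2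
    rw [hA]
    beta_reduce
    by_cases hr : rate Λ X Z = 0
    · rw [rate_comm (X := Z), hr, ite_self, ite_self]
    · rw [rate_comm (X := Z)]
      exact if_congr ⟨aux X Z hX hr, aux Z X hZ (rate_comm (X := X) ▸ hr)⟩ rfl rfl
  rw [Finset.sum_congr rfl hsub]
  have h2 : ∑ X ∈ extensions G Λ σ, ∑ Z ∈ extensions G Λ σ, A X Z * (F Z - F X) =
      -∑ X ∈ extensions G Λ σ, ∑ Z ∈ extensions G Λ σ, A X Z * (F Z - F X) := by
    conv_lhs => rw [Finset.sum_comm]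
    rw [← Finset.sum_neg_distrib]
    refine Finset.sum_congr rfl fun Z hZ => ?_
    rw [← Finset.sum_neg_distrib]
    refine Finset.sum_congr rfl fun X hX => ?_
    rw [hsymm X Z hX hZ]
    ring
  linarith

lemma sum_step_iterate (t : ℕ) :
    ∑ X ∈ extensions G Λ σ, (step G Λ N)^[t] F X = ∑ X ∈ extensions G Λ σ, F X := by
  induction t with
  | zero => rfl
  | succ t ih =>
    rw [Function.iterate_succ_apply', ← ih]
    unfold step
    rw [Finset.sum_add_distrib, ← Finset.sum_div, sum_drift_eq_zero, zero_div, add_zero]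

lemma average_sub_average_le {α : Type*} {S T : Finset α} (hS : S.Nonempty) (hT : T.Nonempty)
    {F : α → ℝ} {C : ℝ} (h : ∀ x ∈ S, ∀ y ∈ T, F x - F y ≤ C) :
    (∑ x ∈ S, F x) / S.card - (∑ y ∈ T, F y) / T.card ≤ C := by
  obtain ⟨x, hx, hxmax⟩ := S.exists_max_image F hS
  obtain ⟨y, hy, hymin⟩ := T.exists_min_image F hT
  have hS0 : (0 : ℝ) < S.card := by exact_mod_cast hS.card_pos
  have hT0 : (0 : ℝ) < T.card := by exact_mod_cast hT.card_pos
  have h1 : (∑ x ∈ S, F x) / S.card ≤ F x := by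
    rw [div_le_iff₀ hS0, mul_comm, ← nsmul_eq_mul]
    exact Finset.sum_le_card_nsmul _ _ _ hxmax
  have h2 : F y ≤ (∑ y ∈ T, F y) / T.card := by
    rw [le_div_iff₀ hT0, mul_comm, ← nsmul_eq_mul]
    exact Finset.card_nsmul_le_sum _ _ _ hymin
  linarith [h x hx y hy]

lemma average_sub_average_le_of_pinLip (hq : InRange Δ q)
    (hΔ : ∀ v, (Finset.univ.filter (G.Adj v)).card ≤ Δ) (hd : DifferOnlyAt Λ σ τ v)
    (hK : 0 < K) (hF : PinLip G Λ Δ K M F) :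
    (∑ X ∈ extensions G Λ σ, F X) / (extensions G Λ σ).card -
      (∑ X ∈ extensions G Λ τ, F X) / (extensions G Λ τ).card ≤ M + 400 * Δ * K := by
  obtain ⟨N, hN, hstep⟩ := exists_pinLip_step hq G Λ hΔ
  have hN0 : 0 < N := by linarith
  set κ := 1 - 0.005 / N with hκN
  have hκ : 0 < κ := by
    rw [hκN, sub_pos, div_lt_one hN0]; linarith
  have hκ1 : κ < 1 := by
    have : 0 < 0.005 / N := by positivity
    linarith
  obtain ⟨hvΛ, -, hoff⟩ := hd
  have ht (t : ℕ) : (∑ X ∈ extensions G Λ σ, F X) / (extensions G Λ σ).card -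
      (∑ X ∈ extensions G Λ τ, F X) / (extensions G Λ τ).card ≤
      M + 400 * Δ * K * (1 - κ ^ t) + κ ^ t * K * Fintype.card V := by
    have hFt := pinLip_iterate hκ hN0 hκN hstep hK hF t
    rw [← sum_step_iterate (N := N) t, ← sum_step_iterate (σ := τ) (N := N) t]
    refine average_sub_average_le (extensions_nonempty hq.succ_le hΔ Λ σ)
      (extensions_nonempty hq.succ_le hΔ Λ τ) fun X hX Y hY => ?_
    have h1 := hFt.2 X v (τ v) hvΛ
    have h2 := hFt.sub_le (X := Function.update X v (τ v)) (Y := Y) (by positivity) ?_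
    · linarith
    · rw [Finset.disjoint_left]
      intro s hs hsΛ
      rw [mem_diff] at hs
      refine hs ?_
      rw [(mem_extensions.1 hY).1 s hsΛ]
      by_cases hsv : s = v
      · rw [hsv, Function.update_self]
      · rw [Function.update_of_ne hsv, (mem_extensions.1 hX).1 s hsΛ, hoff s hsΛ hsv]
  have hlim : Filter.Tendsto (fun t : ℕ =>
      M + 400 * Δ * K * (1 - κ ^ t) + κ ^ t * K * Fintype.card V) Filter.atTop
      (nhds (M + 400 * Δ * K * (1 - 0) + 0 * K * Fintype.card V)) := by
    have h0 := tendsto_pow_atTop_nhds_zero_of_lt_one hκ.le hκ1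
    exact (((h0.const_sub 1).const_mul _).const_add _).add ((h0.mul_const _).mul_const _)
  have := ge_of_tendsto' hlim ht
  linarith

lemma hamming_self (X : V → Fin q) : hamming X X = 0 := by simp [hamming]

lemma hamming_nonneg (X Y : V → Fin q) : 0 ≤ hamming X Y := by unfold hamming; positivity

lemma hamming_triangle (X Y Z : V → Fin q) : hamming X Z ≤ hamming X Y + hamming Y Z := by
  unfold hamming
  have : (Finset.univ.filter fun w => X w ≠ Z w) ⊆
      (Finset.univ.filter fun w => X w ≠ Y w) ∪ Finset.univ.filter fun w => Y w ≠ Z w := by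
    intro w
    simp only [Finset.mem_filter, Finset.mem_univ, true_and, Finset.mem_union]
    intro h
    by_contra hn
    push Not at hn
    exact h (hn.1.trans hn.2)
  exact_mod_cast (Finset.card_le_card this).trans (Finset.card_union_le _ _)

lemma hamming_update_le (X : V → Fin q) (v : V) (j : Fin q) :
    hamming X (Function.update X v j) ≤ 1 := by
  unfold hamming
  have : (Finset.univ.filter fun w => X w ≠ Function.update X v j w) ⊆ {v} := by
    intro w hw
    rw [Finset.mem_singleton]
    by_contra h
    rw [Finset.mem_filter, Function.update_of_ne h] at hw
    exact hw.2 rfl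
  exact_mod_cast (Finset.card_le_card this).trans (Finset.card_singleton v).le

lemma pinLip_of_hamming (hΔ : ∀ v, (Finset.univ.filter (G.Adj v)).card ≤ Δ)
    (hF : ∀ X Y, F X - F Y ≤ hamming X Y) : PinLip G Λ Δ 1.05 1 F := by
  refine ⟨fun X v j _ _ => ?_, fun X v j _ => (hF _ _).trans (hamming_update_le X v j)⟩
  have h1 := (hF _ _).trans (hamming_update_le X v j)
  have h2 := le_wt (Λ := Λ) (X := X) (v := v) (j := j) hΔ
  norm_num at h2 ⊢
  linarith

/-- Coupling independence of colourings, with an explicit constant. -/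
lemma wass_condDist_le (hq : InRange Δ q)
    (hΔ : ∀ v, (Finset.univ.filter (G.Adj v)).card ≤ Δ) (hd : DifferOnlyAt Λ σ τ v) :
    Wass hamming (condDist G (colAE q) (colAV q) Λ σ) (condDist G (colAE q) (colAV q) Λ τ) ≤
      1 + 420 * Δ := by
  refine wass_le_of_lipschitz hamming_self hamming_nonneg hamming_triangle
    (isDist_condDist (extensions_nonempty hq.succ_le hΔ Λ σ))
    (isDist_condDist (extensions_nonempty hq.succ_le hΔ Λ τ)) fun F hF => ?_
  rw [sum_condDist_mul, sum_condDist_mul]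
  have := average_sub_average_le_of_pinLip hq hΔ hd (by norm_num) (pinLip_of_hamming hΔ hF)
  linarith

end FlipDynamics

/-- coupling independence `C = a·(qΔ)^k` for proper `q`-colourings when
`Δ ≥ 125, q ≥ 1.809Δ` or `Δ ≥ 3, q ≥ (11/6 − ε₀)Δ`. -/
theorem coupling_independence_colourings :
    ∃ ε₀ : ℝ, 0 < ε₀ ∧ ∃ a : ℝ, 0 < a ∧ ∃ k : ℕ, 0 < k ∧
      ∀ (Δ q : ℕ) (V : Type) [Fintype V] [DecidableEq V]
        (G : SimpleGraph V) [DecidableRel G.Adj],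
        (∀ v : V, G.degree v ≤ Δ) →
        ((125 ≤ Δ ∧ (1.809 : ℝ) * Δ ≤ q) ∨
          (3 ≤ Δ ∧ ((11 : ℝ) / 6 - ε₀) * Δ ≤ q)) →
        CouplingIndependence G (colAE q) (colAV q) (a * ((q * Δ : ℕ) : ℝ) ^ k) := by
  refine ⟨1 / 1000, by norm_num, 421, by norm_num, 1, one_pos, ?_⟩
  intro Δ q V _ _ G _ hdeg hrange Λ σ τ v hd
  have hq := FlipDynamics.InRange.of_le hrange
  have hΔ (v : V) : (@Finset.filter V (G.Adj v) (Classical.decPred _) Finset.univ).card ≤ Δ := by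
    refine le_trans (le_of_eq ?_) (hdeg v)
    rw [← SimpleGraph.card_neighborFinset_eq_degree]
    congr 1
    ext w
    simp
  refine (FlipDynamics.wass_condDist_le hq hΔ hd).trans ?_
  have h1 : (1 : ℝ) ≤ Δ := by exact_mod_cast (by have := hq.three_le; omega : 1 ≤ Δ)
  have h2 : (1 : ℝ) ≤ q := by exact_mod_cast (by have := hq.succ_le; omega : 1 ≤ q)
  push_cast
  nlinarith
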